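/- arXiv:2411.19920 — 5 statements merged into one kernel-verified Lean document; each statement's English description precedes it below -/
import Mathlib

section
/- Let k be a field, N ≥ 1, d ∈ ℕ^{N+1}, and let A_* = (A_1,…,A_N) and A'_* = (A'_1,…,A'_N) be two tuples in Rep_d(k) such that rank(A_j ⋯ A_{i+1}) = rank(A'_j ⋯ A'_{i+1}) for all 0 ≤ i < j ≤ N. Then there exist invertible matrices P_i ∈ GL_{d_i}(k) for i = 0,…,N with A'_i = P_i A_i P_{i−1}^{−1} for all 1 ≤ i ≤ N. (The G-orbits of Rep_d(k) are exactly the loci of tuples with a fixed rank pattern.) -/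
/-- The product `A_j ⋯ A_{i+2} A_{i+1}` (a segment of length `n` starting at vertex `i`)
of a tuple of composable matrices. -/
def matProdSeg (k : Type) [Field k] (d : ℕ → ℕ)
    (A : ∀ i : ℕ, Matrix (Fin (d (i + 1))) (Fin (d i)) k) (i : ℕ) :
    ∀ n : ℕ, Matrix (Fin (d (i + n))) (Fin (d i)) k
  | 0 => (1 : Matrix (Fin (d i)) (Fin (d i)) k)
  | n + 1 => A (i + n) * matProdSeg k d A i n

section LinearAlgebra

variable {K V V' W : Type*} [Field K] [AddCommGroup V] [Module K V] [AddCommGroup V'] [Module K V']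
  [AddCommGroup W] [Module K W]

/-- Linear maps prescribed on two disjoint subspaces can be glued to a map on the whole space. -/
theorem LinearMap.exists_eqOn_of_disjoint {P Q : Submodule K V} (h : Disjoint P Q)
    (a b : V →ₗ[K] V') : ∃ H : V →ₗ[K] V', (∀ x ∈ P, H x = a x) ∧ ∀ x ∈ Q, H x = b x := by
  obtain ⟨P', hP, hc⟩ := h.exists_isCompl
  refine ⟨LinearMap.ofIsCompl hc (a.domRestrict P') (b.domRestrict Q), fun x hx => ?_,
    fun x hx => ?_⟩
  · exact LinearMap.ofIsCompl_apply_left hc (φ := a.domRestrict P')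
      (ψ := b.domRestrict Q) ⟨x, hP hx⟩
  · exact LinearMap.ofIsCompl_apply_right hc (φ := a.domRestrict P')
      (ψ := b.domRestrict Q) ⟨x, hx⟩

/-- If `f` maps `F` into the image of `F'` under `f'`, then `f` lifts on `F` to a linear map
into `F'`. -/
theorem LinearMap.exists_lift_on {F : Submodule K V} {F' : Submodule K V'} {f : V →ₗ[K] W}
    {f' : V' →ₗ[K] W} (h : F.map f ≤ F'.map f') :
    ∃ l : V →ₗ[K] V', ∀ x ∈ F, l x ∈ F' ∧ f' (l x) = f x := by
  obtain ⟨l, hl⟩ := Module.projective_lifting_property (f'.submoduleMap F')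
    ((f.domRestrict F).codRestrict (F'.map f') fun x => h ⟨x, x.2, rfl⟩)
    (f'.submoduleMap_surjective F')
  obtain ⟨L, hL⟩ := (F'.subtype ∘ₗ l).exists_extend
  refine ⟨L, fun x hx => ?_⟩
  have h1 : L x = l ⟨x, hx⟩ := LinearMap.congr_fun hL ⟨x, hx⟩
  rw [h1]
  exact ⟨(l ⟨x, hx⟩).2, congrArg Subtype.val (LinearMap.congr_fun hl ⟨x, hx⟩)⟩

theorem LinearMap.finrank_map_add_finrank_inf_ker [FiniteDimensional K V] (f : V →ₗ[K] W)
    (F : Submodule K V) :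
    Module.finrank K (F.map f) + Module.finrank K (F ⊓ LinearMap.ker f : Submodule K V) =
      Module.finrank K F := by
  have h := (f.domRestrict F).finrank_range_add_finrank_ker
  rwa [LinearMap.range_domRestrict, LinearMap.ker_domRestrict,
    ← Submodule.finrank_map_subtype_eq, Submodule.map_comap_subtype] at h

theorem LinearMap.finrank_map_of_forall_eq_zero [FiniteDimensional K V] (f : V →ₗ[K] W)
    (F : Submodule K V) (h : ∀ x ∈ F, f x = 0 → x = 0) :
    Module.finrank K (F.map f) = Module.finrank K F := by
  have h0 : F ⊓ LinearMap.ker f = ⊥ :=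
    (Submodule.eq_bot_iff _).2 fun x hx => h x hx.1 hx.2
  rw [← f.finrank_map_add_finrank_inf_ker F, h0, finrank_bot, add_zero]

/-- A linear map `γ` that carries `C` isomorphically to `C'`, when the dimensions agree. -/
theorem LinearMap.exists_forall_mem_of_finrank_eq [FiniteDimensional K V] [FiniteDimensional K V']
    {C : Submodule K V} {C' : Submodule K V'} (h : Module.finrank K C = Module.finrank K C') :
    ∃ γ : V →ₗ[K] V', ∀ x ∈ C, γ x ∈ C' ∧ (γ x = 0 → x = 0) := by
  let e := LinearEquiv.ofFinrankEq C C' h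
  obtain ⟨γ, hγ⟩ := (C'.subtype ∘ₗ e.toLinearMap).exists_extend
  refine ⟨γ, fun x hx => ?_⟩
  have h1 : γ x = e ⟨x, hx⟩ := LinearMap.congr_fun hγ ⟨x, hx⟩
  rw [h1]
  refine ⟨(e ⟨x, hx⟩).2, fun h0 => ?_⟩
  have h2 : e ⟨x, hx⟩ = 0 := Subtype.ext h0
  simpa using h2

/-- An injective partial lift of `f` through `f'`, defined on `U ≤ F` with values in `F'`,
extends to an isomorphism `F ≃ F'` over `W`, as soon as `F` and `F'` have the same dimension
and the same image in `W`. -/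
theorem LinearMap.exists_extend_lift [FiniteDimensional K V] [FiniteDimensional K V']
    {f : V →ₗ[K] W} {f' : V' →ₗ[K] W} {U F : Submodule K V} {F' : Submodule K V'} (hUF : U ≤ F)
    (hF : Module.finrank K F = Module.finrank K F') (hmap : F.map f = F'.map f')
    (H₀ : V →ₗ[K] V') (hmem : ∀ x ∈ U, H₀ x ∈ F') (hlift : ∀ x ∈ U, f' (H₀ x) = f x)
    (hinj : ∀ x ∈ U, H₀ x = 0 → x = 0) :
    ∃ H : V →ₗ[K] V', (∀ x ∈ U, H x = H₀ x) ∧ (∀ x ∈ F, f' (H x) = f x) ∧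
      (∀ x ∈ F, H x = 0 → x = 0) ∧ F.map H = F' := by
  obtain ⟨C, hAC, hACs⟩ := IsModularLattice.exists_disjoint_and_sup_eq
    (inf_le_inf_right (LinearMap.ker f) hUF)
  have hA' : (U ⊓ LinearMap.ker f).map H₀ ≤ F' ⊓ LinearMap.ker f' := by
    rintro _ ⟨x, hx, rfl⟩
    exact ⟨hmem x hx.1, (hlift x hx.1).trans hx.2⟩
  obtain ⟨C', hAC', hACs'⟩ := IsModularLattice.exists_disjoint_and_sup_eq hA'
  have hCC' : Module.finrank K C = Module.finrank K C' := by
    have h1 := Submodule.finrank_sup_add_finrank_inf_eq (U ⊓ LinearMap.ker f) C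
    have h2 := Submodule.finrank_sup_add_finrank_inf_eq ((U ⊓ LinearMap.ker f).map H₀) C'
    rw [hAC.eq_bot, hACs, finrank_bot] at h1
    rw [hAC'.eq_bot, hACs', finrank_bot,
      H₀.finrank_map_of_forall_eq_zero (U ⊓ LinearMap.ker f) fun x hx => hinj x hx.1] at h2
    have h3 := f.finrank_map_add_finrank_inf_ker F
    have h4 := f'.finrank_map_add_finrank_inf_ker F'
    rw [hmap] at h3
    omega
  have hC : C ≤ F ⊓ LinearMap.ker f := hACs ▸ le_sup_right
  have hC' : C' ≤ F' ⊓ LinearMap.ker f' := hACs' ▸ le_sup_right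
  obtain ⟨γ, hγ⟩ := LinearMap.exists_forall_mem_of_finrank_eq hCC'
  obtain ⟨l, hl⟩ := LinearMap.exists_lift_on hmap.le
  have hUC : Disjoint U C := by
    rw [Submodule.disjoint_def] at hAC ⊢
    exact fun x hx hxC => hAC x ⟨hx, (hC hxC).2⟩ hxC
  obtain ⟨D, hD, hDs⟩ := IsModularLattice.exists_disjoint_and_sup_eq
    (sup_le hUF (hC.trans inf_le_left))
  obtain ⟨H₁, hH₁U, hH₁C⟩ := LinearMap.exists_eqOn_of_disjoint hUC H₀ γ
  obtain ⟨H, hHUC, hHD⟩ := LinearMap.exists_eqOn_of_disjoint hD H₁ l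
  have hHU : ∀ x ∈ U, H x = H₀ x := fun x hx =>
    (hHUC x (Submodule.mem_sup_left hx)).trans (hH₁U x hx)
  have hHC : ∀ x ∈ C, H x = γ x := fun x hx =>
    (hHUC x (Submodule.mem_sup_right hx)).trans (hH₁C x hx)
  have hDF : D ≤ F := hDs ▸ le_sup_right
  have key : ∀ x ∈ F, H x ∈ F' ∧ f' (H x) = f x := by
    intro x hx
    rw [← hDs] at hx
    obtain ⟨y, hy, z, hz, rfl⟩ := Submodule.mem_sup.1 hx
    obtain ⟨u, hu, c, hc, rfl⟩ := Submodule.mem_sup.1 hy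
    have hγc := hC' (hγ c hc).1
    have h1 : f' (γ c) = 0 := hγc.2
    have h2 : f c = 0 := (hC hc).2
    simp only [map_add, hHU u hu, hHC c hc, hHD z hz, hlift u hu, h1, h2, (hl z (hDF hz)).2,
      and_true]
    exact F'.add_mem (F'.add_mem (hmem u hu) hγc.1) (hl z (hDF hz)).1
  have hHinj : ∀ x ∈ F, H x = 0 → x = 0 := by
    intro x hx h0
    have hxK : x ∈ F ⊓ LinearMap.ker f :=
      ⟨hx, (key x hx).2.symm.trans (by rw [h0, map_zero])⟩
    rw [← hACs] at hxK
    obtain ⟨a, ha, c, hc, rfl⟩ := Submodule.mem_sup.1 hxK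
    rw [map_add, hHU a ha.1, hHC c hc] at h0
    have h1 : H₀ a = 0 := by
      refine (Submodule.disjoint_def.1 hAC') _ ⟨a, ha, rfl⟩ ?_
      rw [eq_neg_of_add_eq_zero_left h0]
      exact C'.neg_mem (hγ c hc).1
    rw [h1, zero_add] at h0
    rw [hinj a ha.1 h1, (hγ c hc).2 h0, add_zero]
  refine ⟨H, hHU, fun x hx => (key x hx).2, hHinj, Submodule.eq_of_le_of_finrank_eq ?_ ?_⟩
  · rintro _ ⟨x, hx, rfl⟩
    exact (key x hx).1
  · rw [H.finrank_map_of_forall_eq_zero F hHinj, hF]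

/-- Two flags with the same dimensions and the same images in `W` are related by an isomorphism
over `W`. -/
theorem LinearMap.exists_lift_flag [FiniteDimensional K V] [FiniteDimensional K V']
    {f : V →ₗ[K] W} {f' : V' →ₗ[K] W} {F : ℕ → Submodule K V} {F' : ℕ → Submodule K V'}
    (hF : Monotone F) (hF' : Monotone F') (n : ℕ)
    (hrank : ∀ i ≤ n, Module.finrank K (F i) = Module.finrank K (F' i))
    (hmap : ∀ i ≤ n, (F i).map f = (F' i).map f') :
    ∃ H : V →ₗ[K] V', (∀ x ∈ F n, f' (H x) = f x) ∧ (∀ x ∈ F n, H x = 0 → x = 0) ∧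
      ∀ i ≤ n, (F i).map H = F' i := by
  induction n with
  | zero =>
    obtain ⟨H, -, h1, h2, h3⟩ := LinearMap.exists_extend_lift (U := ⊥) bot_le
      (hrank 0 le_rfl) (hmap 0 le_rfl) 0 (by simp) (by simp) (by simp)
    refine ⟨H, h1, h2, fun i hi => ?_⟩
    rwa [Nat.le_zero.1 hi]
  | succ n ih =>
    obtain ⟨H₀, h1, h2, h3⟩ := ih (fun i hi => hrank i (hi.trans n.le_succ))
      (fun i hi => hmap i (hi.trans n.le_succ))
    obtain ⟨H, h0, h1', h2', h3'⟩ := LinearMap.exists_extend_lift (hF n.le_succ)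
      (hrank _ le_rfl) (hmap _ le_rfl) H₀
      (fun x hx => hF' n.le_succ (h3 n le_rfl ▸ Submodule.mem_map_of_mem hx)) h1 h2
    refine ⟨H, h1', h2', fun i hi => ?_⟩
    rcases Nat.le_succ_iff.1 hi with hi | rfl
    · rw [← h3 i hi]
      ext y
      simp only [Submodule.mem_map]
      exact exists_congr fun x => and_congr_right fun hx => by rw [h0 x (hF hi hx)]
    · exact h3'

end LinearAlgebra

section Chain

variable {K : Type*} [Field K] {V : ℕ → Type*} [∀ i, AddCommGroup (V i)] [∀ i, Module K (V i)]

/-- The image of `V i` in `V n` under the composite of the maps `f` (all of `V n` if `n ≤ i`). -/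
def imageFlag (f : ∀ i, V i →ₗ[K] V (i + 1)) : ∀ n : ℕ, ℕ → Submodule K (V n)
  | 0, _ => ⊤
  | n + 1, i => if i ≤ n then (imageFlag f n i).map (f n) else ⊤

theorem imageFlag_of_le (f : ∀ i, V i →ₗ[K] V (i + 1)) {n i : ℕ} (h : n ≤ i) :
    imageFlag f n i = ⊤ := by
  cases n with
  | zero => rfl
  | succ n => exact if_neg (by omega)

theorem imageFlag_succ (f : ∀ i, V i →ₗ[K] V (i + 1)) {n i : ℕ} (h : i ≤ n) :
    imageFlag f (n + 1) i = (imageFlag f n i).map (f n) :=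
  if_pos h

theorem imageFlag_mono (f : ∀ i, V i →ₗ[K] V (i + 1)) (n : ℕ) : Monotone (imageFlag f n) := by
  induction n with
  | zero => exact fun _ _ _ => le_rfl
  | succ n ih =>
    intro i j hij
    by_cases hj : j ≤ n
    · rw [imageFlag_succ f hj, imageFlag_succ f (hij.trans hj)]
      exact Submodule.map_mono (ih hij)
    · rw [imageFlag_of_le f (Nat.lt_of_not_le hj)]
      exact le_top

variable [∀ i, FiniteDimensional K (V i)]

/-- An automorphism of the last space that matches the flags of images extends to an
isomorphism of chains, provided that the rank patterns agree. -/
theorem exists_chain_equiv_of_map_imageFlag (f f' : ∀ i, V i →ₗ[K] V (i + 1)) (n : ℕ)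
    (hrank : ∀ m ≤ n, ∀ i ≤ m,
      Module.finrank K (imageFlag f m i) = Module.finrank K (imageFlag f' m i))
    (g : V n ≃ₗ[K] V n)
    (hg : ∀ i ≤ n, (imageFlag f n i).map g.toLinearMap = imageFlag f' n i) :
    ∃ P : ∀ i, V i ≃ₗ[K] V i, P n = g ∧ ∀ i < n, ∀ x, P (i + 1) (f i x) = f' i (P i x) := by
  induction n with
  | zero => exact ⟨Function.update (fun i => LinearEquiv.refl K (V i)) 0 g, by simp, by simp⟩
  | succ n ih =>
    obtain ⟨H, h1, h2, h3⟩ := LinearMap.exists_lift_flag (f := g.toLinearMap ∘ₗ f n)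
      (f' := f' n) (imageFlag_mono f n) (imageFlag_mono f' n) n (hrank n n.le_succ)
      (fun i hi => by
        rw [Submodule.map_comp, ← imageFlag_succ f hi, ← imageFlag_succ f' hi,
          hg i (hi.trans n.le_succ)])
    have htop : ∀ x, x ∈ imageFlag f n n := fun x => by
      rw [imageFlag_of_le f le_rfl]
      exact Submodule.mem_top
    have hinj : Function.Injective H :=
      (injective_iff_map_eq_zero H).2 fun x => h2 x (htop x)
    have hcoe : (LinearEquiv.ofInjectiveEndo H hinj).toLinearMap = H := LinearMap.ext fun _ => rfl
    obtain ⟨P, hP, hPc⟩ := ih (fun m hm => hrank m (hm.trans n.le_succ))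
      (LinearEquiv.ofInjectiveEndo H hinj) (by rwa [hcoe])
    refine ⟨Function.update P (n + 1) g, by simp, fun i hi x => ?_⟩
    rw [Function.update_of_ne (by omega : i ≠ n + 1)]
    rcases Nat.lt_succ_iff_lt_or_eq.1 hi with hi | rfl
    · rw [Function.update_of_ne (by omega : i + 1 ≠ n + 1)]
      exact hPc i hi x
    · rw [Function.update_self, hP]
      exact (h1 x (htop x)).symm

/-- Two chains of linear maps with the same rank pattern are isomorphic. -/
theorem exists_chain_equiv_of_finrank_eq (f f' : ∀ i, V i →ₗ[K] V (i + 1)) (n : ℕ)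
    (hrank : ∀ m ≤ n, ∀ i ≤ m,
      Module.finrank K (imageFlag f m i) = Module.finrank K (imageFlag f' m i)) :
    ∃ P : ∀ i, V i ≃ₗ[K] V i, ∀ i < n, ∀ x, P (i + 1) (f i x) = f' i (P i x) := by
  obtain ⟨H, -, h2, h3⟩ := LinearMap.exists_lift_flag (f := (0 : V n →ₗ[K] V n))
    (f' := (0 : V n →ₗ[K] V n)) (imageFlag_mono f n) (imageFlag_mono f' n) n (hrank n le_rfl)
    (fun i _ => by simp)
  have hinj : Function.Injective H := (injective_iff_map_eq_zero H).2 fun x =>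
    h2 x (by rw [imageFlag_of_le f le_rfl]; exact Submodule.mem_top)
  have hcoe : (LinearEquiv.ofInjectiveEndo H hinj).toLinearMap = H := LinearMap.ext fun _ => rfl
  obtain ⟨P, -, hP⟩ := exists_chain_equiv_of_map_imageFlag f f' n hrank
    (LinearEquiv.ofInjectiveEndo H hinj) (by rwa [hcoe])
  exact ⟨P, hP⟩

end Chain

theorem range_mulVecLin_matProdSeg (k : Type) [Field k] (d : ℕ → ℕ)
    (A : ∀ i : ℕ, Matrix (Fin (d (i + 1))) (Fin (d i)) k) (i n : ℕ) :
    LinearMap.range (matProdSeg k d A i n).mulVecLin =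
      imageFlag (V := fun i => Fin (d i) → k) (fun i => (A i).mulVecLin) (i + n) i := by
  induction n with
  | zero =>
    refine Eq.trans ?_ (imageFlag_of_le (V := fun i => Fin (d i) → k)
      (fun i => (A i).mulVecLin) (le_refl i)).symm
    exact (congrArg LinearMap.range Matrix.mulVecLin_one).trans LinearMap.range_id
  | succ n ih =>
    refine Eq.trans ?_ (imageFlag_succ (V := fun i => Fin (d i) → k)
      (fun i => (A i).mulVecLin) (Nat.le_add_right i n)).symm
    rw [← ih]
    exact (congrArg LinearMap.range (Matrix.mulVecLin_mul _ _)).trans (LinearMap.range_comp _ _)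

/-- Two tuples of composable matrices with the same rank pattern
(`rank(A_j ⋯ A_{i+1}) = rank(A'_j ⋯ A'_{i+1})` for all `0 ≤ i < j ≤ N`) lie in the
same orbit of `G = Π GL_{d_i}(k)`: there are invertible `P_i` with
`A'_i = P_i A_i P_{i−1}⁻¹`. -/
theorem stmt3 (k : Type) [Field k] (N : ℕ) (hN : 1 ≤ N) (d : ℕ → ℕ)
    (A A' : ∀ i : ℕ, Matrix (Fin (d (i + 1))) (Fin (d i)) k)
    (h : ∀ i j : ℕ, i < j → j ≤ N →
      (matProdSeg k d A i (j - i)).rank = (matProdSeg k d A' i (j - i)).rank) :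
    ∃ P : ∀ i : ℕ, Matrix (Fin (d i)) (Fin (d i)) k,
      (∀ i ≤ N, IsUnit (P i)) ∧ ∀ i < N, A' i = P (i + 1) * A i * (P i)⁻¹ := by
  obtain ⟨P, hP⟩ := exists_chain_equiv_of_finrank_eq (V := fun i => Fin (d i) → k)
    (fun i => (A i).mulVecLin) (fun i => (A' i).mulVecLin) N (by
      intro m hm i hi
      rcases hi.eq_or_lt with rfl | hlt
      · rw [imageFlag_of_le _ le_rfl, imageFlag_of_le _ le_rfl]
      · obtain ⟨n, rfl⟩ := Nat.exists_eq_add_of_le hi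
        have h1 := h i (i + n) hlt hm
        rw [Nat.add_sub_cancel_left] at h1
        rw [← range_mulVecLin_matProdSeg, ← range_mulVecLin_matProdSeg]
        exact h1)
  have hu : ∀ i, IsUnit (LinearMap.toMatrix' (P i).toLinearMap) := fun i =>
    LinearEquiv.isUnit_det (P i) (Pi.basisFun k _) (Pi.basisFun k _) |>
      (Matrix.isUnit_iff_isUnit_det _).2
  refine ⟨fun i => LinearMap.toMatrix' (P i).toLinearMap, fun i _ => hu i, fun i hi => ?_⟩
  have hcomm : LinearMap.toMatrix' (P (i + 1)).toLinearMap * A i =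
      A' i * LinearMap.toMatrix' (P i).toLinearMap := by
    apply Matrix.toLin'.injective
    rw [Matrix.toLin'_mul, Matrix.toLin'_mul, Matrix.toLin'_toMatrix', Matrix.toLin'_toMatrix']
    exact LinearMap.ext (hP i hi)
  rw [hcomm, Matrix.mul_nonsing_inv_cancel_right _ _ ((Matrix.isUnit_iff_isUnit_det _).1 (hu i))]
end

section
/- Fix N ≥ 1, d ∈ ℕ^{N+1}, an integer r with 0 ≤ r ≤ min_i d_i, and a permutation σ of {0,…,N}; write σ·d = (d_{σ(0)}, …, d_{σ(N)}). Then min_{m ∈ M^r_d} c(m) = min_{m ∈ M^r_{σ·d}} c(m), and the number of m ∈ M^r_d attaining the minimum equals the number of m ∈ M^r_{σ·d} attaining the minimum. (The codimension C and the number θ of top-dimensional components of Σ^r_d are invariant under arbitrary permutations of the dimension vector.) -/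
/-- `m` is a Kostant partition of the dimension vector `d` for the equioriented
type-A quiver with vertices `0, …, N`. -/
def IsKostant (N : ℕ) (d : ℕ → ℕ) (m : ℕ → ℕ → ℕ) : Prop :=
  (∀ i j : ℕ, ¬(i ≤ j ∧ j ≤ N) → m i j = 0) ∧
  ∀ k ≤ N, d k = ∑ i ∈ Finset.range (k + 1), ∑ j ∈ Finset.Icc k N, m i j

/-- `c(m) = Σ_{1 ≤ i ≤ u ≤ j ≤ v ≤ N} m_{i−1,j−1} · m_{u,v}`. -/
def kpCodim (N : ℕ) (m : ℕ → ℕ → ℕ) : ℕ :=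
  ∑ i ∈ Finset.Icc 1 N, ∑ u ∈ Finset.Icc i N, ∑ j ∈ Finset.Icc u N,
    ∑ v ∈ Finset.Icc j N, m (i - 1) (j - 1) * m u v

/-- `C = min_{m ∈ M^r_d} c(m)`. -/
noncomputable def KPmin (N : ℕ) (d : ℕ → ℕ) (r : ℕ) : ℕ :=
  sInf {n : ℕ | ∃ m : ℕ → ℕ → ℕ, IsKostant N d m ∧ m 0 N = r ∧ kpCodim N m = n}

/-- `θ = #{m ∈ M^r_d : c(m) = C}`. -/
noncomputable def KPcount (N : ℕ) (d : ℕ → ℕ) (r : ℕ) : ℕ :=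
  {m : ℕ → ℕ → ℕ | IsKostant N d m ∧ m 0 N = r ∧ kpCodim N m = KPmin N d r}.ncard

open PowerSeries in
/-- The power series `1 / ((1 - q) (1 - q^2) ⋯ (1 - q^n))`. -/
noncomputable def invQFactorial (n : ℕ) : PowerSeries ℚ :=
  ∏ i ∈ Finset.range n, (1 - (X : PowerSeries ℚ) ^ (i + 1))⁻¹

open PowerSeries in
lemma invQFactorial_zero : invQFactorial 0 = 1 := by simp [invQFactorial]

open PowerSeries in
lemma invQFactorial_succ_mul (n : ℕ) :
    invQFactorial (n + 1) * (1 - (X : PowerSeries ℚ) ^ (n + 1)) = invQFactorial n := by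
  rw [invQFactorial, Finset.prod_range_succ, mul_assoc, PowerSeries.inv_mul_cancel, mul_one,
    invQFactorial]
  simp

open PowerSeries in
lemma constantCoeff_invQFactorial (n : ℕ) : constantCoeff (invQFactorial n) = 1 := by
  simp [invQFactorial, map_prod]

open PowerSeries in
/-- The summands of the Durfee rectangle identity. -/
noncomputable def durfeeTerm (a d k : ℕ) : PowerSeries ℚ :=
  X ^ ((a - k) * (d - k)) * (invQFactorial (a - k) * invQFactorial k) * invQFactorial (d - k)

open PowerSeries in
lemma durfeeTerm_succ (a d k : ℕ) :
    (if k + 1 ≤ a + 1 ∧ k + 1 ≤ d + 1 then durfeeTerm (a + 1) (d + 1) (k + 1) else 0) *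
        (1 - (X : PowerSeries ℚ) ^ (a + 1)) =
      (if k ≤ a ∧ k ≤ d then durfeeTerm a d k else 0) +
        X ^ (d + 1) * (if k + 1 ≤ a ∧ k + 1 ≤ d + 1 then durfeeTerm a (d + 1) (k + 1) else 0) := by
  by_cases hd : k ≤ d
  · obtain ⟨e, rfl⟩ := Nat.exists_eq_add_of_le hd
    rcases lt_trichotomy k a with h | rfl | h
    · obtain ⟨p, rfl⟩ := Nat.exists_eq_add_of_lt h
      have h1 : k + p + 1 + 1 - (k + 1) = p + 1 := by omega
      have h2 : k + e + 1 - (k + 1) = e := by omega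
      have h3 : k + p + 1 - k = p + 1 := by omega
      have h4 : k + e - k = e := by omega
      have h5 : k + p + 1 - (k + 1) = p := by omega
      rw [if_pos (by omega), if_pos (by omega), if_pos (by omega)]
      simp only [durfeeTerm, h1, h2, h3, h4, h5]
      rw [← invQFactorial_succ_mul p, ← invQFactorial_succ_mul k]
      ring
    · rw [if_pos (by omega), if_pos (by omega), if_neg (by omega)]
      have h2 : k + e + 1 - (k + 1) = e := by omega
      simp only [durfeeTerm, Nat.sub_self, h2, Nat.add_sub_cancel_left]
      rw [← invQFactorial_succ_mul k]
      ring
    · rw [if_neg (by omega), if_neg (by omega), if_neg (by omega)]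
      simp
  · rw [if_neg (by omega), if_neg (by omega), if_neg (by omega)]
    simp

open PowerSeries in
lemma sum_durfeeTerm_ite (a d : ℕ) :
    ∑ k ∈ Finset.range (d + 1), (if k ≤ a ∧ k ≤ d then durfeeTerm a d k else 0) =
      invQFactorial a * invQFactorial d := by
  induction a generalizing d with
  | zero =>
    rw [Finset.sum_range_succ', Finset.sum_eq_zero (by intro i _; rw [if_neg (by omega)])]
    simp [durfeeTerm, invQFactorial_zero]
  | succ a ih =>
    cases d with
    | zero => simp [durfeeTerm, invQFactorial_zero]
    | succ d =>
      have hne : (1 - (X : PowerSeries ℚ) ^ (a + 1)) ≠ 0 := by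
        intro h
        simpa using congrArg constantCoeff h
      apply mul_right_cancel₀ hne
      have h0 : durfeeTerm (a + 1) (d + 1) 0 * (1 - (X : PowerSeries ℚ) ^ (a + 1)) =
          X ^ (d + 1) * durfeeTerm a (d + 1) 0 := by
        simp only [durfeeTerm, Nat.sub_zero]
        rw [← invQFactorial_succ_mul a]
        ring
      have h1 := ih (d + 1)
      rw [Finset.sum_range_succ'] at h1 ⊢
      rw [add_mul, Finset.sum_mul, Finset.sum_congr rfl fun k _ => durfeeTerm_succ a d k,
        Finset.sum_add_distrib, ← Finset.mul_sum, ih d]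
      simp only [Nat.zero_le, and_self, if_true] at h1 ⊢
      rw [h0, add_assoc, ← mul_add, h1, mul_right_comm, invQFactorial_succ_mul,
        ← invQFactorial_succ_mul d]
      ring

/-- The Durfee rectangle identity. -/
lemma sum_durfeeTerm (a d : ℕ) :
    ∑ k ∈ Finset.range (min a d + 1), durfeeTerm a d k = invQFactorial a * invQFactorial d := by
  rw [← sum_durfeeTerm_ite, ← Finset.sum_filter]
  apply Finset.sum_congr _ fun _ _ => rfl
  ext k
  simp only [Finset.mem_range, Finset.mem_filter]
  omega

open scoped Classical in
/-- Functions supported on `{0, …, n - 1}`, bounded by `a`, with sum at most `D`. -/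
noncomputable def boundedTuples (a : ℕ → ℕ) (D : ℕ) : ℕ → Finset (ℕ → ℕ)
  | 0 => {0}
  | n + 1 => ((boundedTuples a D n).sigma fun k =>
      Finset.range (min (a n) (D - ∑ i ∈ Finset.range n, k i) + 1)).image
        fun p => Function.update p.1 n p.2

lemma sum_range_update {n : ℕ} (k : ℕ → ℕ) (x : ℕ) :
    ∑ i ∈ Finset.range n, Function.update k n x i = ∑ i ∈ Finset.range n, k i := by
  apply Finset.sum_congr rfl
  intro i hi
  rw [Function.update_of_ne (Finset.mem_range.1 hi).ne]

lemma mem_boundedTuples {a : ℕ → ℕ} {D n : ℕ} {k : ℕ → ℕ} :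
    k ∈ boundedTuples a D n ↔
      (∀ i, n ≤ i → k i = 0) ∧ (∀ i < n, k i ≤ a i) ∧ ∑ i ∈ Finset.range n, k i ≤ D := by
  induction n generalizing k with
  | zero => simp [boundedTuples, funext_iff]
  | succ n ih =>
    simp only [boundedTuples, Finset.mem_image, Finset.mem_sigma, Finset.mem_range, Sigma.exists,
      ih]
    constructor
    · rintro ⟨l, x, ⟨⟨h1, h2, h3⟩, hx⟩, rfl⟩
      refine ⟨fun i hi => ?_, fun i hi => ?_, ?_⟩
      · rw [Function.update_of_ne (by omega)]
        exact h1 i (by omega)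
      · rcases Nat.lt_succ_iff_lt_or_eq.1 hi with h | rfl
        · rw [Function.update_of_ne h.ne]
          exact h2 i h
        · rw [Function.update_self]
          omega
      · rw [Finset.sum_range_succ, sum_range_update, Function.update_self]
        omega
    · rintro ⟨h1, h2, h3⟩
      rw [Finset.sum_range_succ] at h3
      refine ⟨Function.update k n 0, k n, ⟨⟨fun i hi => ?_, fun i hi => ?_, ?_⟩, ?_⟩, ?_⟩
      · rcases Nat.lt_or_eq_of_le hi with h | rfl
        · rw [Function.update_of_ne (by omega)]
          exact h1 i (by omega)
        · simp
      · rw [Function.update_of_ne hi.ne]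
        exact h2 i (by omega)
      · rw [sum_range_update]
        omega
      · rw [sum_range_update]
        have := h2 n (by omega)
        omega
      · simp

lemma sum_boundedTuples_succ {M : Type*} [AddCommMonoid M] (a : ℕ → ℕ) (D n : ℕ)
    (f : (ℕ → ℕ) → M) :
    ∑ k ∈ boundedTuples a D (n + 1), f k = ∑ k ∈ boundedTuples a D n,
      ∑ x ∈ Finset.range (min (a n) (D - ∑ i ∈ Finset.range n, k i) + 1),
        f (Function.update k n x) := by
  classical
  rw [boundedTuples, Finset.sum_image, Finset.sum_sigma]
  apply Set.LeftInvOn.injOn (f₁' := fun k => ⟨Function.update k n 0, k n⟩)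
  rintro ⟨k, x⟩ hk
  have h := (mem_boundedTuples.1 (Finset.mem_sigma.1 hk).1).1 n le_rfl
  simp only [Function.update_self, Function.update_idem]
  rw [← h, Function.update_eq_self]

open PowerSeries in
/-- The summands of the iterated Durfee rectangle identity. -/
noncomputable def multiDurfeeTerm (a : ℕ → ℕ) (D n : ℕ) (k : ℕ → ℕ) : PowerSeries ℚ :=
  X ^ (∑ u ∈ Finset.range n, (∑ i ∈ Finset.range u, (a i - k i)) * k u +
      (∑ i ∈ Finset.range n, (a i - k i)) * (D - ∑ i ∈ Finset.range n, k i)) *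
    ((∏ i ∈ Finset.range n, invQFactorial (a i - k i)) *
      ((∏ i ∈ Finset.range n, invQFactorial (k i)) *
        invQFactorial (D - ∑ i ∈ Finset.range n, k i)))

open PowerSeries in
lemma multiDurfeeTerm_update (a : ℕ → ℕ) (D n : ℕ) (k : ℕ → ℕ) (x : ℕ)
    (hx : x ≤ D - ∑ i ∈ Finset.range n, k i) :
    multiDurfeeTerm a D (n + 1) (Function.update k n x) =
      (X ^ (∑ u ∈ Finset.range n, (∑ i ∈ Finset.range u, (a i - k i)) * k u +
          (∑ i ∈ Finset.range n, (a i - k i)) * (D - ∑ i ∈ Finset.range n, k i)) *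
        ((∏ i ∈ Finset.range n, invQFactorial (a i - k i)) *
          (∏ i ∈ Finset.range n, invQFactorial (k i)))) *
        durfeeTerm (a n) (D - ∑ i ∈ Finset.range n, k i) x := by
  have h0 : ∀ i < n, Function.update k n x i = k i := fun i hi =>
    Function.update_of_ne hi.ne _ _
  have h1 : ∑ u ∈ Finset.range n, (∑ i ∈ Finset.range u,
      (a i - Function.update k n x i)) * Function.update k n x u =
      ∑ u ∈ Finset.range n, (∑ i ∈ Finset.range u, (a i - k i)) * k u := by
    refine Finset.sum_congr rfl fun u hu => ?_
    rw [Finset.mem_range] at hu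
    rw [h0 u hu]
    congr 1
    refine Finset.sum_congr rfl fun i hi => ?_
    rw [Finset.mem_range] at hi
    rw [h0 i (by omega)]
  have h2 : ∑ i ∈ Finset.range n, (a i - Function.update k n x i) =
      ∑ i ∈ Finset.range n, (a i - k i) :=
    Finset.sum_congr rfl fun i hi => by rw [h0 i (Finset.mem_range.1 hi)]
  have h3 : ∏ i ∈ Finset.range n, invQFactorial (a i - Function.update k n x i) =
      ∏ i ∈ Finset.range n, invQFactorial (a i - k i) :=
    Finset.prod_congr rfl fun i hi => by rw [h0 i (Finset.mem_range.1 hi)]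
  have h4 : ∏ i ∈ Finset.range n, invQFactorial (Function.update k n x i) =
      ∏ i ∈ Finset.range n, invQFactorial (k i) :=
    Finset.prod_congr rfl fun i hi => by rw [h0 i (Finset.mem_range.1 hi)]
  rw [multiDurfeeTerm]
  simp only [Finset.sum_range_succ, Finset.prod_range_succ, h1, h3, h4, sum_range_update,
    h2, Function.update_self, durfeeTerm]
  generalize ∑ i ∈ Finset.range n, k i = s at *
  obtain ⟨e, he⟩ := Nat.exists_eq_add_of_le hx
  have h5 : D - (s + x) = e := by omega
  have h6 : x + e - x = e := by omega
  rw [h5, he, h6]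
  ring

lemma sum_multiDurfeeTerm (a : ℕ → ℕ) (D n : ℕ) :
    ∑ k ∈ boundedTuples a D n, multiDurfeeTerm a D n k =
      (∏ i ∈ Finset.range n, invQFactorial (a i)) * invQFactorial D := by
  induction n with
  | zero => simp [boundedTuples, multiDurfeeTerm]
  | succ n ih =>
    rw [sum_boundedTuples_succ, Finset.prod_range_succ, mul_right_comm, ← ih, Finset.sum_mul]
    refine Finset.sum_congr rfl fun k _ => ?_
    rw [Finset.sum_congr rfl fun x hx => multiDurfeeTerm_update a D n k x
      (by rw [Finset.mem_range] at hx; omega), ← Finset.mul_sum, sum_durfeeTerm, multiDurfeeTerm]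
    ring

lemma sum_Icc_one_eq_sum_range (n : ℕ) (f : ℕ → ℕ) :
    ∑ i ∈ Finset.Icc 1 n, f i = ∑ i ∈ Finset.range n, f (i + 1) := by
  induction n with
  | zero => simp
  | succ n ih => rw [Finset.sum_Icc_succ_top (by omega), ih, Finset.sum_range_succ]

lemma kpCodim_eq (N : ℕ) (m : ℕ → ℕ → ℕ) :
    kpCodim N m = ∑ j ∈ Finset.range N, ∑ u ∈ Finset.range (j + 1),
      (∑ i ∈ Finset.range (u + 1), m i j) * ∑ v ∈ Finset.Icc (j + 1) N, m (u + 1) v := by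
  have h : kpCodim N m = ∑ j ∈ Finset.Icc 1 N, ∑ u ∈ Finset.Icc 1 j, ∑ i ∈ Finset.Icc 1 u,
      ∑ v ∈ Finset.Icc j N, m (i - 1) (j - 1) * m u v := by
    rw [kpCodim, Finset.sum_comm' (t' := Finset.Icc 1 N) (s' := fun u => Finset.Icc 1 u)
      (by intro x y; simp only [Finset.mem_Icc]; omega)]
    rw [Finset.sum_congr rfl fun u _ => Finset.sum_comm]
    rw [Finset.sum_comm' (t' := Finset.Icc 1 N) (s' := fun u => Finset.Icc 1 u)
      (by intro x y; simp only [Finset.mem_Icc]; omega)]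
  rw [h]
  simp only [sum_Icc_one_eq_sum_range, Nat.add_sub_cancel, Finset.sum_mul]
  simp only [Finset.mul_sum]

lemma sum_Icc_succ_merge {N t : ℕ} {f g : ℕ → ℕ} (h : ∀ v < N, f v = g v)
    (hN : f N + f (N + 1) = g N) (ht : t ≤ N) :
    ∑ v ∈ Finset.Icc t (N + 1), f v = ∑ v ∈ Finset.Icc t N, g v := by
  have hmem : N ∈ Finset.Icc t N := Finset.mem_Icc.2 ⟨ht, le_rfl⟩
  rw [Finset.sum_Icc_succ_top (by omega), ← Finset.sum_erase_add _ f hmem,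
    ← Finset.sum_erase_add _ g hmem, add_assoc, hN]
  congr 1
  refine Finset.sum_congr rfl fun v hv => h v ?_
  rw [Finset.mem_erase, Finset.mem_Icc] at hv
  omega

/-- Adjoin a vertex `N + 1` of dimension `D`, prolonging `k i` of the segments `[i, N]`. -/
def kpExtend (N D : ℕ) (m : ℕ → ℕ → ℕ) (k : ℕ → ℕ) (i j : ℕ) : ℕ :=
  if j < N then m i j
  else if j = N then m i N - k i
  else if j = N + 1 then
    if i = N + 1 then D - ∑ l ∈ Finset.range (N + 1), k l else k i
  else 0

/-- Restrict a Kostant partition to the vertices `0, …, N`. -/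
def kpRestrict (N : ℕ) (m : ℕ → ℕ → ℕ) (i j : ℕ) : ℕ :=
  if j < N then m i j
  else if j = N ∧ i ≤ N then m i N + m i (N + 1)
  else 0

/-- The multiplicities of the segments `[i, N + 1]` with `i ≤ N`. -/
def kpTop (N : ℕ) (m : ℕ → ℕ → ℕ) (i : ℕ) : ℕ :=
  if i ≤ N then m i (N + 1) else 0

section extend

variable {N D : ℕ} {m : ℕ → ℕ → ℕ} {k : ℕ → ℕ}

lemma kpExtend_of_lt {i j : ℕ} (h : j < N) : kpExtend N D m k i j = m i j := if_pos h

lemma kpExtend_self (i : ℕ) : kpExtend N D m k i N = m i N - k i := by simp [kpExtend]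

lemma kpExtend_succ {i : ℕ} (h : i ≠ N + 1) : kpExtend N D m k i (N + 1) = k i := by
  simp [kpExtend, h]

lemma kpExtend_succ_succ :
    kpExtend N D m k (N + 1) (N + 1) = D - ∑ l ∈ Finset.range (N + 1), k l := by
  simp [kpExtend]

lemma sum_Icc_kpExtend {i t : ℕ} (hk : k i ≤ m i N) (hi : i ≤ N) (ht : t ≤ N) :
    ∑ v ∈ Finset.Icc t (N + 1), kpExtend N D m k i v = ∑ v ∈ Finset.Icc t N, m i v := by
  refine sum_Icc_succ_merge (fun v hv => kpExtend_of_lt hv) ?_ ht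
  rw [kpExtend_self, kpExtend_succ (by omega)]
  omega

lemma kpRestrict_kpExtend {d : ℕ → ℕ} (hm : IsKostant N d m)
    (hk : k ∈ boundedTuples (fun i => m i N) D (N + 1)) :
    kpRestrict N (kpExtend N D m k) = m := by
  obtain ⟨h1, h2, h3⟩ := mem_boundedTuples.1 hk
  ext i j
  rcases lt_trichotomy j N with h | rfl | h
  · rw [kpRestrict, if_pos h, kpExtend_of_lt h]
  · by_cases hi : i ≤ j
    · have := h2 i (by omega)
      rw [kpRestrict, if_neg (by omega), if_pos ⟨rfl, hi⟩, kpExtend_self,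
        kpExtend_succ (by omega)]
      omega
    · rw [kpRestrict, if_neg (by omega), if_neg (by omega), hm.1 i j (by omega)]
  · rw [kpRestrict, if_neg (by omega), if_neg (by omega), hm.1 i j (by omega)]

lemma kpTop_kpExtend {a : ℕ → ℕ} (hk : k ∈ boundedTuples a D (N + 1)) :
    kpTop N (kpExtend N D m k) = k := by
  ext i
  by_cases hi : i ≤ N
  · rw [kpTop, if_pos hi, kpExtend_succ (by omega)]
  · rw [kpTop, if_neg hi, (mem_boundedTuples.1 hk).1 i (by omega)]

lemma isKostant_kpExtend {d : ℕ → ℕ} (hm : IsKostant N d m)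
    (hk : k ∈ boundedTuples (fun i => m i N) (d (N + 1)) (N + 1)) :
    IsKostant (N + 1) d (kpExtend N (d (N + 1)) m k) := by
  obtain ⟨h1, h2, h3⟩ := mem_boundedTuples.1 hk
  refine ⟨fun i j hij => ?_, fun t ht => ?_⟩
  · rcases lt_trichotomy j N with h | rfl | h
    · rw [kpExtend_of_lt h, hm.1 i j (by omega)]
    · rw [kpExtend_self, hm.1 i j (by omega), Nat.zero_sub]
    · rcases Nat.eq_or_lt_of_le (Nat.succ_le_of_lt h) with h' | h'
      · subst h'
        rw [kpExtend_succ (by omega), h1 i (by omega)]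
      · rw [kpExtend, if_neg (by omega), if_neg (by omega), if_neg (by omega)]
  · rcases Nat.lt_or_eq_of_le ht with h | rfl
    · rw [hm.2 t (by omega)]
      refine Finset.sum_congr rfl fun i hi => ?_
      rw [Finset.mem_range] at hi
      rw [sum_Icc_kpExtend (h2 i (by omega)) (by omega) (by omega)]
    · simp only [Finset.Icc_self, Finset.sum_singleton]
      rw [Finset.sum_range_succ, kpExtend_succ_succ]
      rw [Finset.sum_congr rfl fun i hi => kpExtend_succ (Finset.mem_range.1 hi).ne]
      omega

lemma isKostant_kpRestrict {d : ℕ → ℕ} (hm : IsKostant (N + 1) d m) :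
    IsKostant N d (kpRestrict N m) := by
  refine ⟨fun i j hij => ?_, fun t ht => ?_⟩
  · rcases lt_or_ge j N with h | h
    · rw [kpRestrict, if_pos h, hm.1 i j (by omega)]
    · rw [kpRestrict, if_neg (by omega), if_neg (by omega)]
  · rw [hm.2 t (by omega)]
    refine Finset.sum_congr rfl fun i hi => ?_
    rw [Finset.mem_range] at hi
    refine sum_Icc_succ_merge (fun v hv => (if_pos hv).symm) ?_ ht
    rw [kpRestrict, if_neg (by omega), if_pos (by omega)]

lemma sum_kpTop {d : ℕ → ℕ} (hm : IsKostant (N + 1) d m) :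
    d (N + 1) = ∑ l ∈ Finset.range (N + 1), kpTop N m l + m (N + 1) (N + 1) := by
  rw [hm.2 (N + 1) le_rfl]
  simp only [Finset.Icc_self, Finset.sum_singleton]
  rw [Finset.sum_range_succ]
  congr 1
  refine Finset.sum_congr rfl fun i hi => ?_
  rw [Finset.mem_range] at hi
  rw [kpTop, if_pos (by omega)]

lemma kpTop_mem {d : ℕ → ℕ} (hm : IsKostant (N + 1) d m) :
    kpTop N m ∈ boundedTuples (fun i => kpRestrict N m i N) (d (N + 1)) (N + 1) := by
  refine mem_boundedTuples.2 ⟨fun i hi => if_neg (by omega), fun i hi => ?_, ?_⟩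
  · rw [kpTop, if_pos (by omega), kpRestrict, if_neg (by omega), if_pos (by omega)]
    omega
  · have := sum_kpTop hm
    omega

lemma kpExtend_kpRestrict {d : ℕ → ℕ} (hm : IsKostant (N + 1) d m) :
    kpExtend N (d (N + 1)) (kpRestrict N m) (kpTop N m) = m := by
  ext i j
  rcases lt_trichotomy j N with h | rfl | h
  · rw [kpExtend_of_lt h, kpRestrict, if_pos h]
  · rw [kpExtend_self, kpRestrict, if_neg (by omega), kpTop]
    by_cases hi : i ≤ j
    · rw [if_pos ⟨rfl, hi⟩, if_pos hi]
      omega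
    · rw [if_neg (by omega), hm.1 i j (by omega), Nat.zero_sub]
  · rcases Nat.eq_or_lt_of_le (Nat.succ_le_of_lt h) with h' | h'
    · subst h'
      by_cases hi : i = N + 1
      · subst hi
        have := sum_kpTop hm
        rw [kpExtend_succ_succ]
        simp only [Nat.succ_eq_add_one]
        omega
      · rw [kpExtend_succ hi, kpTop]
        by_cases hi' : i ≤ N
        · rw [if_pos hi']
        · rw [if_neg hi', hm.1 i _ (by omega)]
    · rw [kpExtend, if_neg (by omega), if_neg (by omega), if_neg (by omega), hm.1 i j (by omega)]

lemma kpCodim_kpExtend (hk : ∀ i < N + 1, k i ≤ m i N) :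
    kpCodim (N + 1) (kpExtend N D m k) = kpCodim N m +
      (∑ u ∈ Finset.range (N + 1), (∑ i ∈ Finset.range u, (m i N - k i)) * k u +
        (∑ i ∈ Finset.range (N + 1), (m i N - k i)) *
          (D - ∑ i ∈ Finset.range (N + 1), k i)) := by
  rw [kpCodim_eq, kpCodim_eq, Finset.sum_range_succ]
  congr 1
  · refine Finset.sum_congr rfl fun j hj => Finset.sum_congr rfl fun u hu => ?_
    rw [Finset.mem_range] at hj hu
    rw [sum_Icc_kpExtend (hk _ (by omega)) (by omega) (by omega)]
    simp only [kpExtend_of_lt hj]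
  · simp only [Finset.Icc_self, Finset.sum_singleton, kpExtend_self]
    rw [Finset.sum_range_succ, kpExtend_succ_succ,
      Finset.sum_range_succ' (fun u => (∑ i ∈ Finset.range u, (m i N - k i)) * k u)]
    simp only [Finset.range_zero, Finset.sum_empty, zero_mul, add_zero]
    congr 1
    refine Finset.sum_congr rfl fun u hu => ?_
    rw [Finset.mem_range] at hu
    rw [kpExtend_succ (by omega)]

end extend

open scoped Classical in
/-- The finite set of Kostant partitions of `d`. -/
noncomputable def kostantFinset (d : ℕ → ℕ) : ℕ → Finset (ℕ → ℕ → ℕ)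
  | 0 => {fun i j => if i = 0 ∧ j = 0 then d 0 else 0}
  | N + 1 => ((kostantFinset d N).sigma fun m =>
      boundedTuples (fun i => m i N) (d (N + 1)) (N + 1)).image
        fun p => kpExtend N (d (N + 1)) p.1 p.2

lemma mem_kostantFinset {d : ℕ → ℕ} {N : ℕ} {m : ℕ → ℕ → ℕ} :
    m ∈ kostantFinset d N ↔ IsKostant N d m := by
  induction N generalizing m with
  | zero =>
    rw [kostantFinset, Finset.mem_singleton]
    constructor
    · rintro rfl
      refine ⟨fun i j h => if_neg (by omega), fun k hk => ?_⟩
      obtain rfl : k = 0 := by omega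
      simp
    · intro h
      ext i j
      split_ifs with hij
      · obtain ⟨rfl, rfl⟩ := hij
        simpa using (h.2 0 le_rfl).symm
      · exact h.1 i j (by omega)
  | succ N ih =>
    simp only [kostantFinset, Finset.mem_image, Finset.mem_sigma, Sigma.exists, ih]
    constructor
    · rintro ⟨m, k, ⟨hm, hk⟩, rfl⟩
      exact isKostant_kpExtend hm hk
    · intro hm
      exact ⟨kpRestrict N m, kpTop N m, ⟨isKostant_kpRestrict hm, kpTop_mem hm⟩,
        kpExtend_kpRestrict hm⟩

lemma sum_kostantFinset_succ {M : Type*} [AddCommMonoid M] (d : ℕ → ℕ) (N : ℕ)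
    (f : (ℕ → ℕ → ℕ) → M) :
    ∑ m ∈ kostantFinset d (N + 1), f m = ∑ m ∈ kostantFinset d N,
      ∑ k ∈ boundedTuples (fun i => m i N) (d (N + 1)) (N + 1),
        f (kpExtend N (d (N + 1)) m k) := by
  classical
  rw [kostantFinset, Finset.sum_image, Finset.sum_sigma]
  apply Set.LeftInvOn.injOn (f₁' := fun m => ⟨kpRestrict N m, kpTop N m⟩)
  rintro ⟨m, k⟩ h
  obtain ⟨hm, hk⟩ := Finset.mem_sigma.1 h
  exact Sigma.ext (kpRestrict_kpExtend (mem_kostantFinset.1 hm) hk)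
    (heq_of_eq (kpTop_kpExtend hk))

open PowerSeries in
/-- The term `q ^ c(m) / ∏ (q)_{m i j}`. -/
noncomputable def kpWeight (N : ℕ) (m : ℕ → ℕ → ℕ) : PowerSeries ℚ :=
  X ^ kpCodim N m *
    ∏ j ∈ Finset.range (N + 1), ∏ i ∈ Finset.range (j + 1), invQFactorial (m i j)

open PowerSeries in
lemma kpWeight_kpExtend {N D : ℕ} {m : ℕ → ℕ → ℕ} {k : ℕ → ℕ}
    (hk : ∀ i < N + 1, k i ≤ m i N) :
    kpWeight (N + 1) (kpExtend N D m k) =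
      X ^ kpCodim N m * (∏ j ∈ Finset.range N, ∏ i ∈ Finset.range (j + 1),
        invQFactorial (m i j)) * multiDurfeeTerm (fun i => m i N) D (N + 1) k := by
  have h1 : ∏ j ∈ Finset.range N, ∏ i ∈ Finset.range (j + 1),
      invQFactorial (kpExtend N D m k i j) =
      ∏ j ∈ Finset.range N, ∏ i ∈ Finset.range (j + 1), invQFactorial (m i j) :=
    Finset.prod_congr rfl fun j hj => Finset.prod_congr rfl fun i _ => by
      rw [kpExtend_of_lt (Finset.mem_range.1 hj)]
  have h2 : ∏ i ∈ Finset.range (N + 1), invQFactorial (kpExtend N D m k i (N + 1)) =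
      ∏ i ∈ Finset.range (N + 1), invQFactorial (k i) :=
    Finset.prod_congr rfl fun i hi => by rw [kpExtend_succ (Finset.mem_range.1 hi).ne]
  rw [kpWeight, kpCodim_kpExtend hk, Finset.prod_range_succ, Finset.prod_range_succ _ N, h1,
    Finset.prod_range_succ _ (N + 1), h2, kpExtend_succ_succ, multiDurfeeTerm, pow_add]
  simp only [kpExtend_self]
  ring

/-- Reineke's identity for the equioriented quiver of type `A`. -/
lemma sum_kpWeight (d : ℕ → ℕ) (N : ℕ) :
    ∑ m ∈ kostantFinset d N, kpWeight N m =
      ∏ k ∈ Finset.range (N + 1), invQFactorial (d k) := by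
  induction N with
  | zero => simp [kostantFinset, kpWeight, kpCodim]
  | succ N ih =>
    rw [sum_kostantFinset_succ, Finset.prod_range_succ, ← ih, Finset.sum_mul]
    refine Finset.sum_congr rfl fun m _ => ?_
    rw [Finset.sum_congr rfl fun k hk => kpWeight_kpExtend (mem_boundedTuples.1 hk).2.1,
      ← Finset.mul_sum, sum_multiDurfeeTerm, kpWeight,
      Finset.prod_range_succ (fun j => ∏ i ∈ Finset.range (j + 1), invQFactorial (m i j)) N]
    ring

/-- Replace the multiplicity of the segment `[0, N]` by `r`. -/
def kpSetFull (N : ℕ) (m : ℕ → ℕ → ℕ) (r : ℕ) (i j : ℕ) : ℕ :=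
  if i = 0 ∧ j = N then r else m i j

lemma kpSetFull_full (N : ℕ) (m : ℕ → ℕ → ℕ) (r : ℕ) : kpSetFull N m r 0 N = r := by
  simp [kpSetFull]

lemma kpSetFull_of_not {N : ℕ} {m : ℕ → ℕ → ℕ} {r i j : ℕ} (h : ¬(i = 0 ∧ j = N)) :
    kpSetFull N m r i j = m i j := if_neg h

lemma kpSetFull_kpSetFull {N : ℕ} {m : ℕ → ℕ → ℕ} {r s : ℕ} (h : m 0 N = s) :
    kpSetFull N (kpSetFull N m r) s = m := by
  ext i j
  by_cases hij : i = 0 ∧ j = N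
  · obtain ⟨rfl, rfl⟩ := hij
    rw [kpSetFull_full, h]
  · rw [kpSetFull_of_not hij, kpSetFull_of_not hij]

lemma kpCodim_kpSetFull (N : ℕ) (m : ℕ → ℕ → ℕ) (r : ℕ) :
    kpCodim N (kpSetFull N m r) = kpCodim N m := by
  rw [kpCodim_eq, kpCodim_eq]
  refine Finset.sum_congr rfl fun j hj => Finset.sum_congr rfl fun u _ => ?_
  rw [Finset.mem_range] at hj
  exact congrArg₂ (· * ·) (Finset.sum_congr rfl fun i _ => kpSetFull_of_not (by omega))
    (Finset.sum_congr rfl fun v _ => kpSetFull_of_not (by omega))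

lemma kpWeight_kpSetFull {N : ℕ} {m : ℕ → ℕ → ℕ} (h : m 0 N = 0) (r : ℕ) :
    kpWeight N (kpSetFull N m r) = invQFactorial r * kpWeight N m := by
  have h1 : ∏ j ∈ Finset.range N, ∏ i ∈ Finset.range (j + 1),
      invQFactorial (kpSetFull N m r i j) =
      ∏ j ∈ Finset.range N, ∏ i ∈ Finset.range (j + 1), invQFactorial (m i j) := by
    refine Finset.prod_congr rfl fun j hj => Finset.prod_congr rfl fun i _ => ?_
    rw [Finset.mem_range] at hj
    rw [kpSetFull_of_not (by omega)]
  have h2 : ∏ i ∈ Finset.range N, invQFactorial (kpSetFull N m r (i + 1) N) =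
      ∏ i ∈ Finset.range N, invQFactorial (m (i + 1) N) :=
    Finset.prod_congr rfl fun i _ => by rw [kpSetFull_of_not (by omega)]
  rw [kpWeight, kpWeight, kpCodim_kpSetFull,
    Finset.prod_range_succ (fun j => ∏ i ∈ Finset.range (j + 1), invQFactorial (m i j)) N,
    Finset.prod_range_succ
      (fun j => ∏ i ∈ Finset.range (j + 1), invQFactorial (kpSetFull N m r i j)) N, h1,
    Finset.prod_range_succ', Finset.prod_range_succ' (fun i => invQFactorial (m i N)), h2,
    kpSetFull_full, h, invQFactorial_zero]
  ring

lemma sum_kpSetFull (N : ℕ) (m : ℕ → ℕ → ℕ) (r k : ℕ) (hk : k ≤ N) :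
    (∑ i ∈ Finset.range (k + 1), ∑ j ∈ Finset.Icc k N, kpSetFull N m r i j) + m 0 N =
      (∑ i ∈ Finset.range (k + 1), ∑ j ∈ Finset.Icc k N, m i j) + r := by
  have hN : N ∈ Finset.Icc k N := Finset.mem_Icc.2 ⟨hk, le_rfl⟩
  have h1 : ∑ i ∈ Finset.range k, ∑ j ∈ Finset.Icc k N, kpSetFull N m r (i + 1) j =
      ∑ i ∈ Finset.range k, ∑ j ∈ Finset.Icc k N, m (i + 1) j :=
    Finset.sum_congr rfl fun i _ => Finset.sum_congr rfl fun j _ => kpSetFull_of_not (by omega)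
  have h2 : ∑ j ∈ (Finset.Icc k N).erase N, kpSetFull N m r 0 j =
      ∑ j ∈ (Finset.Icc k N).erase N, m 0 j :=
    Finset.sum_congr rfl fun j hj => kpSetFull_of_not fun h => (Finset.mem_erase.1 hj).1 h.2
  rw [Finset.sum_range_succ', Finset.sum_range_succ', h1,
    ← Finset.sum_erase_add _ (fun j => kpSetFull N m r 0 j) hN,
    ← Finset.sum_erase_add _ (fun j => m 0 j) hN, h2, kpSetFull_full]
  ring

lemma IsKostant.full_le {N : ℕ} {d : ℕ → ℕ} {m : ℕ → ℕ → ℕ} (hm : IsKostant N d m) {k : ℕ}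
    (hk : k ≤ N) : m 0 N ≤ d k := by
  have := sum_kpSetFull N m 0 k hk
  rw [← hm.2 k hk] at this
  omega

lemma IsKostant.kpSetFull {N : ℕ} {d e : ℕ → ℕ} {m : ℕ → ℕ → ℕ} {r : ℕ} (hm : IsKostant N d m)
    (h : ∀ k ≤ N, e k + m 0 N = d k + r) : IsKostant N e (kpSetFull N m r) := by
  refine ⟨fun i j hij => ?_, fun k hk => ?_⟩
  · rw [kpSetFull_of_not (by omega), hm.1 i j hij]
  · have h1 := sum_kpSetFull N m r k hk
    have h2 := h k hk
    rw [← hm.2 k hk] at h1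
    omega

/-- The part of the generating function of Kostant partitions of `d` where the multiplicity of
the segment `[0, N]` is `r`. -/
noncomputable def kpRankSum (N : ℕ) (d : ℕ → ℕ) (r : ℕ) : PowerSeries ℚ :=
  ∑ m ∈ kostantFinset d N with m 0 N = r, kpWeight N m

lemma kpRankSum_eq_mul {N : ℕ} {d : ℕ → ℕ} {r : ℕ} (hr : ∀ k ≤ N, r ≤ d k) :
    kpRankSum N d r = invQFactorial r * kpRankSum N (fun k => d k - r) 0 := by
  rw [kpRankSum, kpRankSum, Finset.mul_sum]
  refine Finset.sum_bij' (fun m _ => kpSetFull N m 0) (fun m _ => kpSetFull N m r) ?_ ?_ ?_ ?_ ?_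
  · intro m hm
    rw [Finset.mem_filter, mem_kostantFinset] at hm ⊢
    exact ⟨hm.1.kpSetFull fun k hk => by have := hr k hk; omega, kpSetFull_full _ _ _⟩
  · intro m hm
    rw [Finset.mem_filter, mem_kostantFinset] at hm ⊢
    exact ⟨hm.1.kpSetFull fun k hk => by have := hr k hk; omega, kpSetFull_full _ _ _⟩
  · intro m hm
    exact kpSetFull_kpSetFull (Finset.mem_filter.1 hm).2
  · intro m hm
    exact kpSetFull_kpSetFull (Finset.mem_filter.1 hm).2
  · intro m hm
    rw [← kpWeight_kpSetFull (kpSetFull_full _ _ _),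
      kpSetFull_kpSetFull (Finset.mem_filter.1 hm).2]

lemma kpRankSum_eq_zero {N : ℕ} {d : ℕ → ℕ} {r k : ℕ} (hk : k ≤ N) (hr : d k < r) :
    kpRankSum N d r = 0 := by
  rw [kpRankSum, Finset.filter_eq_empty_iff.2, Finset.sum_empty]
  intro m hm h
  have := (mem_kostantFinset.1 hm).full_le hk
  omega

lemma sum_kpRankSum {N : ℕ} {d : ℕ → ℕ} {B : ℕ} (hB : d 0 < B) :
    ∑ r ∈ Finset.range B, kpRankSum N d r =
      ∏ k ∈ Finset.range (N + 1), invQFactorial (d k) := by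
  rw [← sum_kpWeight]
  refine Finset.sum_fiberwise_of_maps_to (fun m hm => ?_) _
  have := (mem_kostantFinset.1 hm).full_le (Nat.zero_le N)
  exact Finset.mem_range.2 (by omega)

lemma kpRankSum_congr {N : ℕ} {σ : Equiv.Perm (Fin (N + 1))} {d d' : ℕ → ℕ}
    (hσ : ∀ i : Fin (N + 1), d' i = d (σ i)) {r : ℕ}
    (h : (∀ k ≤ N, r ≤ d k) →
      kpRankSum N (fun k => d k - r) 0 = kpRankSum N (fun k => d' k - r) 0) :
    kpRankSum N d r = kpRankSum N d' r := by
  by_cases hr : ∀ k ≤ N, r ≤ d k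
  · have hr' : ∀ k ≤ N, r ≤ d' k := fun k hk => by
      have := hσ ⟨k, by omega⟩
      rw [this]
      exact hr _ (by omega)
    rw [kpRankSum_eq_mul hr, kpRankSum_eq_mul hr', h hr]
  · push Not at hr
    obtain ⟨k, hk, hkr⟩ := hr
    have hk' : d' (σ.symm ⟨k, by omega⟩ : Fin (N + 1)) = d k := by
      rw [hσ, Equiv.apply_symm_apply]
    rw [kpRankSum_eq_zero hk hkr,
      kpRankSum_eq_zero (k := (σ.symm ⟨k, by omega⟩ : Fin (N + 1))) (by omega) (by omega)]

lemma kpRankSum_zero_perm {N : ℕ} {σ : Equiv.Perm (Fin (N + 1))} {d d' : ℕ → ℕ}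
    (hσ : ∀ i : Fin (N + 1), d' i = d (σ i)) : kpRankSum N d 0 = kpRankSum N d' 0 := by
  induction hn : d 0 using Nat.strong_induction_on generalizing d d' with
  | _ n ih =>
    have hprod : ∏ k ∈ Finset.range (N + 1), invQFactorial (d k) =
        ∏ k ∈ Finset.range (N + 1), invQFactorial (d' k) := by
      rw [Finset.prod_range, Finset.prod_range]
      simp only [hσ]
      exact (Equiv.prod_comp σ fun i : Fin (N + 1) => invQFactorial (d i)).symm
    rw [← sum_kpRankSum (B := d 0 + d' 0 + 1) (by omega),
      ← sum_kpRankSum (d := d') (B := d 0 + d' 0 + 1) (by omega), Finset.sum_range_succ',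
      Finset.sum_range_succ', Finset.sum_congr rfl fun r _ => kpRankSum_congr hσ fun hr =>
        ih (d 0 - (r + 1)) (by have := hr 0 (Nat.zero_le N); omega) (by simp [hσ]) rfl] at hprod
    exact add_left_cancel hprod

/-- The generating function is invariant under permutations of the dimension vector. -/
lemma kpRankSum_perm {N : ℕ} {σ : Equiv.Perm (Fin (N + 1))} {d d' : ℕ → ℕ}
    (hσ : ∀ i : Fin (N + 1), d' i = d (σ i)) (r : ℕ) : kpRankSum N d r = kpRankSum N d' r :=
  kpRankSum_congr hσ fun _ => kpRankSum_zero_perm (σ := σ) (by simp [hσ])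

lemma coeff_kpWeight {N n : ℕ} {m : ℕ → ℕ → ℕ} (h : n ≤ kpCodim N m) :
    PowerSeries.coeff n (kpWeight N m) = if kpCodim N m = n then 1 else 0 := by
  rw [kpWeight, PowerSeries.coeff_X_pow_mul']
  by_cases hn : kpCodim N m = n
  · subst hn
    simp [map_prod, constantCoeff_invQFactorial]
  · rw [if_neg (by omega), if_neg hn]

lemma KPmin_le {N : ℕ} {d : ℕ → ℕ} {m : ℕ → ℕ → ℕ} (hm : IsKostant N d m) :
    KPmin N d (m 0 N) ≤ kpCodim N m :=
  Nat.sInf_le ⟨m, hm, rfl, rfl⟩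

lemma coeff_kpRankSum {N : ℕ} {d : ℕ → ℕ} {r n : ℕ} (h : n ≤ KPmin N d r) :
    PowerSeries.coeff n (kpRankSum N d r) =
      ({m : ℕ → ℕ → ℕ | IsKostant N d m ∧ m 0 N = r ∧ kpCodim N m = n}.ncard : ℚ) := by
  have hset : {m : ℕ → ℕ → ℕ | IsKostant N d m ∧ m 0 N = r ∧ kpCodim N m = n} =
      ({m ∈ {m ∈ kostantFinset d N | m 0 N = r} | kpCodim N m = n} : Finset _) := by
    ext m
    simp [mem_kostantFinset, and_assoc]
  rw [hset, Set.ncard_coe_finset, kpRankSum, map_sum, Finset.card_filter, Nat.cast_sum]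
  refine Finset.sum_congr rfl fun m hm => ?_
  rw [Finset.mem_filter, mem_kostantFinset] at hm
  obtain ⟨hm, rfl⟩ := hm
  rw [coeff_kpWeight (h.trans (KPmin_le hm))]
  simp

lemma exists_isKostant {N : ℕ} (hN : 1 ≤ N) {d : ℕ → ℕ} {r : ℕ} (hr : ∀ i ≤ N, r ≤ d i) :
    ∃ m, IsKostant N d m ∧ m 0 N = r := by
  have hdiag : IsKostant N (fun k => d k - r)
      (fun i j => if i = j ∧ j ≤ N then d i - r else 0) := by
    refine ⟨fun i j h => if_neg (by omega), fun k hk => ?_⟩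
    rw [Finset.sum_eq_single k, Finset.sum_eq_single k]
    · exact (if_pos ⟨rfl, hk⟩).symm
    · intro j _ hj
      exact if_neg (by omega)
    · intro h
      exact absurd (Finset.mem_Icc.2 ⟨le_rfl, hk⟩) h
    · intro i hi hik
      refine Finset.sum_eq_zero fun j hj => if_neg ?_
      rw [Finset.mem_range] at hi
      rw [Finset.mem_Icc] at hj
      omega
    · intro h
      exact absurd (Finset.self_mem_range_succ k) h
  refine ⟨_, hdiag.kpSetFull (r := r) fun k hk => ?_, kpSetFull_full _ _ _⟩
  have := hr k hk
  rw [if_neg (by omega)]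
  omega

lemma KPmin_le_of_kpRankSum_eq {N : ℕ} {d d' : ℕ → ℕ} {r : ℕ}
    (hne : ∃ m, IsKostant N d' m ∧ m 0 N = r) (h : kpRankSum N d r = kpRankSum N d' r) :
    KPmin N d r ≤ KPmin N d' r := by
  by_contra! hlt
  obtain ⟨m₀, hm₀, hr₀⟩ := hne
  obtain ⟨m, hm, hr, hc⟩ : KPmin N d' r ∈ {n : ℕ | ∃ m : ℕ → ℕ → ℕ,
      IsKostant N d' m ∧ m 0 N = r ∧ kpCodim N m = n} :=
    Nat.sInf_mem ⟨_, m₀, hm₀, hr₀, rfl⟩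
  have hcard := (coeff_kpRankSum hlt.le).symm.trans ((congrArg _ h).trans (coeff_kpRankSum le_rfl))
  have hempty : {m : ℕ → ℕ → ℕ | IsKostant N d m ∧ m 0 N = r ∧ kpCodim N m = KPmin N d' r} = ∅ := by
    refine Set.eq_empty_of_forall_notMem ?_
    rintro l ⟨hl, rfl, hl'⟩
    have := KPmin_le hl
    omega
  have hfin : {m : ℕ → ℕ → ℕ |
      IsKostant N d' m ∧ m 0 N = r ∧ kpCodim N m = KPmin N d' r}.Finite :=
    (kostantFinset d' N).finite_toSet.subset fun l hl => mem_kostantFinset.2 hl.1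
  rw [hempty, Set.ncard_empty, Nat.cast_inj, eq_comm, Set.ncard_eq_zero hfin] at hcard
  exact Set.notMem_empty m (hcard ▸ ⟨hm, hr, hc⟩)

/-- The minimal codimension `C` and the number `θ` of minimizing Kostant partitions
are invariant under arbitrary permutations of the dimension vector. -/
theorem stmt8 (N : ℕ) (hN : 1 ≤ N) (d d' : ℕ → ℕ) (r : ℕ) (hr : ∀ i ≤ N, r ≤ d i)
    (σ : Equiv.Perm (Fin (N + 1))) (hσ : ∀ i : Fin (N + 1), d' (i : ℕ) = d ((σ i : Fin (N + 1)) : ℕ)) :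
    KPmin N d r = KPmin N d' r ∧ KPcount N d r = KPcount N d' r := by
  have hr' : ∀ i ≤ N, r ≤ d' i := fun i hi => by
    have := hσ ⟨i, by omega⟩
    rw [this]
    exact hr _ (by omega)
  have h := kpRankSum_perm hσ r
  have hmin : KPmin N d r = KPmin N d' r :=
    (KPmin_le_of_kpRankSum_eq (exists_isKostant hN hr') h).antisymm
      (KPmin_le_of_kpRankSum_eq (exists_isKostant hN hr) h.symm)
  refine ⟨hmin, ?_⟩
  have hcount := (coeff_kpRankSum le_rfl).symm.trans
    ((congrArg _ h).trans (coeff_kpRankSum hmin.le))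
  rw [KPcount, KPcount, ← hmin]
  exact_mod_cast hcount
end

section
/- Fix N ≥ 1 and d ∈ ℕ^{N+1}, and let d' = (d'_0 ≤ d'_1 ≤ … ≤ d'_N) be the weakly increasing rearrangement of d. Then min_{m ∈ M^0_d} c(m) = min{ G(e) : e = (e_1,…,e_N) ∈ ℕ^N, Σ_{i=1}^N e_i = d'_0 }, where G(e) = Σ_{1 ≤ j ≤ i ≤ N} e_i (e_j + d'_j − d'_{j−1}). Moreover, the number of m ∈ M^0_d attaining the left-hand minimum equals the number of e attaining the right-hand minimum. -/
/-- The feasible set of the quadratic integer program: tuples `e = (e_1,…,e_N) ∈ ℕ^N`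
with `Σ_{i=1}^N e_i = d'_0`. -/
def QipSet (N : ℕ) (d' : ℕ → ℕ) : Set (ℕ → ℕ) :=
  {e | (∀ i : ℕ, ¬(1 ≤ i ∧ i ≤ N) → e i = 0) ∧ ∑ i ∈ Finset.Icc 1 N, e i = d' 0}

/-- `G(e) = Σ_{1 ≤ j ≤ i ≤ N} e_i (e_j + d'_j − d'_{j−1})`, the objective of (QIP). -/
def Gqip (N : ℕ) (d' : ℕ → ℕ) (e : ℕ → ℕ) : ℕ :=
  ∑ i ∈ Finset.Icc 1 N, ∑ j ∈ Finset.Icc 1 i, e i * (e j + d' j - d' (j - 1))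

/-- The minimal value of the quadratic integer program. -/
noncomputable def QipMin (N : ℕ) (d' : ℕ → ℕ) : ℕ :=
  sInf {n : ℕ | ∃ e ∈ QipSet N d', Gqip N d' e = n}

/-- `qInv n = 1 / ((1 - X) (1 - X ^ 2) ⋯ (1 - X ^ n))`. -/
noncomputable def qInv : ℕ → PowerSeries ℚ
  | 0 => 1
  | n + 1 => qInv n * (1 - PowerSeries.X ^ (n + 1))⁻¹

lemma constantCoeff_one_sub_X_pow_succ (n : ℕ) :
    PowerSeries.constantCoeff (1 - PowerSeries.X ^ (n + 1) : PowerSeries ℚ) = 1 := by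
  simp

lemma one_sub_X_pow_succ_ne_zero (n : ℕ) :
    (1 - PowerSeries.X ^ (n + 1) : PowerSeries ℚ) ≠ 0 := fun h => by
  simpa [h] using constantCoeff_one_sub_X_pow_succ n

lemma constantCoeff_qInv (n : ℕ) : PowerSeries.constantCoeff (qInv n) = 1 := by
  induction n with
  | zero => simp [qInv]
  | succ n ih =>
    rw [qInv, map_mul, ih, PowerSeries.constantCoeff_inv, constantCoeff_one_sub_X_pow_succ]
    norm_num

lemma one_sub_mul_qInv_succ (n : ℕ) :
    (1 - PowerSeries.X ^ (n + 1)) * qInv (n + 1) = qInv n := by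
  rw [qInv, mul_left_comm, PowerSeries.mul_inv_cancel _ (by simp), mul_one]

/-- `qInv (n - r)`, extended by zero to `n < r`. -/
noncomputable def qInvSub (n r : ℕ) : PowerSeries ℚ :=
  if r ≤ n then qInv (n - r) else 0

lemma qInvSub_of_le {n r : ℕ} (h : r ≤ n) : qInvSub n r = qInv (n - r) := if_pos h

lemma qInvSub_of_lt {n r : ℕ} (h : n < r) : qInvSub n r = 0 := if_neg h.not_ge

lemma qInvSub_self (n : ℕ) : qInvSub n n = 1 := by
  simp [qInvSub, qInv]

lemma qInvSub_zero (n : ℕ) : qInvSub n 0 = qInv n := by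
  simp [qInvSub]

lemma qInvSub_succ_succ (n r : ℕ) : qInvSub (n + 1) (r + 1) = qInvSub n r := by
  simp [qInvSub]

lemma one_sub_mul_qInvSub (n r : ℕ) :
    (1 - PowerSeries.X ^ (n - r)) * qInvSub n r = qInvSub n (r + 1) := by
  rcases lt_or_ge r n with h | h
  · obtain ⟨k, rfl⟩ := Nat.exists_eq_add_of_lt h
    rw [qInvSub_of_le h.le, qInvSub_of_le (by omega), show r + k + 1 - r = k + 1 by omega,
      show r + k + 1 - (r + 1) = k by omega, one_sub_mul_qInv_succ]
  · rw [qInvSub_of_lt (Nat.lt_succ_of_le h), Nat.sub_eq_zero_of_le h]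
    simp

lemma one_sub_mul_qInvSub_succ (n r : ℕ) :
    (1 - PowerSeries.X ^ (n + 1 - r)) * qInvSub (n + 1) r = qInvSub n r := by
  rw [one_sub_mul_qInvSub, qInvSub_succ_succ]

lemma sum_qInvSub_mul (B r n a : ℕ) (ha : a < B) :
    ∑ s ∈ Finset.range B, qInvSub s r *
      (PowerSeries.X ^ ((a - s) * (n - s)) * qInvSub a s * qInvSub n s) =
      qInvSub a r * qInvSub n r := by
  rcases lt_or_ge a r with har | har
  · rw [qInvSub_of_lt har, zero_mul]
    refine Finset.sum_eq_zero fun s _ => ?_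
    rcases lt_or_ge s r with hs | hs
    · simp [qInvSub_of_lt hs]
    · simp [qInvSub_of_lt (har.trans_le hs)]
  induction a, har using Nat.le_induction with
  | base =>
    rw [Finset.sum_eq_single r]
    · simp [qInvSub_self]
    · intro s _ hs
      rcases lt_or_gt_of_ne hs with hs | hs <;> simp [qInvSub_of_lt hs]
    · intro h
      simp [ha] at h
  | succ a har ih =>
    have key : (1 - PowerSeries.X ^ (a + 1 - r)) * ∑ s ∈ Finset.range B, qInvSub s r *
        (PowerSeries.X ^ ((a + 1 - s) * (n - s)) * qInvSub (a + 1) s * qInvSub n s) =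
        ∑ s ∈ Finset.range B, qInvSub s r *
          (PowerSeries.X ^ ((a - s) * (n - s)) * qInvSub a s * qInvSub n s) := by
      obtain ⟨B, rfl⟩ : ∃ C, B = C + 1 := ⟨B - 1, by omega⟩
      have split : ∀ s, (1 - PowerSeries.X ^ (a + 1 - r)) * (qInvSub s r *
          (PowerSeries.X ^ ((a + 1 - s) * (n - s)) * qInvSub (a + 1) s * qInvSub n s)) =
          qInvSub s r * (PowerSeries.X ^ ((a + 1 - s) * (n - s)) * qInvSub a s * qInvSub n s) +
          (1 - PowerSeries.X ^ (s - r)) * qInvSub s r * (PowerSeries.X ^ (a + 1 - s) *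
          PowerSeries.X ^ ((a + 1 - s) * (n - s)) * qInvSub (a + 1) s * qInvSub n s) := by
        intro s
        rw [← one_sub_mul_qInvSub_succ a s]
        rcases lt_or_ge s r with hs | hs
        · simp [qInvSub_of_lt hs]
        rcases lt_or_ge (a + 1) s with hs' | hs'
        · simp [qInvSub_of_lt hs']
        rw [show a + 1 - r = (a + 1 - s) + (s - r) by omega]
        ring
      rw [Finset.mul_sum, Finset.sum_congr rfl fun s _ => split s, Finset.sum_add_distrib,
        Finset.sum_range_succ' (fun s => (1 - PowerSeries.X ^ (s - r)) * _ * _),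
        Finset.sum_range_succ, Finset.sum_range_succ]
      have h0 : (1 - PowerSeries.X ^ (0 - r)) * qInvSub 0 r = 0 := by simp
      rw [h0, qInvSub_of_lt (show a < B by omega)]
      simp only [mul_zero, zero_mul, add_zero]
      rw [← Finset.sum_add_distrib]
      refine Finset.sum_congr rfl fun t _ => ?_
      rw [one_sub_mul_qInvSub_succ, qInvSub_succ_succ, ← one_sub_mul_qInvSub n t,
        Nat.add_sub_add_right]
      rcases lt_or_ge a t with hs' | hs'
      · simp [qInvSub_of_lt hs']
      rcases lt_or_ge n t with hs | hs
      · simp [qInvSub_of_lt hs]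
      obtain ⟨x, rfl⟩ := Nat.exists_eq_add_of_le hs'
      obtain ⟨y, rfl⟩ := Nat.exists_eq_add_of_le hs
      rw [show t + x + 1 - t = x + 1 by omega, show t + x - t = x by omega,
        show t + y - t = y by omega, show t + y - (t + 1) = y - 1 by omega]
      rcases y with _ | y
      · simp
      · simp only [Nat.add_sub_cancel]
        ring
    rw [ih (by omega), ← one_sub_mul_qInvSub_succ a r, mul_assoc] at key
    refine mul_left_cancel₀ ?_ key
    rw [show a + 1 - r = (a - r) + 1 by omega]
    exact one_sub_X_pow_succ_ne_zero _

/-- Generating function of the rank sequences of a chain of `N` composable maps between spaces of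
dimensions `d 0, …, d N`, with final rank `r`; ranks are bounded by `B`. -/
noncomputable def rankSeries (B : ℕ) (d : ℕ → ℕ) : ℕ → ℕ → PowerSeries ℚ
  | 0, r => if r = d 0 then 1 else 0
  | N + 1, r => ∑ a ∈ Finset.range B, rankSeries B d N a *
      (PowerSeries.X ^ ((a - r) * (d (N + 1) - r)) * qInvSub a r * qInvSub (d (N + 1)) r)

lemma sum_qInvSub_mul_rankSeries (B : ℕ) (d : ℕ → ℕ) (hB : d 0 < B) (N r : ℕ) :
    ∑ s ∈ Finset.range B, qInvSub s r * rankSeries B d N s =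
      ∏ k ∈ Finset.range (N + 1), qInvSub (d k) r := by
  induction N with
  | zero => simp [rankSeries, hB]
  | succ N ih =>
    rw [Finset.prod_range_succ, ← ih, Finset.sum_mul]
    simp only [rankSeries, Finset.mul_sum]
    rw [Finset.sum_comm]
    refine Finset.sum_congr rfl fun a ha => ?_
    rw [mul_right_comm, ← sum_qInvSub_mul B r _ a (Finset.mem_range.1 ha), Finset.sum_mul]
    exact Finset.sum_congr rfl fun s _ => by ring

lemma eq_of_sum_qInvSub_mul_eq (B : ℕ) (f g : ℕ → PowerSeries ℚ)
    (h : ∀ r, ∑ s ∈ Finset.range B, qInvSub s r * f s =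
      ∑ s ∈ Finset.range B, qInvSub s r * g s) (r : ℕ) (hr : r < B) : f r = g r := by
  induction k : B - r using Nat.strong_induction_on generalizing r with
  | _ k ih =>
    have key : ∑ s ∈ Finset.range B, qInvSub s r * (f s - g s) = 0 := by
      simp only [mul_sub, Finset.sum_sub_distrib, h r, sub_self]
    rw [Finset.sum_eq_single r] at key
    · simpa [qInvSub_self, sub_eq_zero] using key
    · intro s hs hsr
      rcases lt_or_gt_of_ne hsr with hsr | hsr
      · simp [qInvSub_of_lt hsr]
      · rw [ih (B - s) (by omega) s (Finset.mem_range.1 hs) rfl]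
        simp
    · simp [hr]

lemma rankSeries_eq_of_perm (B N : ℕ) (d d' : ℕ → ℕ) (hd : d 0 < B) (hd' : d' 0 < B)
    (σ : Equiv.Perm (Fin (N + 1)))
    (hσ : ∀ i : Fin (N + 1), d' (i : ℕ) = d ((σ i : Fin (N + 1)) : ℕ)) (r : ℕ) (hr : r < B) :
    rankSeries B d N r = rankSeries B d' N r := by
  refine eq_of_sum_qInvSub_mul_eq B _ _ (fun s => ?_) r hr
  rw [sum_qInvSub_mul_rankSeries B d hd, sum_qInvSub_mul_rankSeries B d' hd',
    Finset.prod_range, Finset.prod_range]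
  simp only [hσ]
  exact (Equiv.prod_comp σ fun i : Fin (N + 1) => qInvSub (d i) s).symm
/-- `S` is a finite set over which `h` sums to `f`. -/
def HasSetSum {α R : Type*} [AddCommMonoid R] (S : Set α) (h : α → R) (f : R) : Prop :=
  ∃ F : Finset α, (F : Set α) = S ∧ ∑ a ∈ F, h a = f

namespace HasSetSum

lemma of_eq_empty {α R : Type*} [AddCommMonoid R] {S : Set α} (hS : S = ∅) (h : α → R) :
    HasSetSum S h 0 :=
  ⟨∅, by simp [hS], by simp⟩

lemma singleton {α R : Type*} [AddCommMonoid R] (a : α) (h : α → R) :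
    HasSetSum {a} h (h a) :=
  ⟨{a}, by simp, by simp⟩

lemma of_fibers {α ι R : Type*} [AddCommMonoid R] {S : Set α} {h : α → R} (ρ : α → ι)
    (I : Finset ι) (f : ι → R) (hρ : ∀ a ∈ S, ρ a ∈ I)
    (hf : ∀ i ∈ I, HasSetSum {a ∈ S | ρ a = i} h (f i)) : HasSetSum S h (∑ i ∈ I, f i) := by
  classical
  choose! F hF hsum using hf
  have mem : ∀ i ∈ I, ∀ a, a ∈ F i ↔ a ∈ S ∧ ρ a = i := fun i hi a => by
    rw [← Finset.mem_coe, hF i hi, Set.mem_ofPred_eq]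
  refine ⟨I.biUnion F, ?_, ?_⟩
  · ext a
    simp only [Finset.coe_biUnion, Finset.mem_coe, Set.mem_iUnion, exists_prop]
    constructor
    · rintro ⟨i, hi, ha⟩
      exact ((mem i hi a).1 ha).1
    · intro ha
      exact ⟨ρ a, hρ a ha, (mem _ (hρ a ha) a).2 ⟨ha, rfl⟩⟩
  · rw [Finset.sum_biUnion, Finset.sum_congr rfl hsum]
    intro i hi j hj hij
    refine Finset.disjoint_left.2 fun a ha ha' => hij ?_
    rw [← ((mem i hi a).1 ha).2, ((mem j hj a).1 ha').2]

lemma of_bijOn {α β R : Type*} [NonUnitalNonAssocSemiring R] {S : Set α} {S' : Set β} {h : α → R}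
    {h' : β → R} {f : R} (hf : HasSetSum S h f) (φ : α → β) (hφ : Set.BijOn φ S S') (k : R)
    (hk : ∀ a ∈ S, h' (φ a) = k * h a) : HasSetSum S' h' (k * f) := by
  classical
  obtain ⟨F, rfl, rfl⟩ := hf
  refine ⟨F.image φ, by rw [Finset.coe_image, hφ.image_eq], ?_⟩
  rw [Finset.sum_image hφ.injOn, Finset.mul_sum]
  exact Finset.sum_congr rfl hk

end HasSetSum

section Minimizers

variable {α β : Type*}

lemma coeff_sum_X_pow_mul (F : Finset α) (c : α → ℕ) (u : α → PowerSeries ℚ)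
    (hu : ∀ a, PowerSeries.constantCoeff (u a) = 1) (n : ℕ) (hn : ∀ a ∈ F, n ≤ c a) :
    PowerSeries.coeff n (∑ a ∈ F, (PowerSeries.X : PowerSeries ℚ) ^ c a * u a) =
      ({a ∈ F | c a = n} : Finset α).card := by
  rw [map_sum, Finset.card_filter, Nat.cast_sum]
  refine Finset.sum_congr rfl fun a ha => ?_
  rw [PowerSeries.coeff_X_pow_mul']
  rcases (hn a ha).eq_or_lt with h | h
  · simp [h, hu]
  · simp [h.not_ge, h.ne']

lemma forall_le_iff_coeff_eq_zero (F : Finset α) (c : α → ℕ) (u : α → PowerSeries ℚ)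
    (hu : ∀ a, PowerSeries.constantCoeff (u a) = 1) (n : ℕ) :
    (∀ a ∈ F, n ≤ c a) ↔
      ∀ k < n, PowerSeries.coeff k (∑ a ∈ F, (PowerSeries.X : PowerSeries ℚ) ^ c a * u a) = 0 := by
  constructor
  · intro h k hk
    rw [coeff_sum_X_pow_mul F c u hu k fun a ha => hk.le.trans (h a ha), Nat.cast_eq_zero,
      Finset.card_eq_zero, Finset.filter_eq_empty_iff]
    exact fun a ha => (hk.trans_le (h a ha)).ne'
  · induction n with
    | zero => simp
    | succ n ih =>
      intro h a ha
      have hn := ih fun k hk => h k (by omega)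
      have h0 := h n n.lt_succ_self
      rw [coeff_sum_X_pow_mul F c u hu n hn, Nat.cast_eq_zero, Finset.card_eq_zero,
        Finset.filter_eq_empty_iff] at h0
      exact Nat.lt_of_le_of_ne (hn a ha) (Ne.symm (h0 ha))

lemma sInf_eq_and_ncard_eq_of_hasSetSum {S : Set α} {S' : Set β} {c : α → ℕ} {c' : β → ℕ}
    {u : α → PowerSeries ℚ} {u' : β → PowerSeries ℚ} {f : PowerSeries ℚ}
    (hu : ∀ a, PowerSeries.constantCoeff (u a) = 1)
    (hu' : ∀ a, PowerSeries.constantCoeff (u' a) = 1)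
    (h : HasSetSum S (fun a => PowerSeries.X ^ c a * u a) f)
    (h' : HasSetSum S' (fun a => PowerSeries.X ^ c' a * u' a) f) :
    sInf (c '' S) = sInf (c' '' S') ∧
      {a ∈ S | c a = sInf (c '' S)}.ncard = {a ∈ S' | c' a = sInf (c' '' S')}.ncard := by
  obtain ⟨F, rfl, rfl⟩ := h
  obtain ⟨F', rfl, hF⟩ := h'
  have bounds : ∀ n, (∀ a ∈ F, n ≤ c a) ↔ ∀ a ∈ F', n ≤ c' a := fun n => by
    rw [forall_le_iff_coeff_eq_zero F c u hu, forall_le_iff_coeff_eq_zero F' c' u' hu', hF]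
  have lb : ∀ a ∈ F, sInf (c '' F) ≤ c a := fun a ha => Nat.sInf_le ⟨a, ha, rfl⟩
  have lb' : ∀ a ∈ F', sInf (c' '' F') ≤ c' a := fun a ha => Nat.sInf_le ⟨a, ha, rfl⟩
  have heq : sInf (c '' F) = sInf (c' '' F') := by
    rcases F.eq_empty_or_nonempty with rfl | hne
    · rcases F'.eq_empty_or_nonempty with rfl | ⟨b, hb⟩
      · simp
      · have := (bounds (c' b + 1)).1 (by simp) b hb
        omega
    rcases F'.eq_empty_or_nonempty with rfl | hne'
    · obtain ⟨a, ha⟩ := hne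
      have := (bounds (c a + 1)).2 (by simp) a ha
      omega
    refine le_antisymm (le_csInf (by simpa using hne') ?_)
      (le_csInf (by simpa using hne) ?_)
    · rintro _ ⟨b, hb, rfl⟩
      exact (bounds _).1 lb b hb
    · rintro _ ⟨a, ha, rfl⟩
      exact (bounds _).2 lb' a ha
  refine ⟨heq, ?_⟩
  rw [← heq] at lb' ⊢
  have h1 := coeff_sum_X_pow_mul F c u hu _ lb
  have h2 := coeff_sum_X_pow_mul F' c' u' hu' _ lb'
  rw [hF, h1, Nat.cast_inj] at h2
  rw [← Set.ncard_coe_finset, ← Set.ncard_coe_finset, Finset.coe_filter, Finset.coe_filter] at h2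
  exact h2

end Minimizers

/-- The rank drops `e_1, …, e_N` along a chain of `N` composable maps between spaces of dimensions
`d 0, …, d N` with final rank `r`. -/
def rankDrops (d : ℕ → ℕ) (N r : ℕ) : Set (ℕ → ℕ) :=
  {e | (∀ i : ℕ, ¬(1 ≤ i ∧ i ≤ N) → e i = 0) ∧ ∑ i ∈ Finset.Icc 1 N, e i + r = d 0 ∧
    ∀ i ∈ Finset.Icc 1 N, d 0 ≤ d i + ∑ j ∈ Finset.Icc 1 i, e j}

/-- The excess of `d i` over the rank `d 0 - (e_1 + ⋯ + e_i)`. -/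
def corank (d e : ℕ → ℕ) (i : ℕ) : ℕ := d i + ∑ j ∈ Finset.Icc 1 i, e j - d 0

/-- The summand of `rankSeries` attached to a sequence of rank drops. -/
noncomputable def rankDropsWeight (d : ℕ → ℕ) (N : ℕ) (e : ℕ → ℕ) : PowerSeries ℚ :=
  ∏ i ∈ Finset.Icc 1 N,
    PowerSeries.X ^ (e i * corank d e i) * (qInv (e i) * qInv (corank d e i))

lemma sum_Icc_one_update_of_lt (e : ℕ → ℕ) (n x i : ℕ) (hi : i < n) :
    ∑ j ∈ Finset.Icc 1 i, Function.update e n x j = ∑ j ∈ Finset.Icc 1 i, e j :=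
  Finset.sum_congr rfl fun j hj => Function.update_of_ne
    (by have := (Finset.mem_Icc.1 hj).2; omega) _ _

lemma bijOn_update_rankDrops (d : ℕ → ℕ) (N a r : ℕ) (hra : r ≤ a) (hr : r ≤ d (N + 1)) :
    Set.BijOn (fun e => Function.update e (N + 1) (a - r)) (rankDrops d N a)
      {e ∈ rankDrops d (N + 1) r | r + e (N + 1) = a} := by
  refine ⟨?_, ?_, ?_⟩
  · rintro e ⟨h0, hsum, hle⟩
    have hS := sum_Icc_one_update_of_lt e (N + 1) (a - r) N (by omega)
    refine ⟨⟨fun i hi => ?_, ?_, fun i hi => ?_⟩, ?_⟩ <;> beta_reduce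
    · rw [Function.update_of_ne (by omega)]
      exact h0 i (by omega)
    · rw [Finset.sum_Icc_succ_top (by omega), hS, Function.update_self]
      omega
    · rw [Finset.mem_Icc] at hi
      rcases (show i ≤ N ∨ i = N + 1 by omega) with h | rfl
      · rw [sum_Icc_one_update_of_lt _ _ _ _ (by omega)]
        exact hle i (Finset.mem_Icc.2 ⟨hi.1, h⟩)
      · rw [Finset.sum_Icc_succ_top (by omega), hS, Function.update_self]
        omega
    · simp only [Function.update_self]
      omega
  · intro e he e' he' h
    funext i
    rcases eq_or_ne i (N + 1) with rfl | hi
    · rw [he.1 _ (by omega), he'.1 _ (by omega)]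
    · simpa [Function.update_of_ne hi] using congrFun h i
  · rintro e ⟨⟨h0, hsum, hle⟩, hea⟩
    refine ⟨Function.update e (N + 1) 0, ⟨fun i hi => ?_, ?_, fun i hi => ?_⟩, ?_⟩
    · rcases eq_or_ne i (N + 1) with rfl | hi'
      · simp
      · rw [Function.update_of_ne hi']
        exact h0 i (by omega)
    · rw [Finset.sum_Icc_succ_top (by omega)] at hsum
      rw [sum_Icc_one_update_of_lt _ _ _ _ (by omega)]
      omega
    · rw [Finset.mem_Icc] at hi
      rw [sum_Icc_one_update_of_lt _ _ _ _ (by omega)]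
      exact hle i (Finset.mem_Icc.2 ⟨hi.1, by omega⟩)
    · beta_reduce
      rw [Function.update_idem, show a - r = e (N + 1) by omega, Function.update_eq_self]

lemma rankDropsWeight_update (d e : ℕ → ℕ) (N x : ℕ) :
    rankDropsWeight d N (Function.update e (N + 1) x) = rankDropsWeight d N e := by
  refine Finset.prod_congr rfl fun i hi => ?_
  have hi := Finset.mem_Icc.1 hi
  rw [corank, corank, sum_Icc_one_update_of_lt _ _ _ _ (by omega),
    Function.update_of_ne (by omega)]

lemma hasSetSum_rankDrops (B : ℕ) (d : ℕ → ℕ) (hB : d 0 < B) (N r : ℕ) :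
    HasSetSum (rankDrops d N r) (rankDropsWeight d N) (rankSeries B d N r) := by
  induction N generalizing r with
  | zero =>
    rw [rankSeries]
    split_ifs with h
    · have hS : rankDrops d 0 r = {0} := by
        ext e
        simp [rankDrops, h, funext_iff]
        exact ⟨fun h i => h i (by omega), fun h i _ => h i⟩
      rw [hS]
      simpa [rankDropsWeight] using HasSetSum.singleton (0 : ℕ → ℕ) (rankDropsWeight d 0)
    · refine HasSetSum.of_eq_empty (Set.eq_empty_of_forall_notMem fun e he => h ?_) _
      simpa using he.2.1
  | succ N ih =>
    refine HasSetSum.of_fibers (fun e => r + e (N + 1)) _ _ (fun e he => ?_) fun a _ => ?_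
    · have := he.2.1
      rw [Finset.sum_Icc_succ_top (by omega)] at this
      rw [Finset.mem_range]
      omega
    by_cases h : r ≤ a ∧ r ≤ d (N + 1)
    · rw [mul_comm]
      refine (ih a).of_bijOn _ (bijOn_update_rankDrops d N a r h.1 h.2) _ fun e he => ?_
      have hS := sum_Icc_one_update_of_lt e (N + 1) (a - r) N (by omega)
      have hc : corank d (Function.update e (N + 1) (a - r)) (N + 1) = d (N + 1) - r := by
        rw [corank, Finset.sum_Icc_succ_top (by omega), hS, Function.update_self]
        have := he.2.1
        omega
      rw [rankDropsWeight, Finset.prod_Icc_succ_top (by omega), hc, Function.update_self,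
        ← rankDropsWeight, rankDropsWeight_update, qInvSub_of_le h.1, qInvSub_of_le h.2]
      ring
    · have hzero : qInvSub a r * qInvSub (d (N + 1)) r = 0 := by
        rcases not_and_or.1 h with h | h <;> simp [qInvSub_of_lt (not_le.1 h)]
      rw [mul_assoc (_ ^ _), hzero, mul_zero, mul_zero]
      refine HasSetSum.of_eq_empty (Set.eq_empty_of_forall_notMem ?_) _
      rintro e ⟨⟨_, hsum, hle⟩, hea⟩
      have := hle (N + 1) (by simp)
      omega

@[to_additive]
lemma prod_Icc_succ_succ {M : Type*} [CommMonoid M] (f : ℕ → M) (a b : ℕ) :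
    ∏ x ∈ Finset.Icc (a + 1) (b + 1), f x = ∏ x ∈ Finset.Icc a b, f (x + 1) := by
  rw [← Finset.map_add_right_Icc, Finset.prod_map]
  rfl

@[to_additive]
lemma prod_Icc_eq_prod_range {M : Type*} [CommMonoid M] (f : ℕ → M) (n : ℕ) :
    ∏ x ∈ Finset.Icc 1 n, f x = ∏ x ∈ Finset.range n, f (x + 1) := by
  induction n with
  | zero => simp
  | succ n ih => rw [Finset.prod_Icc_succ_top (by omega), Finset.prod_range_succ, ih]

lemma kpCodim_succ (N : ℕ) (m : ℕ → ℕ → ℕ) :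
    kpCodim (N + 1) m = ∑ i ∈ Finset.Icc 1 (N + 1),
        m 0 (i - 1) * ∑ u ∈ Finset.Icc 1 i, ∑ v ∈ Finset.Icc i (N + 1), m u v +
      kpCodim N fun i j => m (i + 1) (j + 1) := by
  rw [kpCodim, ← Finset.add_sum_Ioc_eq_sum_Icc (by omega)]
  congr 1
  · rw [Finset.sum_comm' (t' := Finset.Icc 1 (N + 1)) (s' := fun j => Finset.Icc 1 j)]
    · simp only [Finset.mul_sum, Nat.sub_self]
    · intro u j
      simp only [Finset.mem_Icc]
      omega
  · rw [show Finset.Ioc 1 (N + 1) = Finset.Icc (1 + 1) (N + 1) by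
      ext; simp only [Finset.mem_Ioc, Finset.mem_Icc]; omega, sum_Icc_succ_succ, kpCodim]
    refine Finset.sum_congr rfl fun i hi => ?_
    rw [sum_Icc_succ_succ]
    refine Finset.sum_congr rfl fun u hu => ?_
    rw [sum_Icc_succ_succ]
    refine Finset.sum_congr rfl fun j hj => ?_
    rw [sum_Icc_succ_succ]
    rw [Finset.mem_Icc] at hi hu hj
    rw [show i + 1 - 1 = i - 1 + 1 by omega, show j + 1 - 1 = j - 1 + 1 by omega]

/-- The rank drops recorded by the first row of a Kostant partition. -/
def rowDrops (N : ℕ) (m : ℕ → ℕ → ℕ) (i : ℕ) : ℕ :=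
  if 1 ≤ i ∧ i ≤ N then m 0 (i - 1) else 0

lemma sum_rowDrops (N : ℕ) (m : ℕ → ℕ → ℕ) (k : ℕ) (hk : k ≤ N) :
    ∑ i ∈ Finset.Icc 1 k, rowDrops N m i = ∑ j ∈ Finset.range k, m 0 j := by
  rw [sum_Icc_eq_sum_range]
  refine Finset.sum_congr rfl fun j hj => ?_
  have := Finset.mem_range.1 hj
  rw [rowDrops, if_pos (by omega), Nat.add_sub_cancel]

lemma isKostant_succ_iff (N : ℕ) (d : ℕ → ℕ) (m : ℕ → ℕ → ℕ) :
    IsKostant (N + 1) d m ↔ rowDrops (N + 1) m ∈ rankDrops d (N + 1) (m 0 (N + 1)) ∧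
      (∀ j, N + 1 < j → m 0 j = 0) ∧ (∀ i, m (i + 1) 0 = 0) ∧
      IsKostant N (fun k => corank d (rowDrops (N + 1) m) (k + 1))
        fun i j => m (i + 1) (j + 1) := by
  have htail : ∀ k ≤ N + 1, ∑ j ∈ Finset.range k, m 0 j + ∑ j ∈ Finset.Icc k (N + 1), m 0 j =
      ∑ j ∈ Finset.range (N + 1), m 0 j + m 0 (N + 1) := fun k hk => by
    rw [← Finset.sum_range_succ, ← Finset.sum_range_add_sum_Ico _ (show k ≤ N + 1 + 1 by omega)]
    rfl
  have hcol : ∀ k, ∑ i ∈ Finset.range (k + 1 + 1), ∑ j ∈ Finset.Icc (k + 1) (N + 1), m i j =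
      ∑ i ∈ Finset.range (k + 1), ∑ j ∈ Finset.Icc k N, m (i + 1) (j + 1) +
        ∑ j ∈ Finset.Icc (k + 1) (N + 1), m 0 j := fun k => by
    rw [Finset.sum_range_succ']
    simp only [sum_Icc_succ_succ]
  have hsum := sum_rowDrops (N + 1) m
  have htail0 := htail 0 (by omega)
  rw [Finset.sum_range_zero, zero_add] at htail0
  constructor
  · rintro ⟨hsupp, hdim⟩
    have h0 := hdim 0 (by omega)
    rw [Finset.sum_range_one, htail0] at h0
    have hk : ∀ k ≤ N, _ := fun k hk => hdim (k + 1) (by omega)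
    simp only [hcol] at hk
    refine ⟨⟨fun i hi => if_neg hi, ?_, fun i hi => ?_⟩, fun j hj => hsupp _ _ (by omega),
      fun i => hsupp _ _ (by omega), fun i j hij => hsupp _ _ (by omega), fun k hkN => ?_⟩
    · rw [hsum _ le_rfl, h0]
    · obtain ⟨hi1, hi2⟩ := Finset.mem_Icc.1 hi
      obtain ⟨k, rfl⟩ := Nat.exists_eq_add_of_le' hi1
      rw [hsum _ hi2]
      have := htail _ hi2
      have := hk k (by omega)
      omega
    · simp only [corank, hsum (k + 1) (by omega)]
      have := htail (k + 1) (by omega)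
      have := hk k hkN
      omega
  · rintro ⟨⟨-, hsum0, hle⟩, hrow, hcol0, hsupp, hdim⟩
    rw [hsum _ le_rfl] at hsum0
    refine ⟨fun i j hij => ?_, fun k hk => ?_⟩
    · rcases i with _ | i
      · exact hrow j (by omega)
      · rcases j with _ | j
        · exact hcol0 i
        · exact hsupp i j (by omega)
    · rcases k with _ | k
      · rw [zero_add, Finset.sum_range_one, htail0, hsum0]
      · have h1 := hle (k + 1) (Finset.mem_Icc.2 (by omega))
        have h2 := hdim k (by omega)
        have h3 := htail (k + 1) hk
        simp only [corank, hsum _ hk] at h1 h2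
        rw [hcol]
        omega

/-- The family on vertices `0, …, N + 1` with first row given by rank drops `e` and final rank `r`,
and the family `m` on vertices `1, …, N + 1`. -/
def prependRow (N r : ℕ) (e : ℕ → ℕ) (m : ℕ → ℕ → ℕ) : ℕ → ℕ → ℕ
  | 0, j => if j = N + 1 then r else e (j + 1)
  | _ + 1, 0 => 0
  | i + 1, j + 1 => m i j

lemma rowDrops_prependRow (N r : ℕ) (e : ℕ → ℕ) (m : ℕ → ℕ → ℕ)
    (he : ∀ i : ℕ, ¬(1 ≤ i ∧ i ≤ N + 1) → e i = 0) :
    rowDrops (N + 1) (prependRow N r e m) = e := by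
  funext i
  rw [rowDrops]
  split_ifs with h
  · rw [prependRow, if_neg (by omega), Nat.sub_add_cancel h.1]
  · exact (he i h).symm

lemma bijOn_prependRow (N r : ℕ) (d e : ℕ → ℕ) (he : e ∈ rankDrops d (N + 1) r) :
    Set.BijOn (prependRow N r e) {m | IsKostant N (fun k => corank d e (k + 1)) m}
      {m ∈ {m | IsKostant (N + 1) d m ∧ m 0 (N + 1) = r} | rowDrops (N + 1) m = e} := by
  refine ⟨fun m hm => ?_, fun m _ m' _ h => ?_, ?_⟩
  · have hrow := rowDrops_prependRow N r e m he.1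
    have hr : prependRow N r e m 0 (N + 1) = r := by simp [prependRow]
    refine ⟨⟨(isKostant_succ_iff N d _).2 ⟨?_, fun j hj => ?_, fun i => rfl, ?_⟩, hr⟩, hrow⟩
    · rw [hrow, hr]
      exact he
    · rw [prependRow, if_neg (by omega)]
      exact he.1 _ (by omega)
    · rw [hrow]
      exact hm
  · funext i j
    exact congrFun (congrFun h (i + 1)) (j + 1)
  · rintro m ⟨⟨hm, hr⟩, rfl⟩
    obtain ⟨-, hrow, hcol, hK⟩ := (isKostant_succ_iff N d m).1 hm
    refine ⟨_, hK, ?_⟩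
    funext i j
    rcases i with _ | i
    · rw [prependRow, rowDrops]
      split_ifs with h1 h2
      · rw [h1, hr]
      · rfl
      · exact (hrow j (by omega)).symm
    · rcases j with _ | j
      · exact (hcol i).symm
      · rfl

/-- The product of `1 / ((1 - X) ⋯ (1 - X ^ m_{ij}))` over the entries of a Kostant partition. -/
noncomputable def kpUnit (N : ℕ) (m : ℕ → ℕ → ℕ) : PowerSeries ℚ :=
  ∏ i ∈ Finset.range (N + 1), ∏ j ∈ Finset.range (N + 1), qInv (m i j)

lemma kpCodim_prependRow (N r : ℕ) (d e : ℕ → ℕ) (m : ℕ → ℕ → ℕ)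
    (hm : IsKostant N (fun k => corank d e (k + 1)) m) :
    kpCodim (N + 1) (prependRow N r e m) =
      ∑ i ∈ Finset.range (N + 1), e (i + 1) * corank d e (i + 1) + kpCodim N m := by
  rw [kpCodim_succ, sum_Icc_eq_sum_range]
  congr 1
  refine Finset.sum_congr rfl fun k hk => ?_
  have hk := Finset.mem_range.1 hk
  rw [show corank d e (k + 1) = _ from hm.2 k (by omega), sum_Icc_eq_sum_range,
    Nat.add_sub_cancel, prependRow, if_neg (by omega)]
  simp only [sum_Icc_succ_succ, prependRow]

lemma kpUnit_prependRow (N r : ℕ) (e : ℕ → ℕ) (m : ℕ → ℕ → ℕ) :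
    kpUnit (N + 1) (prependRow N r e m) =
      qInv r * (∏ i ∈ Finset.range (N + 1), qInv (e (i + 1))) * kpUnit N m := by
  rw [kpUnit, Finset.prod_range_succ', mul_comm, Finset.prod_range_succ]
  congr 1
  · rw [mul_comm]
    congr 1
    · simp [prependRow]
    · refine Finset.prod_congr rfl fun j hj => ?_
      rw [prependRow, if_neg (Finset.mem_range.1 hj).ne]
  · refine Finset.prod_congr rfl fun i _ => ?_
    rw [Finset.prod_range_succ']
    simp [prependRow, qInv]

lemma hasSetSum_isKostant_corner (B N r : ℕ) (d : ℕ → ℕ) (hB : d 0 < B)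
    (ih : ∀ d' : ℕ → ℕ, HasSetSum {m | IsKostant N d' m}
      (fun m => PowerSeries.X ^ kpCodim N m * kpUnit N m)
      (∏ k ∈ Finset.range (N + 1), qInv (d' k))) :
    HasSetSum {m | IsKostant (N + 1) d m ∧ m 0 (N + 1) = r}
      (fun m => PowerSeries.X ^ kpCodim (N + 1) m * kpUnit (N + 1) m)
      (qInv r * rankSeries B d (N + 1) r) := by
  obtain ⟨F, hF, hsum⟩ := hasSetSum_rankDrops B d hB (N + 1) r
  rw [← hsum, Finset.mul_sum]
  refine HasSetSum.of_fibers (rowDrops (N + 1)) _ _ ?_ fun e he => ?_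
  · rintro m ⟨hm, rfl⟩
    rw [← Finset.mem_coe, hF]
    exact ((isKostant_succ_iff N d m).1 hm).1
  · rw [← Finset.mem_coe, hF] at he
    have hw : qInv r * rankDropsWeight d (N + 1) e =
        PowerSeries.X ^ (∑ i ∈ Finset.range (N + 1), e (i + 1) * corank d e (i + 1)) *
          (qInv r * ∏ i ∈ Finset.range (N + 1), qInv (e (i + 1))) *
          ∏ k ∈ Finset.range (N + 1), qInv (corank d e (k + 1)) := by
      rw [rankDropsWeight, prod_Icc_eq_prod_range, Finset.prod_mul_distrib,
        Finset.prod_mul_distrib, Finset.prod_pow_eq_pow_sum]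
      ring
    rw [hw]
    refine (ih fun k => corank d e (k + 1)).of_bijOn _ (bijOn_prependRow N r d e he) _
      fun m hm => ?_
    rw [kpCodim_prependRow N r d e m hm, kpUnit_prependRow]
    ring

lemma hasSetSum_isKostant (N : ℕ) (d : ℕ → ℕ) :
    HasSetSum {m | IsKostant N d m} (fun m => PowerSeries.X ^ kpCodim N m * kpUnit N m)
      (∏ k ∈ Finset.range (N + 1), qInv (d k)) := by
  induction N generalizing d with
  | zero =>
    have hS : {m | IsKostant 0 d m} = {fun i j => if i = 0 ∧ j = 0 then d 0 else 0} := by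
      ext m
      simp only [IsKostant, Set.mem_ofPred_eq, Set.mem_singleton_iff]
      constructor
      · rintro ⟨h0, h1⟩
        funext i j
        split_ifs with h
        · simpa [h.1, h.2] using (h1 0 le_rfl).symm
        · exact h0 i j (by omega)
      · rintro rfl
        refine ⟨fun i j h => if_neg (by omega), fun k hk => ?_⟩
        obtain rfl : k = 0 := by omega
        simp
    rw [hS]
    convert HasSetSum.singleton _ _ using 1
    simp [kpCodim, kpUnit]
  | succ N ih =>
    have h := sum_qInvSub_mul_rankSeries (d 0 + 1) d (by omega) (N + 1) 0
    simp only [qInvSub_zero] at h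
    rw [← h]
    refine HasSetSum.of_fibers (fun m : ℕ → ℕ → ℕ => m 0 (N + 1)) _ _ (fun m hm => ?_) fun r _ =>
      hasSetSum_isKostant_corner (d 0 + 1) N r d (by omega) ih
    have := ((isKostant_succ_iff N d m).1 hm).1.2.1
    rw [Finset.mem_range]
    omega

lemma corank_eq_sum (N : ℕ) (d e : ℕ → ℕ) (hmono : ∀ i : ℕ, i < N → d i ≤ d (i + 1)) (i : ℕ)
    (hi : i ≤ N) : corank d e i = ∑ j ∈ Finset.Icc 1 i, (e j + d j - d (j - 1)) := by
  have h : ∀ i ≤ N, d i + ∑ j ∈ Finset.Icc 1 i, e j =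
      ∑ j ∈ Finset.Icc 1 i, (e j + d j - d (j - 1)) + d 0 := by
    intro i hi
    induction i with
    | zero => simp
    | succ i ih =>
      have := hmono i (by omega)
      have := ih (by omega)
      rw [Finset.sum_Icc_succ_top (by omega), Finset.sum_Icc_succ_top (by omega),
        Nat.add_sub_cancel]
      omega
  rw [corank, h i hi, Nat.add_sub_cancel]

lemma rankDrops_zero_eq_qipSet (N : ℕ) (d : ℕ → ℕ) (hmono : ∀ i : ℕ, i < N → d i ≤ d (i + 1)) :
    rankDrops d N 0 = QipSet N d := by
  ext e
  refine ⟨fun h => ⟨h.1, h.2.1⟩, fun h => ⟨h.1, h.2, fun i hi => ?_⟩⟩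
  have : ∀ i ≤ N, d 0 ≤ d i := by
    intro i hi
    induction i with
    | zero => rfl
    | succ i ih => exact (ih (by omega)).trans (hmono i (by omega))
  exact (this i (Finset.mem_Icc.1 hi).2).trans (Nat.le_add_right _ _)

lemma rankDropsWeight_eq (N : ℕ) (d e : ℕ → ℕ) (hmono : ∀ i : ℕ, i < N → d i ≤ d (i + 1)) :
    rankDropsWeight d N e = PowerSeries.X ^ Gqip N d e *
      ∏ i ∈ Finset.Icc 1 N, (qInv (e i) * qInv (corank d e i)) := by
  rw [rankDropsWeight, Finset.prod_mul_distrib, Finset.prod_pow_eq_pow_sum, Gqip]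
  congr 2
  refine Finset.sum_congr rfl fun i hi => ?_
  rw [corank_eq_sum N d e hmono i (Finset.mem_Icc.1 hi).2, Finset.mul_sum]

/-- The minimal orbit codimension over `M^0_d` equals the optimal value of the
quadratic integer program for the weakly increasing rearrangement `d'` of `d`,
and the numbers of minimizers agree. -/
theorem stmt9 (N : ℕ) (hN : 1 ≤ N) (d d' : ℕ → ℕ)
    (σ : Equiv.Perm (Fin (N + 1)))
    (hσ : ∀ i : Fin (N + 1), d' (i : ℕ) = d ((σ i : Fin (N + 1)) : ℕ))
    (hmono : ∀ i : ℕ, i < N → d' i ≤ d' (i + 1)) :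
    KPmin N d 0 = QipMin N d' ∧
      KPcount N d 0 = {e ∈ QipSet N d' | Gqip N d' e = QipMin N d'}.ncard := by
  obtain ⟨N, rfl⟩ := Nat.exists_eq_add_of_le' hN
  have hK := hasSetSum_isKostant_corner (d 0 + d' 0 + 1) N 0 d (by omega) (hasSetSum_isKostant N)
  have hE := hasSetSum_rankDrops (d 0 + d' 0 + 1) d' (by omega) (N + 1) 0
  rw [← rankSeries_eq_of_perm _ _ d d' (by omega) (by omega) σ hσ 0 (by omega),
    rankDrops_zero_eq_qipSet _ _ hmono,
    show rankDropsWeight d' (N + 1) = _ from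
      funext fun e => rankDropsWeight_eq (N + 1) d' e hmono] at hE
  rw [qInv, one_mul] at hK
  obtain ⟨hmin, hcard⟩ := sInf_eq_and_ncard_eq_of_hasSetSum
    (fun m => by simp [kpUnit, map_prod, constantCoeff_qInv])
    (fun e => by simp [map_prod, constantCoeff_qInv]) hK hE
  have hKmin : sInf (kpCodim (N + 1) '' {m | IsKostant (N + 1) d m ∧ m 0 (N + 1) = 0}) =
      KPmin (N + 1) d 0 := by
    simp only [KPmin, Set.image, Set.mem_ofPred_eq, and_assoc]
  have hQmin : sInf (Gqip (N + 1) d' '' QipSet (N + 1) d') = QipMin (N + 1) d' := rfl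
  rw [hKmin, hQmin] at hmin hcard
  refine ⟨hmin, ?_⟩
  rw [← hcard, KPcount]
  simp only [Set.mem_ofPred_eq, and_assoc]
end

section
/- Fix N ≥ 1 and d ∈ ℕ^{N+1} with all d_i ≥ 1, let d' = (d'_0 ≤ … ≤ d'_N) be the weakly increasing rearrangement of d, let m = max{ l ∈ {1,…,N} : Σ_{i=0}^l d'_i ≥ l·d'_l }, and let S = Σ_{i=0}^m d'_i. Then min_{μ ∈ M^0_d} c(μ) = (m/2)·{S/m}·(1 − {S/m}) − (m(m−1)/2)·(S/m)² + Σ_{0 ≤ i < j ≤ m} d'_i d'_j, and the number of μ ∈ M^0_d attaining this minimum equals the binomial coefficient C(m, |S − m·⌊S/m + 1/2⌋|). (These are the codimension and the number of top-dimensional irreducible components of the variety Σ^0_d of tuples of composable matrices multiplying to zero.) -/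
section

open Finset

/-- The pairs `(i, j)` with `i, j ≤ N`, which index the multiplicities. -/
def grid (N : ℕ) : Finset (ℕ × ℕ) := range (N + 1) ×ˢ range (N + 1)

/-- The bilinear form whose quadratic form is `kpCodim`. -/
def pairing (N : ℕ) (F G : ℕ × ℕ → ℕ) : ℕ :=
  ∑ x ∈ grid N, ∑ y ∈ grid N,
    if x.1 < y.1 ∧ y.1 ≤ x.2 + 1 ∧ x.2 < y.2 then F x * G y else 0

/-- The `k`-th entry of the dimension vector of `F`. -/
def dimAt (N : ℕ) (F : ℕ × ℕ → ℕ) (k : ℕ) : ℕ :=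
  ∑ x ∈ grid N, if x.1 ≤ k ∧ k ≤ x.2 then F x else 0

/-- Uncurried form of `IsKostant`. -/
def IsKP (N : ℕ) (d : ℕ → ℕ) (F : ℕ × ℕ → ℕ) : Prop :=
  (∀ x, ¬(x.1 ≤ x.2 ∧ x.2 ≤ N) → F x = 0) ∧ ∀ k ≤ N, dimAt N F k = d k

theorem mem_grid {N : ℕ} {x : ℕ × ℕ} : x ∈ grid N ↔ x.1 ≤ N ∧ x.2 ≤ N := by
  simp [grid]

theorem kpCodim_eq_pairing (N : ℕ) (m : ℕ → ℕ → ℕ) :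
    kpCodim N m = pairing N (fun x => m x.1 x.2) (fun x => m x.1 x.2) := by
  unfold kpCodim pairing
  simp only [Finset.sum_sigma']
  rw [← Finset.sum_filter]
  refine Finset.sum_nbij' (fun x => ⟨(x.1 - 1, x.2.2.1 - 1), (x.2.1, x.2.2.2)⟩)
    (fun y => ⟨y.1.1 + 1, y.2.1, y.1.2 + 1, y.2.2⟩) ?_ ?_ ?_ ?_ ?_
  · rintro ⟨i, u, j, v⟩ h
    simp only [mem_sigma, mem_Icc, mem_filter, mem_grid] at h ⊢
    omega
  · rintro ⟨⟨a, b⟩, ⟨c, e⟩⟩ h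
    simp only [mem_sigma, mem_Icc, mem_filter, mem_grid] at h ⊢
    omega
  · rintro ⟨i, u, j, v⟩ h
    simp only [mem_sigma, mem_Icc] at h
    simp only [Nat.sub_add_cancel (show 1 ≤ i by omega), Nat.sub_add_cancel (show 1 ≤ j by omega)]
  · rintro ⟨⟨a, b⟩, ⟨c, e⟩⟩ h
    simp
  · rintro ⟨i, u, j, v⟩ h
    rfl

theorem isKostant_iff (N : ℕ) (d : ℕ → ℕ) (m : ℕ → ℕ → ℕ) :
    IsKostant N d m ↔ IsKP N d (fun x => m x.1 x.2) := by
  have key : ∀ k ≤ N, dimAt N (fun x => m x.1 x.2) k =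
      ∑ i ∈ range (k + 1), ∑ j ∈ Icc k N, m i j := by
    intro k hk
    unfold dimAt
    rw [← Finset.sum_filter, ← Finset.sum_product']
    refine Finset.sum_congr ?_ fun _ _ => rfl
    ext x
    simp only [mem_filter, mem_grid, mem_product, mem_range, mem_Icc]
    omega
  constructor
  · rintro ⟨h1, h2⟩
    exact ⟨fun x hx => h1 _ _ hx, fun k hk => by rw [key k hk, h2 k hk]⟩
  · rintro ⟨h1, h2⟩
    exact ⟨fun i j hx => h1 (i, j) hx, fun k hk => by rw [← key k hk, h2 k hk]⟩

theorem pairing_add_add (N : ℕ) (F G : ℕ × ℕ → ℕ) :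
    pairing N (F + G) (F + G) =
      pairing N F F + (pairing N F G + pairing N G F) + pairing N G G := by
  unfold pairing
  simp only [← Finset.sum_add_distrib]
  refine Finset.sum_congr rfl fun x _ => Finset.sum_congr rfl fun y _ => ?_
  split_ifs
  · simp only [Pi.add_apply]; ring
  · rfl

theorem pairing_eq_zero_iff (N : ℕ) (F G : ℕ × ℕ → ℕ) :
    pairing N F G = 0 ↔ ∀ x ∈ grid N, ∀ y ∈ grid N,
      x.1 < y.1 → y.1 ≤ x.2 + 1 → x.2 < y.2 → F x * G y = 0 := by
  unfold pairing
  simp only [Finset.sum_eq_zero_iff, ite_eq_right_iff, and_imp]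

theorem dimAt_add (N : ℕ) (F G : ℕ × ℕ → ℕ) (k : ℕ) :
    dimAt N (F + G) k = dimAt N F k + dimAt N G k := by
  unfold dimAt
  rw [← Finset.sum_add_distrib]
  refine Finset.sum_congr rfl fun x _ => ?_
  split_ifs <;> simp

theorem le_dimAt {N : ℕ} (F : ℕ × ℕ → ℕ) {k : ℕ} {x : ℕ × ℕ} (hx : x ∈ grid N)
    (h1 : x.1 ≤ k) (h2 : k ≤ x.2) : F x ≤ dimAt N F k := by
  have := Finset.single_le_sum (f := fun x => if x.1 ≤ k ∧ k ≤ x.2 then F x else 0)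
    (fun _ _ => Nat.zero_le _) hx
  simpa [dimAt, h1, h2] using this

theorem exists_isKP_pairing_eq_zero (N : ℕ) (d : ℕ → ℕ) :
    ∃ F, IsKP N d F ∧ pairing N F F = 0 := by
  induction hs : ∑ k ∈ range (N + 1), d k using Nat.strong_induction_on generalizing d with
  | _ s ih =>
  by_cases h0 : ∀ k ≤ N, d k = 0
  · exact ⟨0, ⟨fun _ _ => rfl, fun k hk => by simp [dimAt, h0 k hk]⟩, by simp [pairing]⟩
  push Not at h0
  classical
  obtain ⟨hiN, hi⟩ := Nat.find_spec h0
  have hmin : ∀ k, k < Nat.find h0 → k ≤ N → d k = 0 := fun k hk hkN => by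
    by_contra h
    exact Nat.find_min h0 hk ⟨hkN, h⟩
  generalize Nat.find h0 = i at hiN hi hmin
  have hj0 : ∃ j, i ≤ j ∧ (j = N ∨ d (j + 1) = 0) := ⟨N, hiN, Or.inl rfl⟩
  obtain ⟨hij, hj⟩ := Nat.find_spec hj0
  have hjmin : ∀ k, i ≤ k → k < Nat.find hj0 → k ≠ N ∧ d (k + 1) ≠ 0 := fun k hk hlt => by
    have := Nat.find_min hj0 hlt
    tauto
  generalize Nat.find hj0 = j at hij hj hjmin
  have hjN : j ≤ N := by
    by_contra h
    exact (hjmin N hiN (by omega)).1 rfl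
  have hpos : ∀ k, i ≤ k → k ≤ j → 1 ≤ d k := by
    intro k hk hkj
    rcases Nat.eq_or_lt_of_le hk with rfl | hlt
    · omega
    · have := (hjmin (k - 1) (by omega) (by omega)).2
      rw [Nat.sub_add_cancel (by omega)] at this
      omega
  let e : ℕ → ℕ := fun k => if i ≤ k ∧ k ≤ j then d k - 1 else d k
  have hlt : ∑ k ∈ range (N + 1), e k < s := by
    rw [← hs]
    refine Finset.sum_lt_sum (fun k _ => ?_) ⟨i, by simp; omega, ?_⟩
    · simp only [e]; split_ifs <;> omega
    · simp only [e, le_refl, hij, and_self, if_true]; omega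
  obtain ⟨G, ⟨hG1, hG2⟩, hG3⟩ := ih _ hlt e rfl
  let D : ℕ × ℕ → ℕ := fun x => if x = (i, j) then 1 else 0
  have hmem : (i, j) ∈ grid N := mem_grid.2 ⟨hiN, hjN⟩
  refine ⟨D + G, ⟨fun x hx => ?_, fun k hk => ?_⟩, ?_⟩
  · have : x ≠ (i, j) := by rintro rfl; exact hx ⟨hij, hjN⟩
    simp [D, this, hG1 x hx]
  · rw [dimAt_add, hG2 k hk]
    have : dimAt N D k = if i ≤ k ∧ k ≤ j then 1 else 0 := by
      unfold dimAt
      rw [Finset.sum_eq_single (i, j)]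
      · simp [D]
      · intro x _ hx; simp [D, hx]
      · exact fun h => absurd hmem h
    rw [this]
    simp only [e]
    split_ifs with h
    · have := hpos k h.1 h.2; omega
    · omega
  · rw [pairing_add_add, hG3]
    have h1 : pairing N D D = 0 := by
      rw [pairing_eq_zero_iff]
      intro x _ y _ h1 _ _
      by_cases hx : x = (i, j)
      · have : y ≠ (i, j) := by rintro rfl; subst hx; simp at h1
        simp [D, this]
      · simp [D, hx]
    have h2 : pairing N D G = 0 := by
      rw [pairing_eq_zero_iff]
      intro x _ y hy h1 h2 h3
      by_cases hx : x = (i, j)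
      · subst hx
        simp only at h1 h2 h3
        have hyN := (mem_grid.1 hy).2
        have := le_dimAt G hy (k := j + 1) h2 h3
        rw [hG2 _ (by omega)] at this
        have hz : e (j + 1) = 0 := by
          rcases hj with rfl | hj
          · omega
          · simp [e, hj]
        simp [show G y = 0 by omega]
      · simp [D, hx]
    have h3 : pairing N G D = 0 := by
      rw [pairing_eq_zero_iff]
      intro x hx y _ h1 h2 h3
      by_cases hy : y = (i, j)
      · subst hy
        simp only at h1 h2 h3
        have := le_dimAt G hx (k := i - 1) (by omega) (by omega)
        rw [hG2 _ (by omega)] at this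
        have hz : e (i - 1) = 0 := by
          have := hmin (i - 1) (by omega) (by omega)
          simp [e, this]
        simp [show G x = 0 by omega]
      · simp [D, hy]
    omega

/-- The number of intervals starting before `i` and ending at `j` or later. -/
def coverCount (N : ℕ) (F : ℕ × ℕ → ℕ) (i j : ℕ) : ℕ :=
  ∑ x ∈ grid N, if x.1 < i ∧ j ≤ x.2 then F x else 0

theorem coverCount_rec {N : ℕ} (F : ℕ × ℕ → ℕ) {i j : ℕ} (hi : i ≤ N) (hj : j ≤ N) :
    coverCount N F (i + 1) j + coverCount N F i (j + 1) =
      F (i, j) + coverCount N F (i + 1) (j + 1) + coverCount N F i j := by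
  have : F (i, j) = ∑ x ∈ grid N, if x = (i, j) then F x else 0 := by
    rw [Finset.sum_ite_eq_of_mem' _ _ _ (mem_grid.2 ⟨hi, hj⟩)]
  rw [this]
  unfold coverCount
  simp only [← Finset.sum_add_distrib]
  refine Finset.sum_congr rfl fun x _ => ?_
  obtain ⟨a, b⟩ := x
  simp only [Prod.mk.injEq]
  split_ifs <;> omega

theorem coverCount_succ {N : ℕ} {d : ℕ → ℕ} {F : ℕ × ℕ → ℕ} (hF : IsKP N d F)
    (h0 : pairing N F F = 0) {i j : ℕ} (hij : i ≤ j) (hj : j + 1 ≤ N) :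
    coverCount N F (i + 1) (j + 1) = min (coverCount N F (i + 1) j) (d (j + 1)) := by
  have h1 : coverCount N F (i + 1) j = coverCount N F (i + 1) (j + 1) +
      ∑ x ∈ grid N, if x.1 ≤ i ∧ x.2 = j then F x else 0 := by
    unfold coverCount
    rw [← Finset.sum_add_distrib]
    refine Finset.sum_congr rfl fun x _ => ?_
    split_ifs <;> omega
  have h2 : d (j + 1) = coverCount N F (i + 1) (j + 1) +
      ∑ x ∈ grid N, if i < x.1 ∧ x.1 ≤ j + 1 ∧ j + 1 ≤ x.2 then F x else 0 := by
    rw [← hF.2 _ hj]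
    unfold coverCount dimAt
    rw [← Finset.sum_add_distrib]
    refine Finset.sum_congr rfl fun x _ => ?_
    split_ifs <;> omega
  have h3 : (∑ x ∈ grid N, if x.1 ≤ i ∧ x.2 = j then F x else 0) *
      (∑ x ∈ grid N, if i < x.1 ∧ x.1 ≤ j + 1 ∧ j + 1 ≤ x.2 then F x else 0) = 0 := by
    rw [Finset.sum_mul_sum]
    refine Finset.sum_eq_zero fun x hx => Finset.sum_eq_zero fun y hy => ?_
    rw [pairing_eq_zero_iff] at h0
    split_ifs with ha hb
    · exact h0 x hx y hy (by omega) (by omega) (by omega)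
    all_goals simp
  rcases Nat.mul_eq_zero.1 h3 with h | h <;> omega

theorem IsKP.eq_of_pairing_eq_zero {N : ℕ} {d : ℕ → ℕ} {F G : ℕ × ℕ → ℕ}
    (hF : IsKP N d F) (hG : IsKP N d G) (hF0 : pairing N F F = 0) (hG0 : pairing N G G = 0) :
    F = G := by
  have hdiag : ∀ H : ℕ × ℕ → ℕ, ∀ k, coverCount N H (k + 1) k = dimAt N H k := by
    intro H k
    simp [coverCount, dimAt]
  have hcov : ∀ i n, i + n ≤ N →
      coverCount N F (i + 1) (i + n) = coverCount N G (i + 1) (i + n) := by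
    intro i n
    induction n with
    | zero =>
      intro h
      simp only [Nat.add_zero] at h ⊢
      rw [hdiag, hdiag, hF.2 _ h, hG.2 _ h]
    | succ n ih =>
      intro h
      rw [← Nat.add_assoc] at h ⊢
      rw [coverCount_succ hF hF0 (by omega) h, coverCount_succ hG hG0 (by omega) h,
        ih (by omega)]
  have hend : ∀ H : ℕ × ℕ → ℕ, ∀ i, coverCount N H i (N + 1) = 0 := by
    intro H i
    refine Finset.sum_eq_zero fun x hx => ?_
    have := (mem_grid.1 hx).2
    exact if_neg (by omega)
  have hzero : ∀ H : ℕ × ℕ → ℕ, ∀ j, coverCount N H 0 j = 0 := by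
    intro H i
    simp [coverCount]
  have hall : ∀ i j, i ≤ j + 1 → j ≤ N + 1 → coverCount N F i j = coverCount N G i j := by
    intro i j hij hj
    rcases Nat.eq_zero_or_pos i with rfl | hi
    · rw [hzero, hzero]
    rcases Nat.eq_or_lt_of_le hj with rfl | hj
    · rw [hend, hend]
    have := hcov (i - 1) (j - (i - 1)) (by omega)
    rwa [Nat.sub_add_cancel hi, Nat.add_sub_cancel' (by omega)] at this
  funext ⟨i, j⟩
  by_cases h : i ≤ j ∧ j ≤ N
  · have h1 := coverCount_rec F (show i ≤ N by omega) h.2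
    have h2 := coverCount_rec G (show i ≤ N by omega) h.2
    rw [hall _ _ (by omega) (by omega), hall _ _ (by omega) (by omega)] at h1
    rw [hall (i + 1) (j + 1) (by omega) (by omega), hall i j (by omega) (by omega)] at h1
    omega
  · rw [hF.1 _ h, hG.1 _ h]

/-- The number of intervals of `F` starting at `c`. -/
def startCount (N : ℕ) (F : ℕ × ℕ → ℕ) (c : ℕ) : ℕ :=
  ∑ x ∈ grid N, if x.1 = c then F x else 0

/-- The number of intervals of `F` ending at `b`. -/
def endCount (N : ℕ) (F : ℕ × ℕ → ℕ) (b : ℕ) : ℕ :=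
  ∑ x ∈ grid N, if x.2 = b then F x else 0

/-- The number of intervals of `F` to which the vertex `k` can be appended. -/
def adjCount (N : ℕ) (F : ℕ × ℕ → ℕ) (k : ℕ) : ℕ :=
  startCount N F (k + 1) + if k = 0 then 0 else endCount N F (k - 1)

/-- All intervals of `F` contain `p`. -/
def IsThrough (p : ℕ) (F : ℕ × ℕ → ℕ) : Prop :=
  ∀ x, ¬(x.1 ≤ p ∧ p ≤ x.2) → F x = 0

theorem pairing_right {N p : ℕ} {F G : ℕ × ℕ → ℕ} (hF : IsThrough p F)
    (hG : dimAt N G p = 0) :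
    pairing N F G = ∑ b ∈ range N, endCount N F b * dimAt N G (b + 1) := by
  unfold endCount
  simp only [Finset.sum_mul]
  rw [Finset.sum_comm]
  unfold pairing
  refine Finset.sum_congr rfl fun x hx => ?_
  simp only [ite_mul, zero_mul, Finset.sum_ite_eq, mem_range]
  by_cases hxp : x.1 ≤ p ∧ p ≤ x.2
  swap
  · simp [hF x hxp]
  have hy0 : ∀ y ∈ grid N, y.1 ≤ p → p ≤ y.2 → G y = 0 := fun y hy h1 h2 =>
    Nat.le_zero.1 (hG ▸ le_dimAt G hy h1 h2)
  split_ifs with hxN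
  · rw [dimAt, Finset.mul_sum]
    refine Finset.sum_congr rfl fun y hy => ?_
    by_cases hyp : y.1 ≤ p ∧ p ≤ y.2
    · simp [hy0 y hy hyp.1 hyp.2]
    rw [mul_ite, mul_zero]
    exact if_congr (by omega) rfl rfl
  · refine Finset.sum_eq_zero fun y hy => if_neg ?_
    have := (mem_grid.1 hy).2
    omega

theorem pairing_left {N p : ℕ} {F G : ℕ × ℕ → ℕ} (hF : IsThrough p F)
    (hG : dimAt N G p = 0) :
    pairing N G F = ∑ b ∈ range N, startCount N F (b + 1) * dimAt N G b := by
  have hy0 : ∀ y ∈ grid N, y.1 ≤ p → p ≤ y.2 → G y = 0 := fun y hy h1 h2 =>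
    Nat.le_zero.1 (hG ▸ le_dimAt G hy h1 h2)
  unfold startCount
  simp only [Finset.sum_mul]
  rw [Finset.sum_comm]
  unfold pairing
  rw [Finset.sum_comm]
  refine Finset.sum_congr rfl fun x hx => ?_
  have hxN := mem_grid.1 hx
  by_cases hxp : x.1 ≤ p ∧ p ≤ x.2
  swap
  · simp [hF x hxp]
  rcases Nat.eq_zero_or_pos x.1 with h0 | h0
  · simp [h0]
  rw [Finset.sum_eq_single (x.1 - 1)]
  · rw [if_pos (by omega), dimAt, Finset.mul_sum]
    refine Finset.sum_congr rfl fun y hy => ?_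
    by_cases hyp : y.1 ≤ p ∧ p ≤ y.2
    · simp [hy0 y hy hyp.1 hyp.2]
    rw [mul_ite, mul_zero, mul_comm]
    exact if_congr (by omega) rfl rfl
  · intro b _ hb
    rw [if_neg (by omega), zero_mul]
  · intro h
    simp only [mem_range] at h
    omega

theorem startCount_eq_zero {N p c : ℕ} {F : ℕ × ℕ → ℕ} (hF : IsThrough p F) (h : p < c) :
    startCount N F c = 0 := by
  refine Finset.sum_eq_zero fun x _ => ?_
  split_ifs
  · exact hF x (by omega)
  · rfl

theorem endCount_eq_zero {N p b : ℕ} {F : ℕ × ℕ → ℕ} (hF : IsThrough p F) (h : b < p) :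
    endCount N F b = 0 := by
  refine Finset.sum_eq_zero fun x _ => ?_
  split_ifs
  · exact hF x (by omega)
  · rfl

theorem dimAt_eq_sum_endCount {N p k : ℕ} {F : ℕ × ℕ → ℕ} (hF : IsThrough p F) (h : p ≤ k) :
    dimAt N F k = ∑ b ∈ Icc k N, endCount N F b := by
  unfold dimAt endCount
  rw [Finset.sum_comm]
  refine Finset.sum_congr rfl fun x hx => ?_
  have hxN := mem_grid.1 hx
  rw [Finset.sum_ite_eq]
  by_cases hxp : x.1 ≤ p ∧ p ≤ x.2
  · refine if_congr ?_ rfl rfl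
    simp only [mem_Icc]
    omega
  · simp [hF x hxp]

theorem dimAt_eq_sum_startCount {N p k : ℕ} {F : ℕ × ℕ → ℕ} (hF : IsThrough p F) (h : k ≤ p) :
    dimAt N F k = ∑ c ∈ range (k + 1), startCount N F c := by
  unfold dimAt startCount
  rw [Finset.sum_comm]
  refine Finset.sum_congr rfl fun x hx => ?_
  rw [Finset.sum_ite_eq]
  by_cases hxp : x.1 ≤ p ∧ p ≤ x.2
  · refine if_congr ?_ rfl rfl
    simp only [mem_range]
    omega
  · simp [hF x hxp]

theorem sum_endCount {N p : ℕ} {F : ℕ × ℕ → ℕ} (hF : IsThrough p F) :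
    ∑ b ∈ range (N + 1), endCount N F b = dimAt N F p := by
  rw [dimAt_eq_sum_endCount hF le_rfl]
  refine (Finset.sum_subset (fun b => ?_) fun b hb hb' => ?_).symm
  · simp only [mem_Icc, mem_range]; omega
  · simp only [mem_Icc, mem_range] at hb hb'
    exact endCount_eq_zero hF (by omega)

theorem sum_startCount {N p : ℕ} {F : ℕ × ℕ → ℕ} (hp : p ≤ N) (hF : IsThrough p F) :
    ∑ c ∈ range (N + 1), startCount N F c = dimAt N F p := by
  rw [dimAt_eq_sum_startCount hF le_rfl]
  refine (Finset.sum_subset (fun b => ?_) fun b hb hb' => ?_).symm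
  · simp only [mem_range]; omega
  · simp only [mem_range] at hb hb'
    exact startCount_eq_zero hF (by omega)

theorem sum_adjCount_mul {N p : ℕ} {F : ℕ × ℕ → ℕ} (hp : p ≤ N) (hF : IsThrough p F)
    (w : ℕ → ℕ) :
    ∑ k ∈ range (N + 1), adjCount N F k * w k =
      ∑ b ∈ range N, endCount N F b * w (b + 1) +
        ∑ b ∈ range N, startCount N F (b + 1) * w b := by
  unfold adjCount
  simp only [add_mul, Finset.sum_add_distrib]
  rw [Finset.sum_range_succ, startCount_eq_zero hF (Nat.lt_succ_of_le hp),
    Finset.sum_range_succ' (fun k => (if k = 0 then 0 else endCount N F (k - 1)) * w k)]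
  simp [add_comm]

theorem adjCount_of_lt {N p k : ℕ} {F : ℕ × ℕ → ℕ} (hF : IsThrough p F) (h : k < p + 1) :
    adjCount N F k = startCount N F (k + 1) := by
  unfold adjCount
  split_ifs
  · rfl
  · rw [endCount_eq_zero hF (by omega), add_zero]

theorem adjCount_succ_of_le {N p k : ℕ} {F : ℕ × ℕ → ℕ} (hF : IsThrough p F) (h : p ≤ k + 1) :
    adjCount N F (k + 1) = endCount N F k := by
  simp [adjCount, startCount_eq_zero hF (show p < k + 1 + 1 by omega)]

theorem sum_adjCount {N p : ℕ} {F : ℕ × ℕ → ℕ} (hp : p ≤ N) (hF : IsThrough p F) :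
    ∑ k ∈ range (N + 1), adjCount N F k + (startCount N F 0 + endCount N F N) =
      2 * dimAt N F p := by
  have h := sum_adjCount_mul hp hF (fun _ => 1)
  have h1 := sum_startCount hp hF
  have h2 := sum_endCount (N := N) hF
  rw [Finset.sum_range_succ'] at h1
  rw [Finset.sum_range_succ] at h2
  simp only [mul_one] at h
  omega

theorem sum_adjCount_sq {N p : ℕ} {F : ℕ × ℕ → ℕ} (hp : p ≤ N) (hF : IsThrough p F) :
    ∑ k ∈ range (N + 1), adjCount N F k ^ 2 =
      ∑ b ∈ range N, endCount N F b ^ 2 + ∑ b ∈ range N, startCount N F (b + 1) ^ 2 := by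
  simp only [sq]
  rw [sum_adjCount_mul hp hF]
  congr 1
  · refine Finset.sum_congr rfl fun b _ => ?_
    by_cases h : p ≤ b
    · rw [adjCount_succ_of_le hF (by omega)]
    · simp [endCount_eq_zero hF (show b < p by omega)]
  · refine Finset.sum_congr rfl fun b _ => ?_
    by_cases h : b < p + 1
    · rw [adjCount_of_lt hF h]
    · simp [startCount_eq_zero hF (show p < b + 1 by omega)]

theorem two_mul_sum_Ioc (r : ℕ → ℕ) (N : ℕ) :
    2 * ∑ b ∈ range N, r b * ∑ c ∈ Ioc b N, r c + ∑ b ∈ range (N + 1), r b ^ 2 =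
      (∑ b ∈ range (N + 1), r b) ^ 2 := by
  induction N with
  | zero => simp
  | succ N ih =>
    have h : ∑ b ∈ range (N + 1), r b * ∑ c ∈ Ioc b (N + 1), r c =
        ∑ b ∈ range N, r b * ∑ c ∈ Ioc b N, r c + (∑ b ∈ range (N + 1), r b) * r (N + 1) := by
      rw [Finset.sum_mul, Finset.sum_range_succ, Finset.sum_range_succ (fun b => r b * r (N + 1)),
        ← add_assoc, ← Finset.sum_add_distrib]
      congr 1
      · refine Finset.sum_congr rfl fun b hb => ?_
        rw [Finset.sum_Ioc_succ_top (by simp at hb; omega), mul_add]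
      · simp
    rw [h, Finset.sum_range_succ _ (N + 1), Finset.sum_range_succ _ (N + 1)]
    linarith [ih]

theorem two_mul_sum_range {R : Type*} [CommSemiring R] (l : ℕ → R) (N : ℕ) :
    2 * ∑ b ∈ range N, l (b + 1) * ∑ c ∈ range (b + 1), l c + ∑ b ∈ range (N + 1), l b ^ 2 =
      (∑ b ∈ range (N + 1), l b) ^ 2 := by
  induction N with
  | zero => simp
  | succ N ih =>
    rw [Finset.sum_range_succ, Finset.sum_range_succ _ (N + 1),
      Finset.sum_range_succ (fun b => l b) (N + 1), add_sq, ← ih]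
    ring

theorem two_mul_sum_adjCount_mul_dimAt {N p : ℕ} {F : ℕ × ℕ → ℕ} (hp : p ≤ N)
    (hF : IsThrough p F) :
    2 * ∑ k ∈ range (N + 1), adjCount N F k * dimAt N F k +
        ∑ k ∈ range (N + 1), adjCount N F k ^ 2 +
        (startCount N F 0 ^ 2 + endCount N F N ^ 2) = 2 * dimAt N F p ^ 2 := by
  have h1 := two_mul_sum_Ioc (endCount N F) N
  have h2 := two_mul_sum_range (startCount N F) N
  rw [sum_endCount hF, Finset.sum_range_succ] at h1
  rw [sum_startCount hp hF, Finset.sum_range_succ'] at h2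
  have e1 : ∑ b ∈ range N, endCount N F b * ∑ c ∈ Ioc b N, endCount N F c =
      ∑ b ∈ range N, endCount N F b * dimAt N F (b + 1) := by
    refine Finset.sum_congr rfl fun b _ => ?_
    by_cases h : p ≤ b
    · rw [dimAt_eq_sum_endCount hF (by omega : p ≤ b + 1)]
      congr 2
      ext c
      simp only [mem_Ioc, mem_Icc]
      omega
    · simp [endCount_eq_zero hF (show b < p by omega)]
  have e2 : ∑ b ∈ range N, startCount N F (b + 1) * ∑ c ∈ range (b + 1), startCount N F c =
      ∑ b ∈ range N, startCount N F (b + 1) * dimAt N F b := by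
    refine Finset.sum_congr rfl fun b _ => ?_
    by_cases h : b ≤ p
    · rw [dimAt_eq_sum_startCount hF h]
    · simp [startCount_eq_zero hF (show p < b + 1 by omega)]
  rw [e1] at h1
  rw [e2] at h2
  rw [sum_adjCount_mul hp hF, sum_adjCount_sq hp hF]
  linarith

theorem two_mul_pairing_cross {N p : ℕ} {d : ℕ → ℕ} {F G : ℕ × ℕ → ℕ} (hp : p ≤ N)
    (hF : IsThrough p F) (hG : dimAt N G p = 0) (hd : ∀ k ≤ N, dimAt N (F + G) k = d k) :
    2 * (pairing N F G + pairing N G F) + 2 * d p ^ 2 =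
      ∑ k ∈ range (N + 1), (2 * (adjCount N F k * d k) + adjCount N F k ^ 2) +
        (startCount N F 0 ^ 2 + endCount N F N ^ 2) := by
  have h := two_mul_sum_adjCount_mul_dimAt hp hF
  have hdp := hd p hp
  rw [dimAt_add, hG, add_zero] at hdp
  have e : ∑ k ∈ range (N + 1), adjCount N F k * d k =
      ∑ k ∈ range (N + 1), adjCount N F k * dimAt N F k +
        ∑ k ∈ range (N + 1), adjCount N F k * dimAt N G k := by
    rw [← Finset.sum_add_distrib]
    refine Finset.sum_congr rfl fun k hk => ?_
    rw [← mul_add, ← dimAt_add, hd k (by simpa [Nat.lt_succ_iff] using hk)]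
  rw [pairing_right hF hG, pairing_left hF hG, ← sum_adjCount_mul hp hF,
    Finset.sum_add_distrib, ← Finset.mul_sum, e, ← hdp]
  linarith

/-- The part of `F` supported on the intervals containing `p`. -/
def throughPart (p : ℕ) (F : ℕ × ℕ → ℕ) : ℕ × ℕ → ℕ :=
  fun x => if x.1 ≤ p ∧ p ≤ x.2 then F x else 0

/-- The part of `F` supported on the intervals not containing `p`. -/
def awayPart (p : ℕ) (F : ℕ × ℕ → ℕ) : ℕ × ℕ → ℕ :=
  fun x => if x.1 ≤ p ∧ p ≤ x.2 then 0 else F x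

theorem throughPart_add_awayPart (p : ℕ) (F : ℕ × ℕ → ℕ) :
    throughPart p F + awayPart p F = F := by
  funext x
  simp only [throughPart, awayPart, Pi.add_apply]
  split_ifs <;> simp

theorem isThrough_throughPart (p : ℕ) (F : ℕ × ℕ → ℕ) : IsThrough p (throughPart p F) :=
  fun _ hx => if_neg hx

theorem dimAt_awayPart (N p : ℕ) (F : ℕ × ℕ → ℕ) : dimAt N (awayPart p F) p = 0 := by
  refine Finset.sum_eq_zero fun x _ => ?_
  simp only [awayPart]
  split_ifs <;> rfl

theorem dimAt_eq_endpoints {N p : ℕ} {F : ℕ × ℕ → ℕ} (hF : IsThrough p F) (h0 : F (0, N) = 0) :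
    dimAt N F p = (startCount N F 0 + endCount N F N) +
      ∑ x ∈ grid N, if x.1 ≠ 0 ∧ x.2 ≠ N then F x else 0 := by
  unfold dimAt startCount endCount
  simp only [← Finset.sum_add_distrib]
  refine Finset.sum_congr rfl fun x _ => ?_
  by_cases hxp : x.1 ≤ p ∧ p ≤ x.2
  swap
  · simp [hF x hxp]
  by_cases hx : x = (0, N)
  · simp [hx, h0]
  have : ¬(x.1 = 0 ∧ x.2 = N) := fun h => hx (Prod.ext h.1 h.2)
  split_ifs <;> omega

theorem startCount_mul_endCount_le {N p : ℕ} {F : ℕ × ℕ → ℕ} (hF : IsThrough p F)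
    (h0 : F (0, N) = 0) : startCount N F 0 * endCount N F N ≤ pairing N F F := by
  unfold startCount endCount pairing
  rw [Finset.sum_mul_sum]
  refine Finset.sum_le_sum fun x hx => Finset.sum_le_sum fun y hy => ?_
  have hxN := mem_grid.1 hx
  by_cases hxp : x.1 ≤ p ∧ p ≤ x.2
  swap
  · simp [hF x hxp]
  by_cases hyp : y.1 ≤ p ∧ p ≤ y.2
  swap
  · simp [hF y hyp]
  by_cases hx0 : x = (0, N)
  · simp [hx0, h0]
  by_cases hy0 : y = (0, N)
  · simp [hy0, h0]
  have h1 : ¬(x.1 = 0 ∧ x.2 = N) := fun h => hx0 (Prod.ext h.1 h.2)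
  have h2 : ¬(y.1 = 0 ∧ y.2 = N) := fun h => hy0 (Prod.ext h.1 h.2)
  split_ifs <;> omega

theorem pairing_self_of_endpoints {N p : ℕ} {F : ℕ × ℕ → ℕ} (hF : IsThrough p F)
    (h0 : F (0, N) = 0) (hz : ∀ x ∈ grid N, x.1 ≠ 0 → x.2 ≠ N → F x = 0) :
    pairing N F F = startCount N F 0 * endCount N F N := by
  refine le_antisymm ?_ (startCount_mul_endCount_le hF h0)
  unfold startCount endCount pairing
  rw [Finset.sum_mul_sum]
  refine Finset.sum_le_sum fun x hx => Finset.sum_le_sum fun y hy => ?_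
  have hyN := mem_grid.1 hy
  have hx' := hz x hx
  have hy' := hz y hy
  split_ifs with h h1 h2 h2
  · exact le_rfl
  · rw [hy' (by omega) h2]
  · rw [hx' h1 (by omega), zero_mul]
  · rw [hx' h1 (by omega), zero_mul, zero_mul]
  all_goals simp

/-- `A` is the set of containers reached when an amount `d p` of water is poured into containers
prefilled to the heights `d k`, `k ≠ p`, and `q` is the integral part of the final level. -/
structure IsFilling (N : ℕ) (d : ℕ → ℕ) (p : ℕ) (A : Finset ℕ) (q : ℕ) : Prop where
  p_le : p ≤ N
  le_N : ∀ k ∈ A, k ≤ N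
  p_notMem : p ∉ A
  min_le : ∀ k ≤ N, d p ≤ d k
  le_level : ∀ k ∈ A, d k ≤ q
  level_lt : ∀ k ≤ N, k ≠ p → k ∉ A → q < d k
  min_le_level : d p ≤ q

/-- Twice the minimal codimension. -/
def fillingCost (d : ℕ → ℕ) (p : ℕ) (A : Finset ℕ) (q : ℕ) : ℤ :=
  (2 * q + 1) * d p - d p ^ 2 - ∑ k ∈ A, ((d k : ℤ) - q) * (d k - q - 1)

theorem adjCount_self {N p : ℕ} {F : ℕ × ℕ → ℕ} (hF : IsThrough p F) :
    adjCount N F p = 0 := by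
  rw [adjCount_of_lt hF (Nat.lt_succ_self p), startCount_eq_zero hF (Nat.lt_succ_self p)]

theorem IsFilling.two_mul_pairing_eq {N : ℕ} {d : ℕ → ℕ} {p : ℕ} {A : Finset ℕ} {q : ℕ}
    (h : IsFilling N d p A q) {F G : ℕ × ℕ → ℕ} (hF : IsThrough p F)
    (hG : dimAt N G p = 0) (hd : ∀ k ≤ N, dimAt N (F + G) k = d k) :
    (2 * pairing N (F + G) (F + G) : ℤ) = fillingCost d p A q +
      ((d p : ℤ) - (startCount N F 0 + endCount N F N)) *
        (2 * q + 1 - d p - (startCount N F 0 + endCount N F N)) +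
      ∑ k ∈ A, ((d k : ℤ) + adjCount N F k - q) * (d k + adjCount N F k - q - 1) +
      ∑ k ∈ range (N + 1) \ A, (adjCount N F k : ℤ) * (2 * d k + adjCount N F k - 2 * q - 1) +
      2 * (pairing N F F - startCount N F 0 * endCount N F N) + 2 * pairing N G G := by
  have h1 := two_mul_pairing_cross h.p_le hF hG hd
  have h2 := sum_adjCount h.p_le hF
  have hdp := hd p h.p_le
  rw [dimAt_add, hG, add_zero] at hdp
  rw [hdp] at h2
  zify at h1 h2
  have hA : A ⊆ range (N + 1) := fun k hk => by
    have := h.le_N k hk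
    simp only [mem_range]; omega
  have key : ∑ k ∈ range (N + 1), (2 * ((adjCount N F k : ℤ) * d k) + (adjCount N F k : ℤ) ^ 2) =
      (2 * q + 1) * ∑ k ∈ range (N + 1), (adjCount N F k : ℤ) +
      ∑ k ∈ A, ((d k : ℤ) + adjCount N F k - q) * (d k + adjCount N F k - q - 1) +
      ∑ k ∈ range (N + 1) \ A, (adjCount N F k : ℤ) * (2 * d k + adjCount N F k - 2 * q - 1) -
      ∑ k ∈ A, ((d k : ℤ) - q) * (d k - q - 1) := by
    rw [← Finset.sum_sdiff hA, ← Finset.sum_sdiff hA, mul_add, Finset.mul_sum, Finset.mul_sum]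
    have e1 : ∑ k ∈ A, (2 * ((adjCount N F k : ℤ) * d k) + (adjCount N F k : ℤ) ^ 2) =
        ∑ k ∈ A, (2 * q + 1) * (adjCount N F k : ℤ) +
        ∑ k ∈ A, ((d k : ℤ) + adjCount N F k - q) * (d k + adjCount N F k - q - 1) -
        ∑ k ∈ A, ((d k : ℤ) - q) * (d k - q - 1) := by
      rw [← Finset.sum_add_distrib, ← Finset.sum_sub_distrib]
      exact Finset.sum_congr rfl fun k _ => by ring
    have e2 : ∑ k ∈ range (N + 1) \ A, (2 * ((adjCount N F k : ℤ) * d k) +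
          (adjCount N F k : ℤ) ^ 2) =
        ∑ k ∈ range (N + 1) \ A, (2 * q + 1) * (adjCount N F k : ℤ) +
        ∑ k ∈ range (N + 1) \ A,
          (adjCount N F k : ℤ) * (2 * d k + adjCount N F k - 2 * q - 1) := by
      rw [← Finset.sum_add_distrib]
      exact Finset.sum_congr rfl fun k _ => by ring
    rw [e1, e2]
    ring
  rw [key, show ∑ k ∈ range (N + 1), (adjCount N F k : ℤ) =
    2 * d p - (startCount N F 0 + endCount N F N) by linarith] at h1
  rw [pairing_add_add, fillingCost]
  push_cast
  linarith

theorem mul_sub_one_nonneg (n : ℤ) : 0 ≤ n * (n - 1) := by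
  rcases le_or_gt n 0 with h | h <;> nlinarith

theorem IsFilling.slack_nonneg {N : ℕ} {d : ℕ → ℕ} {p : ℕ} {A : Finset ℕ} {q : ℕ}
    (h : IsFilling N d p A q) {F : ℕ × ℕ → ℕ} (hF : IsThrough p F) {k : ℕ}
    (hk : k ∈ range (N + 1) \ A) :
    0 ≤ (adjCount N F k : ℤ) * (2 * d k + adjCount N F k - 2 * q - 1) := by
  simp only [mem_sdiff, mem_range] at hk
  rcases eq_or_ne k p with rfl | hkp
  · simp [adjCount_self hF]
  · have := h.level_lt k (by omega) hkp hk.2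
    exact mul_nonneg (by positivity) (by omega)

theorem IsFilling.cost_le_and_iff {N : ℕ} {d : ℕ → ℕ} {p : ℕ} {A : Finset ℕ} {q : ℕ}
    (h : IsFilling N d p A q) {F G : ℕ × ℕ → ℕ} (hF : IsThrough p F) (h0 : F (0, N) = 0)
    (hG : dimAt N G p = 0) (hd : ∀ k ≤ N, dimAt N (F + G) k = d k) :
    fillingCost d p A q ≤ 2 * pairing N (F + G) (F + G) ∧
    ((2 * pairing N (F + G) (F + G) : ℤ) = fillingCost d p A q ↔
      (∀ x ∈ grid N, x.1 ≠ 0 → x.2 ≠ N → F x = 0) ∧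
      (∀ k ∈ A, d k + adjCount N F k = q ∨ d k + adjCount N F k = q + 1) ∧
      (∀ k ≤ N, k ∉ A → adjCount N F k = 0) ∧ pairing N G G = 0) := by
  have hsplit := dimAt_eq_endpoints hF h0
  have hdp := hd p h.p_le
  rw [dimAt_add, hG, add_zero] at hdp
  rw [hdp] at hsplit
  have hq := h.min_le_level
  have n1 : 0 ≤ ((d p : ℤ) - (startCount N F 0 + endCount N F N)) *
      (2 * q + 1 - d p - (startCount N F 0 + endCount N F N)) :=
    mul_nonneg (by omega) (by omega)
  have n2' : ∀ k ∈ A, 0 ≤ ((d k : ℤ) + adjCount N F k - q) * (d k + adjCount N F k - q - 1) :=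
    fun k _ => mul_sub_one_nonneg _
  have n2 := Finset.sum_nonneg n2'
  have n3 := Finset.sum_nonneg fun k hk => h.slack_nonneg hF hk
  have n4 : (0 : ℤ) ≤ pairing N F F - startCount N F 0 * endCount N F N := by
    have := startCount_mul_endCount_le hF h0
    zify at this
    linarith
  have heq := h.two_mul_pairing_eq hF hG hd
  refine ⟨by linarith, fun hc => ?_, fun ⟨hz, hA, hU, hG0⟩ => ?_⟩
  · refine ⟨?_, fun k hk => ?_, fun k hk hkA => ?_, ?_⟩
    · have e1 := le_antisymm (by linarith) n1
      have : (d p : ℤ) - (startCount N F 0 + endCount N F N) = 0 :=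
        (mul_eq_zero.1 e1).resolve_right (by omega)
      have hz : (∑ x ∈ grid N, if x.1 ≠ 0 ∧ x.2 ≠ N then F x else 0) = 0 := by omega
      rw [Finset.sum_eq_zero_iff] at hz
      intro x hx h1 h2
      simpa [h1, h2] using hz x hx
    · have e2 := (Finset.sum_eq_zero_iff_of_nonneg n2').1 (le_antisymm (by linarith) n2) k hk
      rcases mul_eq_zero.1 e2 with e | e <;> omega
    · have hkU : k ∈ range (N + 1) \ A := by
        simp only [mem_sdiff, mem_range]; exact ⟨by omega, hkA⟩
      have e3 := (Finset.sum_eq_zero_iff_of_nonneg fun k hk => h.slack_nonneg hF hk).1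
        (le_antisymm (by linarith) n3) k hkU
      rcases eq_or_ne k p with rfl | hkp
      · exact adjCount_self hF
      · have := h.level_lt k hk hkp hkA
        rcases mul_eq_zero.1 e3 with e | e <;> omega
    · have : (pairing N G G : ℤ) = 0 := le_antisymm (by linarith) (by positivity)
      exact_mod_cast this
  · have e1 : (∑ x ∈ grid N, if x.1 ≠ 0 ∧ x.2 ≠ N then F x else 0) = 0 := by
      refine Finset.sum_eq_zero fun x hx => ?_
      split_ifs with hx'
      · exact hz x hx hx'.1 hx'.2
      · rfl
    rw [e1, add_zero] at hsplit
    have e2 : ∑ k ∈ A, ((d k : ℤ) + adjCount N F k - q) * (d k + adjCount N F k - q - 1) = 0 := by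
      refine Finset.sum_eq_zero fun k hk => mul_eq_zero.2 ?_
      rcases hA k hk with e | e
      · left; omega
      · right; omega
    have e3 : ∑ k ∈ range (N + 1) \ A,
        (adjCount N F k : ℤ) * (2 * d k + adjCount N F k - 2 * q - 1) = 0 := by
      refine Finset.sum_eq_zero fun k hk => ?_
      simp only [mem_sdiff, mem_range] at hk
      rw [hU k (by omega) hk.2]
      simp
    rw [heq, e2, e3, pairing_self_of_endpoints hF h0 hz, hG0, hsplit]
    push_cast
    ring

/-- The multiplicities of intervals through `p` with exactly one endpoint in `{0, N}` whose
adjacency counts are given by `t`. -/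
def ofAdj (N p : ℕ) (t : ℕ → ℕ) : ℕ × ℕ → ℕ := fun x =>
  if x.1 = 0 ∧ p ≤ x.2 ∧ x.2 < N then t (x.2 + 1)
  else if x.2 = N ∧ 1 ≤ x.1 ∧ x.1 ≤ p then t (x.1 - 1) else 0

theorem isThrough_ofAdj {N p : ℕ} (hp : p ≤ N) (t : ℕ → ℕ) : IsThrough p (ofAdj N p t) := by
  intro x hx
  unfold ofAdj
  rw [if_neg (by omega), if_neg (by omega)]

theorem ofAdj_zero_N (N p : ℕ) (t : ℕ → ℕ) : ofAdj N p t (0, N) = 0 := by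
  simp [ofAdj]

theorem ofAdj_of_ne {N p : ℕ} (t : ℕ → ℕ) {x : ℕ × ℕ} (h1 : x.1 ≠ 0) (h2 : x.2 ≠ N) :
    ofAdj N p t x = 0 := by
  simp [ofAdj, h1, h2]

theorem adjCount_ofAdj {N p : ℕ} (hp : p ≤ N) {t : ℕ → ℕ} (htp : t p = 0) {k : ℕ}
    (hk : k ≤ N) : adjCount N (ofAdj N p t) k = t k := by
  have hthr := isThrough_ofAdj hp t
  rcases lt_trichotomy k p with h | rfl | h
  · rw [adjCount_of_lt hthr (by omega), startCount, Finset.sum_eq_single (k + 1, N)]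
    · simp [ofAdj, Nat.succ_le_of_lt h]
    · intro x _ hx
      have : ¬(x.1 = k + 1 ∧ x.2 = N) := fun h => hx (Prod.ext h.1 h.2)
      split_ifs with h1
      · exact ofAdj_of_ne t (by omega) (by omega)
      · rfl
    · exact fun h' => absurd (mem_grid.2 ⟨by simp only; omega, le_rfl⟩) h'
  · rw [adjCount_self hthr, htp]
  · obtain ⟨k, rfl⟩ := Nat.exists_eq_add_of_le' (show 1 ≤ k by omega)
    rw [adjCount_succ_of_le hthr (by omega), endCount, Finset.sum_eq_single (0, k)]
    · simp [ofAdj, Nat.le_of_lt_succ h, Nat.lt_of_succ_le hk]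
    · intro x _ hx
      have : ¬(x.1 = 0 ∧ x.2 = k) := fun h => hx (Prod.ext h.1 h.2)
      split_ifs with h1
      · exact ofAdj_of_ne t (by omega) (by omega)
      · rfl
    · exact fun h' => absurd (mem_grid.2 ⟨by simp only; omega, by simp only; omega⟩) h'

theorem ofAdj_congr {N p : ℕ} (hp : p ≤ N) {t u : ℕ → ℕ} (h : ∀ k ≤ N, t k = u k) :
    ofAdj N p t = ofAdj N p u := by
  funext x
  unfold ofAdj
  split_ifs
  · exact h _ (by omega)
  · exact h _ (by omega)
  · rfl

theorem eq_ofAdj_adjCount {N p : ℕ} {F : ℕ × ℕ → ℕ} (hp : p ≤ N) (hF : IsThrough p F)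
    (hN : ∀ x, N < x.2 → F x = 0) (h0 : F (0, N) = 0)
    (hz : ∀ x ∈ grid N, x.1 ≠ 0 → x.2 ≠ N → F x = 0) : F = ofAdj N p (adjCount N F) := by
  funext ⟨i, j⟩
  unfold ofAdj
  simp only
  split_ifs with h1 h2
  · obtain ⟨rfl, h1, h2⟩ := h1
    rw [adjCount_succ_of_le hF (by omega), endCount, Finset.sum_eq_single (0, j)]
    · simp
    · intro x hx hne
      have : ¬(x.1 = 0 ∧ x.2 = j) := fun h => hne (Prod.ext h.1 h.2)
      split_ifs with h3
      · exact hz x hx (by omega) (by omega)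
      · rfl
    · exact fun h' => absurd (mem_grid.2 ⟨by simp only; omega, by simp only; omega⟩) h'
  · obtain ⟨rfl, h2, h3⟩ := h2
    rw [adjCount_of_lt hF (by omega), Nat.sub_add_cancel h2, startCount,
      Finset.sum_eq_single (i, j)]
    · simp
    · intro x hx hne
      have : ¬(x.1 = i ∧ x.2 = j) := fun h => hne (Prod.ext h.1 h.2)
      split_ifs with h4
      · exact hz x hx (by omega) (by omega)
      · rfl
    · exact fun h' => absurd (mem_grid.2 ⟨by simp only; omega, le_rfl⟩) h'
  · by_cases hp' : i ≤ p ∧ p ≤ j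
    swap
    · exact hF _ hp'
    rcases lt_trichotomy j N with hj | rfl | hj
    · exact hz _ (mem_grid.2 ⟨by simp only; omega, hj.le⟩) (by simp only; omega)
        (by simp only; omega)
    · obtain rfl : i = 0 := by omega
      exact h0
    · exact hN _ hj

theorem dimAt_le_of_isThrough {N p k : ℕ} {F : ℕ × ℕ → ℕ} (hF : IsThrough p F) :
    dimAt N F k ≤ dimAt N F p := by
  refine Finset.sum_le_sum fun x _ => ?_
  by_cases hxp : x.1 ≤ p ∧ p ≤ x.2
  · split_ifs <;> simp
  · simp [hF x hxp]

theorem dimAt_ofAdj {N p : ℕ} (hp : p ≤ N) {t : ℕ → ℕ} (htp : t p = 0) :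
    dimAt N (ofAdj N p t) p = ∑ k ∈ range (N + 1), t k := by
  have h1 := sum_adjCount hp (isThrough_ofAdj hp t)
  have h2 := dimAt_eq_endpoints (isThrough_ofAdj hp t) (ofAdj_zero_N N p t)
  have h3 : (∑ x ∈ grid N, if x.1 ≠ 0 ∧ x.2 ≠ N then ofAdj N p t x else 0) = 0 := by
    refine Finset.sum_eq_zero fun x _ => ?_
    split_ifs with h
    · exact ofAdj_of_ne t h.1 h.2
    · rfl
  have h4 : ∑ k ∈ range (N + 1), adjCount N (ofAdj N p t) k = ∑ k ∈ range (N + 1), t k :=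
    Finset.sum_congr rfl fun k hk =>
      adjCount_ofAdj hp htp (Nat.lt_succ_iff.1 (mem_range.1 hk))
  omega

/-- The Kostant partition of `d` of codimension zero. -/
noncomputable def openKP (N : ℕ) (d : ℕ → ℕ) : ℕ × ℕ → ℕ :=
  (exists_isKP_pairing_eq_zero N d).choose

theorem isKP_openKP (N : ℕ) (d : ℕ → ℕ) : IsKP N d (openKP N d) :=
  (exists_isKP_pairing_eq_zero N d).choose_spec.1

theorem pairing_openKP (N : ℕ) (d : ℕ → ℕ) : pairing N (openKP N d) (openKP N d) = 0 :=
  (exists_isKP_pairing_eq_zero N d).choose_spec.2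

/-- The amounts of water poured into the containers when those in `B ⊆ A` end at height `q + 1`
and the others in `A` at height `q`. -/
def fillingAmount (d : ℕ → ℕ) (A : Finset ℕ) (q : ℕ) (B : Finset ℕ) (k : ℕ) : ℕ :=
  if k ∈ A then (q - d k) + (if k ∈ B then 1 else 0) else 0

/-- The Kostant partition attached to a choice of `B ⊆ A`. -/
noncomputable def fillingKP (N : ℕ) (d : ℕ → ℕ) (p : ℕ) (A : Finset ℕ) (q : ℕ)
    (B : Finset ℕ) : ℕ × ℕ → ℕ :=
  ofAdj N p (fillingAmount d A q B) +
    openKP N fun k => d k - dimAt N (ofAdj N p (fillingAmount d A q B)) k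

section Filling

variable {N : ℕ} {d : ℕ → ℕ} {p : ℕ} {A : Finset ℕ} {q : ℕ}

theorem IsFilling.fillingAmount_self (h : IsFilling N d p A q) (B : Finset ℕ) :
    fillingAmount d A q B p = 0 := if_neg h.p_notMem

theorem IsFilling.subset_range (h : IsFilling N d p A q) : A ⊆ range (N + 1) := fun k hk =>
  mem_range.2 (Nat.lt_succ_of_le (h.le_N k hk))

theorem IsFilling.sum_fillingAmount (h : IsFilling N d p A q) {B : Finset ℕ} (hB : B ⊆ A) :
    ∑ k ∈ range (N + 1), fillingAmount d A q B k + ∑ k ∈ A, d k = #A * q + #B := by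
  rw [← Finset.sum_subset h.subset_range (f := fillingAmount d A q B) fun k _ hk => if_neg hk, ← Finset.sum_add_distrib]
  have : #B = ∑ k ∈ A, if k ∈ B then 1 else 0 := by
    rw [← Finset.card_filter, Finset.filter_mem_eq_inter, Finset.inter_eq_right.2 hB]
  rw [this, ← smul_eq_mul, ← Finset.sum_const, ← Finset.sum_add_distrib]
  refine Finset.sum_congr rfl fun k hk => ?_
  have := h.le_level k hk
  simp only [fillingAmount, hk, if_true]
  omega

theorem IsFilling.dimAt_ofAdj_fillingAmount (h : IsFilling N d p A q) {s : ℕ}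
    (hs : ∑ k ∈ A, d k + d p = #A * q + s) {B : Finset ℕ} (hB : B ∈ powersetCard s A) :
    dimAt N (ofAdj N p (fillingAmount d A q B)) p = d p := by
  obtain ⟨hBA, rfl⟩ := mem_powersetCard.1 hB
  rw [dimAt_ofAdj h.p_le (h.fillingAmount_self B)]
  have := h.sum_fillingAmount hBA
  omega

theorem throughPart_add_of_isThrough {F G : ℕ × ℕ → ℕ} (hF : IsThrough p F) (hG : dimAt N G p = 0)
    (hsupp : ∀ x, ¬(x.1 ≤ x.2 ∧ x.2 ≤ N) → G x = 0) : throughPart p (F + G) = F := by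
  funext x
  simp only [throughPart, Pi.add_apply]
  split_ifs with hx
  · by_cases hxN : x.1 ≤ x.2 ∧ x.2 ≤ N
    · have := le_dimAt G (mem_grid.2 ⟨by omega, hxN.2⟩) hx.1 hx.2
      omega
    · simp [hsupp x hxN]
  · exact (hF x hx).symm

theorem IsFilling.fillingKP_spec (h : IsFilling N d p A q) {s : ℕ}
    (hs : ∑ k ∈ A, d k + d p = #A * q + s) {B : Finset ℕ} (hB : B ∈ powersetCard s A) :
    IsKP N d (fillingKP N d p A q B) ∧ fillingKP N d p A q B (0, N) = 0 ∧
      (2 * pairing N (fillingKP N d p A q B) (fillingKP N d p A q B) : ℤ) =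
        fillingCost d p A q ∧
      throughPart p (fillingKP N d p A q B) = ofAdj N p (fillingAmount d A q B) := by
  have hthr := isThrough_ofAdj h.p_le (fillingAmount d A q B)
  have hdim := h.dimAt_ofAdj_fillingAmount hs hB
  have hG := isKP_openKP N fun k => d k - dimAt N (ofAdj N p (fillingAmount d A q B)) k
  have hGp : dimAt N (openKP N fun k =>
      d k - dimAt N (ofAdj N p (fillingAmount d A q B)) k) p = 0 := by
    simp only [hG.2 p h.p_le, hdim, Nat.sub_self]
  have hd : ∀ k ≤ N, dimAt N (fillingKP N d p A q B) k = d k := by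
    intro k hk
    have h1 := dimAt_le_of_isThrough (N := N) (k := k) hthr
    have h2 := h.min_le k hk
    simp only [fillingKP, dimAt_add, hG.2 k hk]
    omega
  have hadj : ∀ k ≤ N, adjCount N (ofAdj N p (fillingAmount d A q B)) k =
      fillingAmount d A q B k := fun k hk =>
    adjCount_ofAdj h.p_le (h.fillingAmount_self B) hk
  refine ⟨⟨fun x hx => ?_, hd⟩, ?_, ?_, throughPart_add_of_isThrough hthr hGp hG.1⟩
  · rw [fillingKP, Pi.add_apply, hG.1 x hx, add_zero, ofAdj]
    have := h.p_le
    rw [if_neg (by omega), if_neg (by omega)]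
  · have hle := le_dimAt (openKP N fun k =>
      d k - dimAt N (ofAdj N p (fillingAmount d A q B)) k)
      (mem_grid.2 ⟨Nat.zero_le N, le_rfl⟩ : (0, N) ∈ grid N) (Nat.zero_le p) h.p_le
    rw [fillingKP, Pi.add_apply, ofAdj_zero_N]
    omega
  · refine (h.cost_le_and_iff hthr (ofAdj_zero_N N p _) hGp hd).2.2
      ⟨fun x _ h1 h2 => ofAdj_of_ne _ h1 h2, fun k hk => ?_, fun k hk hkA => ?_,
        pairing_openKP _ _⟩
    · rw [hadj k (h.le_N k hk)]
      have := h.le_level k hk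
      simp only [fillingAmount, hk, if_true]
      split_ifs <;> omega
    · rw [hadj k hk]
      exact if_neg hkA

theorem IsFilling.fillingKP_injOn (h : IsFilling N d p A q) {s : ℕ}
    (hs : ∑ k ∈ A, d k + d p = #A * q + s) :
    Set.InjOn (fillingKP N d p A q) (powersetCard s A : Set (Finset ℕ)) := by
  intro B hB C hC hBC
  have h1 := (h.fillingKP_spec hs hB).2.2.2
  rw [hBC, (h.fillingKP_spec hs hC).2.2.2] at h1
  have hBA := (mem_powersetCard.1 hB).1
  have hCA := (mem_powersetCard.1 hC).1
  have key : ∀ k ∈ A, (k ∈ B ↔ k ∈ C) := by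
    intro k hk
    have h2 := adjCount_ofAdj h.p_le (h.fillingAmount_self C) (h.le_N k hk)
    rw [h1, adjCount_ofAdj h.p_le (h.fillingAmount_self B) (h.le_N k hk)] at h2
    simp only [fillingAmount, hk, if_true] at h2
    split_ifs at h2 <;> first | tauto | omega
  ext k
  exact ⟨fun hk => (key k (hBA hk)).1 hk, fun hk => (key k (hCA hk)).2 hk⟩

theorem IsFilling.throughPart_cost_le_and_iff (h : IsFilling N d p A q) {F : ℕ × ℕ → ℕ}
    (hF : IsKP N d F) (h0 : F (0, N) = 0) :
    fillingCost d p A q ≤ 2 * pairing N F F ∧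
    ((2 * pairing N F F : ℤ) = fillingCost d p A q ↔
      (∀ x ∈ grid N, x.1 ≠ 0 → x.2 ≠ N → throughPart p F x = 0) ∧
      (∀ k ∈ A, d k + adjCount N (throughPart p F) k = q ∨
        d k + adjCount N (throughPart p F) k = q + 1) ∧
      (∀ k ≤ N, k ∉ A → adjCount N (throughPart p F) k = 0) ∧
      pairing N (awayPart p F) (awayPart p F) = 0) := by
  have := h.cost_le_and_iff (isThrough_throughPart p F) (G := awayPart p F)
    (by simp [throughPart, h0]) (dimAt_awayPart N p F)
    (by rw [throughPart_add_awayPart]; exact hF.2)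
  rwa [throughPart_add_awayPart] at this

theorem IsFilling.exists_fillingKP_eq (h : IsFilling N d p A q) {s : ℕ}
    (hs : ∑ k ∈ A, d k + d p = #A * q + s) {F : ℕ × ℕ → ℕ} (hF : IsKP N d F)
    (h0 : F (0, N) = 0) (hcost : (2 * pairing N F F : ℤ) = fillingCost d p A q) :
    ∃ B ∈ powersetCard s A, fillingKP N d p A q B = F := by
  obtain ⟨hz, hA, hU, hG0⟩ := (h.throughPart_cost_le_and_iff hF h0).2.1 hcost
  have hthr := isThrough_throughPart p F
  have hsum := throughPart_add_awayPart p F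
  have hGp := dimAt_awayPart N p F
  have hGsupp : ∀ x, ¬(x.1 ≤ x.2 ∧ x.2 ≤ N) → awayPart p F x = 0 := by
    intro x hx
    simp [awayPart, hF.1 x hx]
  have hTN : ∀ x : ℕ × ℕ, N < x.2 → throughPart p F x = 0 := by
    intro x hx
    simp [throughPart, hF.1 x (by omega)]
  have hT0 : throughPart p F (0, N) = 0 := by simp [throughPart, h0]
  have hTof := eq_ofAdj_adjCount h.p_le hthr hTN hT0 hz
  set B := A.filter fun k => d k + adjCount N (throughPart p F) k = q + 1 with hBdef
  have hBA : B ⊆ A := Finset.filter_subset _ _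
  have hadj : ∀ k ≤ N, adjCount N (throughPart p F) k = fillingAmount d A q B k := by
    intro k hk
    unfold fillingAmount
    by_cases hkA : k ∈ A
    · have h1 := hA k hkA
      have h2 := h.le_level k hkA
      have h3 : k ∈ B ↔ d k + adjCount N (throughPart p F) k = q + 1 := by
        simp [hBdef, hkA]
      rw [if_pos hkA]
      split_ifs with hkB
      · have := h3.1 hkB; omega
      · have := mt h3.2 hkB; omega
    · rw [hU k hk hkA, if_neg hkA]
  rw [ofAdj_congr h.p_le hadj] at hTof
  have hdp : dimAt N (throughPart p F) p = d p := by
    rw [← hF.2 p h.p_le]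
    nth_rw 2 [← hsum]
    rw [dimAt_add, hGp, add_zero]
  have hB : B ∈ powersetCard s A := by
    refine mem_powersetCard.2 ⟨hBA, ?_⟩
    have h1 := h.sum_fillingAmount hBA
    rw [← dimAt_ofAdj h.p_le (h.fillingAmount_self B), ← hTof, hdp] at h1
    omega
  refine ⟨B, hB, ?_⟩
  have hG : IsKP N (fun k => d k - dimAt N (ofAdj N p (fillingAmount d A q B)) k)
      (awayPart p F) := by
    refine ⟨hGsupp, fun k hk => ?_⟩
    change _ = d k - dimAt N (ofAdj N p (fillingAmount d A q B)) k
    rw [← hTof, ← hF.2 k hk]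
    nth_rw 2 [← hsum]
    rw [dimAt_add, Nat.add_sub_cancel_left]
  rw [fillingKP, (isKP_openKP N _).eq_of_pairing_eq_zero hG (pairing_openKP N _) hG0, ← hTof,
    hsum]

theorem IsFilling.two_mul_KPmin (h : IsFilling N d p A q) {s : ℕ}
    (hs : ∑ k ∈ A, d k + d p = #A * q + s) (hsA : s ≤ #A) :
    (2 * KPmin N d 0 : ℤ) = fillingCost d p A q := by
  obtain ⟨B, hB⟩ := Finset.powersetCard_nonempty.2 hsA
  obtain ⟨h1, h2, h3, -⟩ := h.fillingKP_spec hs hB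
  have hmem : pairing N (fillingKP N d p A q B) (fillingKP N d p A q B) ∈
      {n : ℕ | ∃ m : ℕ → ℕ → ℕ, IsKostant N d m ∧ m 0 N = 0 ∧ kpCodim N m = n} :=
    ⟨fun i j => fillingKP N d p A q B (i, j), (isKostant_iff N d _).2 h1, h2,
      kpCodim_eq_pairing N _⟩
  refine le_antisymm ?_ ?_
  · have := Nat.sInf_le hmem
    rw [← h3, KPmin]
    exact_mod_cast Nat.mul_le_mul_left 2 this
  · obtain ⟨m, hm1, hm2, hm3⟩ := Nat.sInf_mem ⟨_, hmem⟩
    rw [KPmin, ← hm3, kpCodim_eq_pairing]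
    exact (h.throughPart_cost_le_and_iff ((isKostant_iff N d m).1 hm1) hm2).1

theorem IsFilling.KPcount_eq (h : IsFilling N d p A q) {s : ℕ}
    (hs : ∑ k ∈ A, d k + d p = #A * q + s) (hsA : s ≤ #A) :
    KPcount N d 0 = (#A).choose s := by
  have hset : {m : ℕ → ℕ → ℕ | IsKostant N d m ∧ m 0 N = 0 ∧ kpCodim N m = KPmin N d 0} =
      (fun B i j => fillingKP N d p A q B (i, j)) '' (powersetCard s A : Set (Finset ℕ)) := by
    ext m
    simp only [Set.mem_ofPred_eq, Set.mem_image, Finset.mem_coe]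
    have hcost := h.two_mul_KPmin hs hsA
    constructor
    · rintro ⟨hm1, hm2, hm3⟩
      rw [kpCodim_eq_pairing] at hm3
      obtain ⟨B, hB, hBm⟩ := h.exists_fillingKP_eq hs ((isKostant_iff N d m).1 hm1) hm2
        (by rw [hm3, hcost])
      exact ⟨B, hB, by rw [hBm]⟩
    · rintro ⟨B, hB, rfl⟩
      obtain ⟨h1, h2, h3, -⟩ := h.fillingKP_spec hs hB
      refine ⟨(isKostant_iff N d _).2 h1, h2, ?_⟩
      rw [kpCodim_eq_pairing]
      change pairing N (fillingKP N d p A q B) (fillingKP N d p A q B) = _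
      omega
  rw [KPcount, hset, Set.InjOn.ncard_image, Set.ncard_coe_finset, card_powersetCard]
  intro B hB C hC hBC
  refine h.fillingKP_injOn hs hB hC ?_
  funext x
  exact congrFun (congrFun hBC x.1) x.2

end Filling

theorem two_mul_KPmin_and_KPcount_of_sorted {N : ℕ} {d d' : ℕ → ℕ}
    {σ : Equiv.Perm (Fin (N + 1))}
    (hσ : ∀ i : Fin (N + 1), d' (i : ℕ) = d ((σ i : Fin (N + 1)) : ℕ))
    (hmono : ∀ i : ℕ, i < N → d' i ≤ d' (i + 1)) {m q s : ℕ} (hm1 : 1 ≤ m) (hmN : m ≤ N)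
    (hS : ∑ i ∈ range (m + 1), d' i = m * q + s) (hs : s < m)
    (hmle : m * d' m ≤ ∑ i ∈ range (m + 1), d' i)
    (hmax : m < N → ∑ i ∈ range (m + 2), d' i < (m + 1) * d' (m + 1)) :
    (2 * KPmin N d 0 : ℤ) = (2 * q + 1) * (m * q + s) - m * (q ^ 2 + q) -
        ∑ i ∈ range (m + 1), (d' i : ℤ) ^ 2 ∧
      KPcount N d 0 = m.choose s := by
  let τ : ℕ → ℕ := fun i => if h : i < N + 1 then (σ ⟨i, h⟩ : ℕ) else 0
  have hτ : ∀ i (h : i < N + 1), τ i = σ ⟨i, h⟩ := fun i h => dif_pos h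
  have hdτ : ∀ i ≤ N, d (τ i) = d' i := fun i hi => by
    rw [hτ i (by omega), ← hσ]
  have hτN : ∀ i ≤ N, τ i ≤ N := fun i hi => by
    rw [hτ i (by omega)]
    exact Nat.le_of_lt_succ (σ _).isLt
  have hτinj : ∀ i ≤ N, ∀ j ≤ N, τ i = τ j → i = j := fun i hi j hj h => by
    rw [hτ i (by omega), hτ j (by omega)] at h
    simpa using σ.injective (Fin.ext h)
  have hτsurj : ∀ k ≤ N, ∃ i ≤ N, τ i = k := fun k hk => by
    refine ⟨σ.symm ⟨k, by omega⟩, Nat.le_of_lt_succ (Fin.isLt _), ?_⟩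
    rw [hτ _ (Fin.isLt _)]
    simp
  have hmono' : ∀ i j, i ≤ j → j ≤ N → d' i ≤ d' j := fun i j hij => by
    induction j, hij using Nat.le_induction with
    | base => exact fun _ => le_rfl
    | succ j _ ih => exact fun h => (ih (by omega)).trans (hmono j (by omega))
  have hq : d' m ≤ q := by
    by_contra! h
    have := Nat.mul_le_mul_left m (Nat.succ_le_of_lt h)
    rw [Nat.succ_eq_add_one, mul_add] at this
    omega
  have hq' : m < N → q < d' (m + 1) := fun h => by
    have h1 := hmax h
    rw [Finset.sum_range_succ, hS, add_mul] at h1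
    exact lt_of_mul_lt_mul_left (by omega : m * q < m * d' (m + 1)) (Nat.zero_le m)
  set A := (Icc 1 m).image τ with hA
  have hinj : Set.InjOn τ (Icc 1 m : Finset ℕ) := fun i hi j hj h => by
    simp only [Finset.coe_Icc, Set.mem_Icc] at hi hj
    exact hτinj i (by omega) j (by omega) h
  have hmemA : ∀ k, k ∈ A ↔ ∃ i, (1 ≤ i ∧ i ≤ m) ∧ τ i = k := by simp [hA]
  have hcard : #A = m := by simp [hA, Finset.card_image_of_injOn hinj]
  have hsumA : ∀ {R : Type} [AddCommMonoid R] (f : ℕ → R),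
      ∑ k ∈ A, f (d k) + f (d (τ 0)) = ∑ i ∈ range (m + 1), f (d' i) := by
    intro R _ f
    rw [hA, Finset.sum_image hinj, Finset.sum_range_succ', hdτ 0 (by omega),
      Finset.range_eq_Ico, Finset.sum_Ico_add' (fun i => f (d' i)) 0 m 1]
    congr 1
    refine Finset.sum_congr (by ext; simp) fun i hi => ?_
    simp only [mem_Ico] at hi
    rw [hdτ i (by omega)]
  have hfill : IsFilling N d (τ 0) A q := by
    refine ⟨hτN 0 (by omega), ?_, ?_, ?_, ?_, ?_, ?_⟩
    · intro k hk
      obtain ⟨i, hi, rfl⟩ := (hmemA k).1 hk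
      exact hτN i (by omega)
    · intro hk
      obtain ⟨i, hi, h⟩ := (hmemA _).1 hk
      have := hτinj i (by omega) 0 (by omega) h
      omega
    · intro k hk
      obtain ⟨i, hi, rfl⟩ := hτsurj k hk
      rw [hdτ i hi, hdτ 0 (by omega)]
      exact hmono' 0 i (by omega) hi
    · intro k hk
      obtain ⟨i, hi, rfl⟩ := (hmemA k).1 hk
      rw [hdτ i (by omega)]
      exact (hmono' i m hi.2 hmN).trans hq
    · intro k hk hk0 hkA
      obtain ⟨i, hi, rfl⟩ := hτsurj k hk
      have hi0 : i ≠ 0 := by rintro rfl; exact hk0 rfl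
      have him : m < i := by
        by_contra h
        exact hkA ((hmemA _).2 ⟨i, by omega, rfl⟩)
      rw [hdτ i hi]
      exact (hq' (by omega)).trans_le (hmono' (m + 1) i him hi)
    · rw [hdτ 0 (by omega)]
      exact (hmono' 0 m (by omega) hmN).trans hq
  have hsum : ∑ k ∈ A, d k + d (τ 0) = #A * q + s := by
    rw [hcard, ← hS]
    exact hsumA (fun n => n)
  refine ⟨?_, by rw [hfill.KPcount_eq hsum (by omega), hcard]⟩
  rw [hfill.two_mul_KPmin hsum (by omega), fillingCost, ← hsumA fun n => (n : ℤ) ^ 2]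
  have e : ∑ k ∈ A, ((d k : ℤ) - q) * (d k - q - 1) =
      ∑ k ∈ A, (d k : ℤ) ^ 2 - (2 * q + 1) * ∑ k ∈ A, (d k : ℤ) + m * (q ^ 2 + q) := by
    rw [← hcard, ← nsmul_eq_mul, ← Finset.sum_const, Finset.mul_sum, ← Finset.sum_sub_distrib,
      ← Finset.sum_add_distrib]
    exact Finset.sum_congr rfl fun k _ => by ring
  rw [hcard] at hsum
  zify at hsum
  rw [e, ← hsum]
  ring

theorem choose_natAbs_sub_mul_floor {m q s : ℕ} (hs : s < m) :
    m.choose (((m * q + s : ℕ) : ℤ) - (m : ℤ) *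
      ⌊(((m * q + s : ℕ) : ℤ) : ℝ) / m + 1 / 2⌋).natAbs = m.choose s := by
  have hm : (0 : ℝ) < m := by exact_mod_cast (Nat.zero_le s).trans_lt hs
  have hdiv : (((m * q + s : ℕ) : ℤ) : ℝ) / m = q + s / m := by
    push_cast
    field_simp
  rw [hdiv]
  have hs0 : (0 : ℝ) ≤ s / m := by positivity
  have hs1 : (s : ℝ) / m < 1 := by rw [div_lt_one hm]; exact_mod_cast hs
  rcases lt_or_ge ((s : ℝ) / m) (1 / 2) with h | h
  · have : ⌊(q : ℝ) + s / m + 1 / 2⌋ = q := by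
      rw [Int.floor_eq_iff]
      push_cast
      constructor <;> linarith
    rw [this]
    congr 1
    push_cast
    omega
  · have : ⌊(q : ℝ) + s / m + 1 / 2⌋ = q + 1 := by
      rw [Int.floor_eq_iff]
      push_cast
      constructor <;> linarith
    rw [this, ← Nat.choose_symm hs.le]
    congr 1
    push_cast
    rw [mul_add, mul_one]
    omega

end

/-- The explicit formula for the codimension of `Σ^0_d` and for its number of
top-dimensional irreducible components, in terms of the weakly increasing
rearrangement `d'` of `d`, the cutoff `m`, and `S = Σ_{i=0}^m d'_i`. -/
theorem stmt12 (N : ℕ) (hN : 1 ≤ N) (d : ℕ → ℕ) (hd : ∀ i ≤ N, 1 ≤ d i)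
    (d' : ℕ → ℕ) (σ : Equiv.Perm (Fin (N + 1)))
    (hσ : ∀ i : Fin (N + 1), d' (i : ℕ) = d ((σ i : Fin (N + 1)) : ℕ))
    (hmono : ∀ i : ℕ, i < N → d' i ≤ d' (i + 1))
    (m : ℕ) (hm1 : 1 ≤ m) (hmN : m ≤ N)
    (hmle : (m : ℤ) * d' m ≤ ∑ i ∈ Finset.range (m + 1), (d' i : ℤ))
    (hmax : ∀ l : ℕ, m < l → l ≤ N →
      ∑ i ∈ Finset.range (l + 1), (d' i : ℤ) < (l : ℤ) * d' l) :
    let S : ℤ := ∑ i ∈ Finset.range (m + 1), (d' i : ℤ)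
    (KPmin N d 0 : ℝ) =
        (m : ℝ) / 2 * Int.fract ((S : ℝ) / m) * (1 - Int.fract ((S : ℝ) / m)) -
          (m : ℝ) * ((m : ℝ) - 1) / 2 * ((S : ℝ) / m) ^ 2 +
          ∑ j ∈ Finset.range (m + 1), ∑ i ∈ Finset.range j, (d' i : ℝ) * (d' j : ℝ) ∧
      KPcount N d 0 = m.choose (S - (m : ℤ) * ⌊(S : ℝ) / m + 1 / 2⌋).natAbs := by
  intro S
  obtain ⟨q, s, hs, hSn⟩ : ∃ q s, s < m ∧ ∑ i ∈ Finset.range (m + 1), d' i = m * q + s :=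
    ⟨_, _, Nat.mod_lt _ hm1, (Nat.div_add_mod _ m).symm⟩
  have hS : S = ((m * q + s : ℕ) : ℤ) := by
    rw [← hSn, Nat.cast_sum]
  obtain ⟨hmin, hcount⟩ := two_mul_KPmin_and_KPcount_of_sorted hσ hmono hm1 hmN hSn hs
    (by exact_mod_cast hmle)
    (fun h => by exact_mod_cast hmax (m + 1) (Nat.lt_succ_self m) h)
  refine ⟨?_, by rw [hcount, hS, choose_natAbs_sub_mul_floor hs]⟩
  have hm : (0 : ℝ) < m := by exact_mod_cast hm1
  have hfract : Int.fract ((S : ℝ) / m) = s / m := by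
    rw [Int.fract_eq_iff]
    refine ⟨by positivity, by rw [div_lt_one hm]; exact_mod_cast hs, q, ?_⟩
    rw [hS]
    push_cast
    field_simp
    ring
  have hpairs := two_mul_sum_range (fun i => (d' i : ℝ)) m
  have hE : ∑ b ∈ Finset.range m, (d' (b + 1) : ℝ) * ∑ c ∈ Finset.range (b + 1), (d' c : ℝ) =
      ∑ j ∈ Finset.range (m + 1), ∑ i ∈ Finset.range j, (d' i : ℝ) * (d' j : ℝ) := by
    rw [Finset.sum_range_succ' (fun j => ∑ i ∈ Finset.range j, (d' i : ℝ) * (d' j : ℝ))]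
    simp only [Finset.range_zero, Finset.sum_empty, mul_zero, add_zero, ← Finset.sum_mul, mul_comm]
  have hmin' : (2 * KPmin N d 0 : ℝ) = (2 * q + 1) * (m * q + s) - m * (q ^ 2 + q) -
      ∑ i ∈ Finset.range (m + 1), (d' i : ℝ) ^ 2 := by exact_mod_cast hmin
  have hSr : ∑ i ∈ Finset.range (m + 1), (d' i : ℝ) = m * q + s := by exact_mod_cast hSn
  rw [hE, hSr] at hpairs
  have hgoal : (m : ℝ) / 2 * (s / m) * (1 - s / m) -
      m * (m - 1) / 2 * (((m : ℝ) * q + s) / m) ^ 2 =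
      ((2 * q + 1) * (m * q + s) - m * (q ^ 2 + q) - (m * q + s) ^ 2) / 2 := by
    field_simp
    ring
  rw [hfract, hS]
  push_cast
  rw [hgoal]
  linarith
end

section
/- Fix N ≥ 1, d ∈ ℕ^{N+1}, and a complex d_N × d_0 matrix B with rank(B) = min_{0 ≤ i ≤ N} d_i. Then the set { (A_1, …, A_N) ∈ Π_{i=1}^N Mat_{d_i × d_{i−1}}(ℂ) : A_N A_{N−1} ⋯ A_1 = B } is a nonempty connected subset of Π_{i=1}^N Mat_{d_i × d_{i−1}}(ℂ) in the Euclidean topology. -/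
/-- The iterated product `A_n ⋯ A_2 A_1` of a tuple of composable matrices. -/
def matProd (k : Type) [Field k] (d : ℕ → ℕ)
    (A : ∀ i : ℕ, Matrix (Fin (d (i + 1))) (Fin (d i)) k) :
    ∀ n : ℕ, Matrix (Fin (d n)) (Fin (d 0)) k
  | 0 => (1 : Matrix (Fin (d 0)) (Fin (d 0)) k)
  | n + 1 => A n * matProd k d A n

open Polynomial in
/-- The complement of the zero locus of a function which is polynomial along every complex line
is preconnected. -/
theorem isPreconnected_ne_zero_of_polynomial_on_lines {E : Type*} [AddCommGroup E] [Module ℂ E]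
    [TopologicalSpace E] [ContinuousAdd E] [ContinuousSMul ℂ E] (f : E → ℂ)
    (hf : ∀ x v : E, ∃ p : ℂ[X], ∀ t : ℂ, p.eval t = f (x + t • v)) :
    IsPreconnected {x | f x ≠ 0} := by
  refine isPreconnected_of_forall_pair fun x hx y hy => ?_
  obtain ⟨p, hp⟩ := hf x (y - x)
  have hp0 : p ≠ 0 := by
    rintro rfl
    exact hx (by simpa using (hp 0).symm)
  have hfin : {t : ℂ | p.IsRoot t}.Finite := p.finite_setOfPred_isRoot hp0
  have hconn : IsPreconnected ({t : ℂ | p.IsRoot t}ᶜ) :=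
    (hfin.countable.isPathConnected_compl_of_one_lt_rank (by simp)).isConnected.isPreconnected
  refine ⟨(fun t : ℂ => x + t • (y - x)) '' {t : ℂ | p.IsRoot t}ᶜ, ?_, ⟨0, ?_, by simp⟩,
    ⟨1, ?_, by simp⟩, hconn.image _ (by fun_prop)⟩
  · rintro _ ⟨t, ht, rfl⟩
    exact fun h => ht ((hp t).trans h)
  · exact fun h => hx (by simpa using (hp 0).symm.trans h)
  · exact fun h => hy (by simpa using (hp 1).symm.trans h)

open Polynomial in
theorem exists_polynomial_matrix_mul {l m n : Type*} [Fintype m] {F : ℂ → Matrix l m ℂ}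
    {G : ℂ → Matrix m n ℂ} (hF : ∃ P : Matrix l m ℂ[X], ∀ t, P.map (eval t) = F t)
    (hG : ∃ P : Matrix m n ℂ[X], ∀ t, P.map (eval t) = G t) :
    ∃ P : Matrix l n ℂ[X], ∀ t, P.map (eval t) = F t * G t := by
  obtain ⟨P, hP⟩ := hF
  obtain ⟨Q, hQ⟩ := hG
  refine ⟨P * Q, fun t => ?_⟩
  rw [← hP, ← hQ]
  exact Matrix.map_mul (f := evalRingHom t)

open Polynomial in
theorem exists_polynomial_matrix_line {m n : Type*} (M D : Matrix m n ℂ) :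
    ∃ P : Matrix m n ℂ[X], ∀ t, P.map (eval t) = M + t • D :=
  ⟨.of fun i j => C (M i j) + X * C (D i j), fun t => by ext; simpa using mul_comm _ _⟩

open Polynomial in
theorem exists_polynomial_matProd_line (d : ℕ → ℕ)
    (A D : ∀ i : ℕ, Matrix (Fin (d (i + 1))) (Fin (d i)) ℂ) (n : ℕ) :
    ∃ P : Matrix (Fin (d n)) (Fin (d 0)) ℂ[X],
      ∀ t : ℂ, P.map (eval t) = matProd ℂ d (A + t • D) n := by
  induction n with
  | zero => exact ⟨1, fun t => Matrix.map_one _ eval_zero eval_one⟩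
  | succ n ih => exact exists_polynomial_matrix_mul (exists_polynomial_matrix_line (A n) (D n)) ih

theorem matProd_add (d : ℕ → ℕ) (A : ∀ i : ℕ, Matrix (Fin (d (i + 1))) (Fin (d i)) ℂ)
    (m k : ℕ) :
    matProd ℂ d A (m + k) =
      matProd ℂ (fun i => d (m + i)) (fun i => A (m + i)) k * matProd ℂ d A m := by
  induction k with
  | zero => exact (Matrix.one_mul _).symm
  | succ k ih =>
    change A (m + k) * matProd ℂ d A (m + k) = (A (m + k) * _) * _
    rw [ih, Matrix.mul_assoc]

theorem matProd_congr (d : ℕ → ℕ) {A A' : ∀ i : ℕ, Matrix (Fin (d (i + 1))) (Fin (d i)) ℂ}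
    {n : ℕ} (h : ∀ i < n, A i = A' i) : matProd ℂ d A n = matProd ℂ d A' n := by
  induction n with
  | zero => rfl
  | succ n ih =>
    rw [matProd, matProd, h n n.lt_succ_self, ih fun i hi => h i (hi.trans n.lt_succ_self)]

theorem matProd_update_zero (d : ℕ → ℕ)
    (A : ∀ i : ℕ, Matrix (Fin (d (i + 1))) (Fin (d i)) ℂ) (S : Matrix (Fin (d 0)) (Fin (d 0)) ℂ)
    (n : ℕ) :
    matProd ℂ d (Function.update A 0 (A 0 * S)) (n + 1) = matProd ℂ d A (n + 1) * S := by
  induction n with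
  | zero => simp [matProd]
  | succ n ih =>
    rw [matProd, ih, Function.update_of_ne n.succ_ne_zero, ← Matrix.mul_assoc]
    rfl

theorem matProd_update_last (d : ℕ → ℕ)
    (A : ∀ i : ℕ, Matrix (Fin (d (i + 1))) (Fin (d i)) ℂ) (n : ℕ)
    (T : Matrix (Fin (d (n + 1))) (Fin (d (n + 1))) ℂ) :
    matProd ℂ d (Function.update A n (T * A n)) (n + 1) = T * matProd ℂ d A (n + 1) := by
  rw [matProd, matProd, Function.update_self, Matrix.mul_assoc,
    matProd_congr d fun i hi => Function.update_of_ne hi.ne _ _]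

theorem continuous_matProd (d : ℕ → ℕ) (n : ℕ) :
    Continuous fun A : ∀ i : ℕ, Matrix (Fin (d (i + 1))) (Fin (d i)) ℂ => matProd ℂ d A n := by
  induction n with
  | zero => exact continuous_const
  | succ n ih => exact (continuous_apply n).matrix_mul ih

/-- The `a × b` matrix with ones at the first `r` diagonal positions and zeros elsewhere. -/
def rectDiag (r a b : ℕ) : Matrix (Fin a) (Fin b) ℂ :=
  .of fun i j => if (i : ℕ) = j ∧ (i : ℕ) < r then 1 else 0

theorem rectDiag_self (r : ℕ) : rectDiag r r r = 1 := by
  ext i j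
  simp [rectDiag, Matrix.one_apply, Fin.ext_iff]

theorem rectDiag_mul {r b : ℕ} (a c : ℕ) (h : r ≤ b) :
    rectDiag r a b * rectDiag r b c = rectDiag r a c := by
  ext i j
  simp only [rectDiag, Matrix.mul_apply, Matrix.of_apply, mul_ite, mul_one, mul_zero]
  by_cases hi : (i : ℕ) < r
  · rw [Finset.sum_eq_single (⟨i, hi.trans_le h⟩ : Fin b)]
    · simp [hi]
    · intro k _ hk
      have : (i : ℕ) ≠ k := fun e => hk (Fin.ext e.symm)
      simp [this]
    · simp
  · simp [hi]

theorem matProd_rectDiag_mul (d : ℕ → ℕ) (r n : ℕ) (h : ∀ i ≤ n, r ≤ d i) :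
    matProd ℂ d (fun i => rectDiag r (d (i + 1)) (d i)) n * rectDiag r (d 0) r =
      rectDiag r (d n) r := by
  induction n with
  | zero => exact Matrix.one_mul _
  | succ n ih =>
    rw [matProd, Matrix.mul_assoc, ih fun i hi => h i (hi.trans n.le_succ),
      rectDiag_mul _ _ (h n n.le_succ)]

theorem exists_rank_factorization {p q r : ℕ} (B : Matrix (Fin p) (Fin q) ℂ) (hB : B.rank = r) :
    ∃ (L : Matrix (Fin p) (Fin r) ℂ) (R : Matrix (Fin r) (Fin q) ℂ)
      (L' : Matrix (Fin r) (Fin p) ℂ) (R' : Matrix (Fin q) (Fin r) ℂ),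
      B = L * R ∧ L' * L = 1 ∧ R * R' = 1 := by
  let f := Matrix.toLin' B
  have hr : Module.finrank ℂ (LinearMap.range f) = Module.finrank ℂ (Fin r → ℂ) := by
    rw [Module.finrank_fin_fun, ← hB]
    rfl
  let e := LinearEquiv.ofFinrankEq _ _ hr
  let l := (LinearMap.range f).subtype ∘ₗ e.symm.toLinearMap
  let s := e.toLinearMap ∘ₗ f.rangeRestrict
  obtain ⟨linv, hlinv⟩ := l.exists_leftInverse_of_injective
    (LinearMap.ker_eq_bot.2 (Subtype.val_injective.comp e.symm.injective))
  obtain ⟨sinv, hsinv⟩ := s.exists_rightInverse_of_surjective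
    (LinearMap.range_eq_top.2 (e.surjective.comp f.surjective_rangeRestrict))
  refine ⟨LinearMap.toMatrix' l, LinearMap.toMatrix' s, LinearMap.toMatrix' linv,
    LinearMap.toMatrix' sinv, ?_, ?_, ?_⟩
  · have hls : l ∘ₗ s = f := by
      ext
      simp [l, s]
    rw [← LinearMap.toMatrix'_comp, hls, LinearMap.toMatrix'_toLin']
  · rw [← LinearMap.toMatrix'_comp, hlinv, LinearMap.toMatrix'_id]
  · rw [← LinearMap.toMatrix'_comp, hsinv, LinearMap.toMatrix'_id]

theorem isConnected_det_mul_matProd_mul_ne_zero {E : Type*} [AddCommGroup E] [Module ℂ E]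
    [TopologicalSpace E] [ContinuousAdd E] [ContinuousSMul ℂ E] (d : ℕ → ℕ) (r n : ℕ)
    (h : ∀ i ≤ n, r ≤ d i) :
    IsConnected {v : (∀ i : ℕ, Matrix (Fin (d (i + 1))) (Fin (d i)) ℂ) ×
      Matrix (Fin (d 0)) (Fin r) ℂ × Matrix (Fin r) (Fin (d n)) ℂ × E |
        (v.2.2.1 * (matProd ℂ d v.1 n * v.2.1)).det ≠ 0} := by
  refine ⟨⟨(fun i => rectDiag r (d (i + 1)) (d i), rectDiag r (d 0) r, rectDiag r r (d n), 0), ?_⟩,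
    isPreconnected_ne_zero_of_polynomial_on_lines _ fun x v => ?_⟩
  · simp [matProd_rectDiag_mul d r n h, rectDiag_mul _ _ (h n le_rfl), rectDiag_self]
  · obtain ⟨P, hP⟩ := exists_polynomial_matrix_mul
      (exists_polynomial_matrix_line x.2.2.1 v.2.2.1)
      (exists_polynomial_matrix_mul (exists_polynomial_matProd_line d x.1 v.1 n)
        (exists_polynomial_matrix_line x.2.1 v.2.1))
    refine ⟨P.det, fun t => ?_⟩
    have hdet := RingHom.map_det (Polynomial.evalRingHom t) P
    rw [RingHom.mapMatrix_apply, Polynomial.coe_evalRingHom, hP] at hdet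
    exact hdet

theorem isConnected_setOf_mul_matProd_mul_eq (d : ℕ → ℕ) {n m p q : ℕ} (hm : m ≤ n)
    (hd : ∀ i ≤ n, d m ≤ d i) (B : Matrix (Fin p) (Fin q) ℂ) (hB : B.rank = d m) :
    IsConnected {y : (∀ i : ℕ, Matrix (Fin (d (i + 1))) (Fin (d i)) ℂ) ×
      Matrix (Fin p) (Fin (d n)) ℂ × Matrix (Fin (d 0)) (Fin q) ℂ |
        y.2.1 * (matProd ℂ d y.1 n * y.2.2) = B} := by
  obtain ⟨L, R, L', R', rfl, hL, hR⟩ := exists_rank_factorization B hB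
  have hD := isConnected_iff_connectedSpace.1 (isConnected_det_mul_matProd_mul_ne_zero
    (E := Matrix (Fin p) (Fin (d n)) ℂ × Matrix (Fin (d 0)) (Fin q) ℂ) d (d m) n hd)
  have hfac : ∀ A : ∀ i : ℕ, Matrix (Fin (d (i + 1))) (Fin (d i)) ℂ,
      ∃ (M : Matrix (Fin (d n)) (Fin (d m)) ℂ), matProd ℂ d A n = M * matProd ℂ d A m := by
    obtain ⟨k, rfl⟩ := Nat.exists_eq_add_of_le hm
    exact fun A => ⟨_, matProd_add d A m k⟩
  set D := {v : (∀ i : ℕ, Matrix (Fin (d (i + 1))) (Fin (d i)) ℂ) ×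
      Matrix (Fin (d 0)) (Fin (d m)) ℂ × Matrix (Fin (d m)) (Fin (d n)) ℂ ×
      Matrix (Fin p) (Fin (d n)) ℂ × Matrix (Fin (d 0)) (Fin q) ℂ |
        (v.2.2.1 * (matProd ℂ d v.1 n * v.2.1)).det ≠ 0}
  let K : D → Matrix (Fin (d m)) (Fin (d m)) ℂ :=
    fun v => v.1.2.2.1 * (matProd ℂ d v.1.1 n * v.1.2.1)
  have hP : Continuous fun v : D => matProd ℂ d v.1.1 n :=
    (continuous_matProd d n).comp (continuous_fst.comp continuous_subtype_val)
  have hX : Continuous fun v : D => v.1.2.1 := by fun_prop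
  have hY : Continuous fun v : D => v.1.2.2.1 := by fun_prop
  have hT : Continuous fun v : D => v.1.2.2.2.1 := by fun_prop
  have hS : Continuous fun v : D => v.1.2.2.2.2 := by fun_prop
  have hK : Continuous K := hY.matrix_mul (hP.matrix_mul hX)
  have hKinv : Continuous fun v => (K v)⁻¹ := by
    simp_rw [Matrix.inv_def, Ring.inverse_eq_inv']
    exact (hK.matrix_det.inv₀ fun v => v.2).smul hK.matrix_adjugate
  let Φ : D → (∀ i : ℕ, Matrix (Fin (d (i + 1))) (Fin (d i)) ℂ) ×
      Matrix (Fin p) (Fin (d n)) ℂ × Matrix (Fin (d 0)) (Fin q) ℂ := fun v =>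
    (v.1.1,
      L * ((K v)⁻¹ * v.1.2.2.1) +
        v.1.2.2.2.1 * (1 - matProd ℂ d v.1.1 n * (v.1.2.1 * ((K v)⁻¹ * v.1.2.2.1))),
      v.1.2.1 * R + (1 - v.1.2.1 * ((K v)⁻¹ * (v.1.2.2.1 * matProd ℂ d v.1.1 n))) * v.1.2.2.2.2)
  have hΦ : Continuous Φ := by
    have hZ := hKinv.matrix_mul hY
    refine (continuous_fst.comp continuous_subtype_val).prodMk (.prodMk ?_ ?_)
    · exact (continuous_const.matrix_mul hZ).add
        (hT.matrix_mul (continuous_const.sub (hP.matrix_mul (hX.matrix_mul hZ))))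
    · exact (hX.matrix_mul continuous_const).add
        ((continuous_const.sub (hX.matrix_mul (hKinv.matrix_mul (hY.matrix_mul hP)))).matrix_mul hS)
  convert isConnected_range hΦ using 1
  ext ⟨A, T, S⟩
  obtain ⟨M, hM⟩ := hfac A
  constructor
  · intro h
    have h : T * (matProd ℂ d A n * S) = L * R := h
    set Q := matProd ℂ d A m
    have h1 : (L' * T * M) * (Q * S * R') = 1 := by
      calc _ = L' * (T * (matProd ℂ d A n * S)) * R' := by simp only [hM, Matrix.mul_assoc]
        _ = (L' * L) * (R * R') := by simp only [h, Matrix.mul_assoc]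
        _ = 1 := by rw [hL, hR, Matrix.one_mul]
    have hKv : L' * T * (matProd ℂ d A n * (S * R')) = 1 := by
      rw [← h1, hM]; simp only [Matrix.mul_assoc]
    have h2 := mul_eq_one_comm.1 h1
    refine ⟨⟨(A, S * R', L' * T, T, S), by simp only [D, Set.mem_ofPred_eq, hKv]; simp⟩, ?_⟩
    simp only [Φ, K, hKv, inv_one, Matrix.one_mul]
    have h3 : T * M = L * (L' * T * M) := by
      calc T * M = T * M * ((Q * S * R') * (L' * T * M)) := by rw [h2, Matrix.mul_one]
        _ = (T * ((M * Q) * S)) * R' * (L' * T * M) := by simp only [Matrix.mul_assoc]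
        _ = L * (R * R') * (L' * T * M) := by rw [← hM, h]; simp only [Matrix.mul_assoc]
        _ = _ := by rw [hR, Matrix.mul_one]
    have h4 : T * matProd ℂ d A n * (S * R') = L := by
      calc _ = (T * (matProd ℂ d A n * S)) * R' := by simp only [Matrix.mul_assoc]
        _ = L := by rw [h, Matrix.mul_assoc, hR, Matrix.mul_one]
    have h5 : L' * T * matProd ℂ d A n * S = R := by
      calc _ = L' * (T * (matProd ℂ d A n * S)) := by simp only [Matrix.mul_assoc]
        _ = R := by rw [h, ← Matrix.mul_assoc, hL, Matrix.one_mul]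
    refine Prod.ext rfl (Prod.ext ?_ ?_)
    · simp only [Matrix.mul_sub, Matrix.mul_one]
      rw [← Matrix.mul_assoc T, ← Matrix.mul_assoc _ (S * R'), h4]
      abel
    · simp only [Matrix.sub_mul, Matrix.one_mul]
      rw [Matrix.mul_assoc (S * R'), h5]
      abel
  · rintro ⟨v, hv⟩
    obtain rfl : v.1.1 = A := congrArg Prod.fst hv
    rw [← hv]
    have hdet : IsUnit (K v).det := isUnit_iff_ne_zero.2 v.2
    have hKK : K v = v.1.2.2.1 * (matProd ℂ d v.1.1 n * v.1.2.1) := rfl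
    simp only [Set.mem_ofPred_eq, Φ]
    generalize K v = K' at *
    generalize matProd ℂ d v.1.1 n = P at *
    generalize matProd ℂ d v.1.1 m = Q at *
    generalize v.1.2.1 = X at *
    generalize v.1.2.2.1 = Y at *
    have h1 : (Y * M) * ((Q * X) * K'⁻¹) = 1 := by
      calc _ = Y * ((M * Q) * X) * K'⁻¹ := by simp only [Matrix.mul_assoc]
        _ = 1 := by rw [← hM, ← hKK, Matrix.mul_nonsing_inv _ hdet]
    have h2 : P * (X * (K'⁻¹ * (Y * P))) = P := by
      calc _ = M * ((Q * X * K'⁻¹) * (Y * M)) * Q := by rw [hM]; simp only [Matrix.mul_assoc]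
        _ = P := by rw [mul_eq_one_comm.1 h1, Matrix.mul_one, hM]
    have h3 : P * (X * R + (1 - X * (K'⁻¹ * (Y * P))) * v.1.2.2.2.2) = P * X * R := by
      rw [Matrix.mul_add, ← Matrix.mul_assoc P (1 - _), Matrix.mul_sub, h2, Matrix.mul_one, sub_self,
        Matrix.zero_mul, add_zero, Matrix.mul_assoc]
    have h4 : K'⁻¹ * (Y * (P * X)) = 1 := by rw [← hKK, Matrix.nonsing_inv_mul _ hdet]
    rw [h3, Matrix.add_mul, ← Matrix.mul_assoc _ (P * X), ← Matrix.mul_assoc _ (P * X)]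
    simp only [Matrix.mul_assoc, Matrix.sub_mul, Matrix.mul_sub, Matrix.one_mul]
    have h5 : K'⁻¹ * (Y * (P * (X * R))) = R := by
      calc _ = K'⁻¹ * (Y * (P * X)) * R := by simp only [Matrix.mul_assoc]
        _ = R := by rw [h4, Matrix.one_mul]
    simp [h5]

/-- If `rank B = min_{0 ≤ i ≤ N} d_i`, then the fiber `mult⁻¹(B)` of the matrix
multiplication map is a nonempty connected subset of the space of tuples of
composable complex matrices (with its Euclidean topology). -/
theorem stmt14 (N : ℕ) (hN : 1 ≤ N) (d : ℕ → ℕ)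
    (B : Matrix (Fin (d N)) (Fin (d 0)) ℂ)
    (hB : B.rank = (Finset.range (N + 1)).inf' ⟨0, by simp⟩ d) :
    IsConnected {x : ∀ i : Fin N, Matrix (Fin (d ((i : ℕ) + 1))) (Fin (d (i : ℕ))) ℂ |
      matProd ℂ d (fun i => if h : i < N then x ⟨i, h⟩ else 0) N = B} := by
  obtain ⟨n, rfl⟩ := Nat.exists_eq_add_of_le' hN
  obtain ⟨m, hm, hdm⟩ := Finset.exists_mem_eq_inf' (s := Finset.range (n + 1 + 1)) ⟨0, by simp⟩ d
  have hd : ∀ i ≤ n + 1, d m ≤ d i := fun i hi =>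
    hdm ▸ Finset.inf'_le d (Finset.mem_range.2 (Nat.lt_succ_of_le hi))
  have hG := isConnected_setOf_mul_matProd_mul_eq d (Nat.le_of_lt_succ (Finset.mem_range.1 hm)) hd B
    (hB.trans hdm)
  let Ψ : (∀ i : ℕ, Matrix (Fin (d (i + 1))) (Fin (d i)) ℂ) ×
      Matrix (Fin (d (n + 1))) (Fin (d (n + 1))) ℂ × Matrix (Fin (d 0)) (Fin (d 0)) ℂ →
      ∀ i : ℕ, Matrix (Fin (d (i + 1))) (Fin (d i)) ℂ := fun y =>
    let A := Function.update y.1 0 (y.1 0 * y.2.2)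
    Function.update A n (y.2.1 * A n)
  have hΨ : Continuous Ψ := by
    have hA : Continuous fun y : (∀ i : ℕ, Matrix (Fin (d (i + 1))) (Fin (d i)) ℂ) ×
        Matrix (Fin (d (n + 1))) (Fin (d (n + 1))) ℂ × Matrix (Fin (d 0)) (Fin (d 0)) ℂ =>
        Function.update y.1 0 (y.1 0 * y.2.2) :=
      continuous_fst.update 0
        (((continuous_apply 0).comp continuous_fst).matrix_mul (by fun_prop))
    exact hA.update n (Continuous.matrix_mul (by fun_prop) ((continuous_apply n).comp hA))
  have hΨ_one : ∀ A : ∀ i : ℕ, Matrix (Fin (d (i + 1))) (Fin (d i)) ℂ, Ψ (A, 1, 1) = A :=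
    fun A => by simp [Ψ]
  have hext : ∀ A : ∀ i : ℕ, Matrix (Fin (d (i + 1))) (Fin (d i)) ℂ,
      matProd ℂ d (fun i => if i < n + 1 then A i else 0) (n + 1) = matProd ℂ d A (n + 1) :=
    fun A => matProd_congr d fun i hi => if_pos hi
  convert hG.image (fun y (i : Fin (n + 1)) => Ψ y i)
    (continuous_pi fun i : Fin (n + 1) => (continuous_apply (i : ℕ)).comp hΨ).continuousOn using 1
  ext x
  constructor
  · intro hx
    refine ⟨(fun i => if h : i < n + 1 then x ⟨i, h⟩ else 0, 1, 1), ?_, ?_⟩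
    · simpa using hx
    · funext i
      exact (congrFun (hΨ_one _) i).trans (dif_pos i.2)
  · rintro ⟨⟨A, T, S⟩, hy, rfl⟩
    simp only [Set.mem_ofPred_eq, dite_eq_ite] at hy ⊢
    rw [hext, ← hy, matProd_update_last, matProd_update_zero]
end
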